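/- arXiv:0902.1738 — 6 statements merged into one kernel-verified Lean document; each statement's English description precedes it below -/
import Mathlib

section
/- (Baer–Suzuki) Let G be a finite group and x ∈ G. If for every g ∈ G the subgroup ⟨x, g⁻¹xg⟩ generated by x and its conjugate is nilpotent, then the normal closure ⟨x^G⟩ of x in G is nilpotent; that is, x lies in the Fitting subgroup of G. -/
/-- Let `D ≤ P` with `P` nilpotent and let `K` be closed under conjugation. If `D` does not contain
`P ∩ K`, then some element of `P ∩ K` outside `D` normalizes the subgroup generated by `D ∩ K`. -/
theorem Subgroup.exists_mem_normalizer_closure_inter {G : Type*} [Group G] [Finite G]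
    {P D : Subgroup G} (hP : Group.IsNilpotent P) {K : Set G}
    (hK : ∀ g : G, ∀ k ∈ K, g * k * g⁻¹ ∈ K) (hDP : D ≤ P) (hD : ¬ (P ∩ K : Set G) ⊆ D) :
    ∃ y ∈ P, y ∈ K ∧ y ∉ D ∧
      y ∈ Subgroup.normalizer (Subgroup.closure (D ∩ K : Set G) : Set G) := by
  obtain ⟨E, hDE, hE⟩ :=
    (Set.toFinite {E : Subgroup G | E ≤ P ∧ (E ∩ K : Set G) ⊆ D}).exists_le_maximal
      (a := D) ⟨hDP, Set.inter_subset_left⟩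
  obtain ⟨⟨hEP, hED⟩, hmax⟩ := hE
  have hEK : (E ∩ K : Set G) = (D ∩ K : Set G) :=
    Set.Subset.antisymm (fun k hk => ⟨hED hk, hk.2⟩) fun k hk => ⟨hDE hk.1, hk.2⟩
  have hlt : E.subgroupOf P < ⊤ := by
    rw [lt_top_iff_ne_top, Ne, Subgroup.subgroupOf_eq_top]
    exact fun hPE => hD fun k hk => hED ⟨hPE hk.1, hk.2⟩
  have hnorm := Group.normalizerCondition_of_isNilpotent (G := P) _ hlt
  set N : Subgroup P := Subgroup.normalizer (E.subgroupOf P : Set P)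
  have hEN : E ≤ N.map P.subtype := by
    intro e he
    exact ⟨⟨e, hEP he⟩, hnorm.le (Subgroup.mem_subgroupOf.2 he), rfl⟩
  have hNK : ¬ ((N.map P.subtype : Subgroup G) ∩ K : Set G) ⊆ D := by
    intro hsub
    have hle := hmax ⟨Subgroup.map_subtype_le N, hsub⟩ hEN
    exact hnorm.not_ge fun n hn => Subgroup.mem_subgroupOf.2 (hle ⟨n, hn, rfl⟩)
  obtain ⟨_, ⟨⟨y, hyN, rfl⟩, hyK⟩, hyD⟩ := Set.not_subset.1 hNK
  refine ⟨y, y.2, hyK, hyD, ?_⟩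
  rw [← hEK]
  apply Subgroup.normalizer_le_normalizer_closure
  have hyE : ∀ e ∈ E, (y : G) * e * (y : G)⁻¹ ∈ E := fun e he =>
    (Subgroup.mem_normalizer_iff.1 hyN ⟨e, hEP he⟩).1 he
  have hyE' : ∀ e, e ∈ P → (y : G) * e * (y : G)⁻¹ ∈ E → e ∈ E := fun e he h =>
    (Subgroup.mem_normalizer_iff.1 hyN ⟨e, he⟩).2 h
  refine Subgroup.mem_set_normalizer_iff.2 fun k =>
    ⟨fun hk => ⟨hyE k hk.1, hK _ k hk.2⟩, fun hk => ?_⟩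
  have hk' : (y : G)⁻¹ * ((y : G) * k * (y : G)⁻¹) * (y : G)⁻¹⁻¹ = k := by group
  have hkP : k ∈ P := by
    rw [← hk']
    exact P.mul_mem (P.mul_mem (P.inv_mem y.2) (hEP hk.1)) (P.inv_mem (P.inv_mem y.2))
  exact ⟨hyE' k hkP hk.1, hk' ▸ hK (y : G)⁻¹ _ hk.2⟩

open scoped Pointwise in
/-- A conjugation-invariant set in which any two elements generate a `p`-group meets all Sylow
`p`-subgroups in the same set. -/
theorem Sylow.inter_eq_of_isPGroup_closure_pair {G : Type*} [Group G] [Finite G] {p : ℕ}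
    [Fact p.Prime] {K : Set G} (hK : ∀ g : G, ∀ k ∈ K, g * k * g⁻¹ ∈ K)
    (hpair : ∀ y ∈ K, ∀ z ∈ K, IsPGroup p (Subgroup.closure ({y, z} : Set G)))
    (P Q : Sylow p G) : (P ∩ K : Set G) = (Q ∩ K : Set G) := by
  have hcard : ∀ P Q : Sylow p G, (P ∩ K : Set G).ncard ≤ (Q ∩ K : Set G).ncard := by
    intro P Q
    obtain ⟨g, rfl⟩ := MulAction.exists_smul_eq G P Q
    refine Set.ncard_le_ncard_of_injOn (fun k => g * k * g⁻¹) ?_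
      (fun a _ b _ hab => by simpa using hab)
    intro k hk
    exact ⟨Subgroup.smul_mem_pointwise_smul k (MulAut.conj g) (P : Subgroup G) hk.1, hK g k hk.2⟩
  by_contra hne
  obtain ⟨⟨P, Q⟩, hPQ : (P ∩ K : Set G) ≠ (Q ∩ K : Set G), hmax⟩ :=
    Set.exists_max_image {R : Sylow p G × Sylow p G | (R.1 ∩ K : Set G) ≠ (R.2 ∩ K : Set G)}
      (fun R => ((R.1 ∩ R.2 : Set G) ∩ K).ncard) (Set.toFinite _) ⟨(P, Q), hne⟩
  have hmax' : ∀ P' R : Sylow p G, ((P ∩ Q : Set G) ∩ K) ⊂ ((P' ∩ R : Set G) ∩ K) →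
      (P' ∩ K : Set G) = (R ∩ K : Set G) := by
    intro P' R hlt
    by_contra h
    exact (Set.ncard_lt_ncard hlt).not_ge (hmax (P', R) h)
  have hPD : ¬ (P ∩ K : Set G) ⊆ ((P ⊓ Q : Subgroup G) : Set G) := fun h =>
    hPQ (Set.eq_of_subset_of_ncard_le (fun k hk => ⟨(h hk).2, hk.2⟩) (hcard Q P))
  have hQD : ¬ (Q ∩ K : Set G) ⊆ ((P ⊓ Q : Subgroup G) : Set G) := fun h =>
    hPQ.symm (Set.eq_of_subset_of_ncard_le (fun k hk => ⟨(h hk).1, hk.2⟩) (hcard P Q))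
  obtain ⟨y, hyP, hyK, hyD, hyN⟩ := Subgroup.exists_mem_normalizer_closure_inter
    P.isPGroup'.isNilpotent hK inf_le_left hPD
  obtain ⟨z, hzQ, hzK, hzD, hzN⟩ := Subgroup.exists_mem_normalizer_closure_inter
    Q.isPGroup'.isNilpotent hK inf_le_right hQD
  set C := Subgroup.closure (((P ⊓ Q : Subgroup G) : Set G) ∩ K)
  have hCp : IsPGroup p C :=
    P.isPGroup'.to_le ((Subgroup.closure_le _).2 fun k hk => hk.1.1)
  have hle : Subgroup.closure ({y, z} : Set G) ≤ Subgroup.normalizer (C : Set G) :=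
    (Subgroup.closure_le _).2 (Set.insert_subset hyN (Set.singleton_subset_iff.2 hzN))
  obtain ⟨R, hR⟩ := (hCp.to_sup_of_normal_left' (hpair y hyK z hzK) hle).exists_le_sylow
  have hCR : ∀ k, k ∈ P → k ∈ Q → k ∈ K → k ∈ R := fun k h1 h2 h3 =>
    hR (Subgroup.mem_sup_left (Subgroup.subset_closure ⟨⟨h1, h2⟩, h3⟩))
  have hyR : y ∈ R := hR (Subgroup.mem_sup_right (Subgroup.subset_closure (by simp)))
  have hzR : z ∈ R := hR (Subgroup.mem_sup_right (Subgroup.subset_closure (by simp)))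
  have hPR : (P ∩ K : Set G) = (R ∩ K : Set G) := hmax' P R <| by
    refine (Set.ssubset_iff_of_subset ?_).2 ⟨y, ⟨⟨hyP, hyR⟩, hyK⟩, fun h => hyD h.1⟩
    exact fun k hk => ⟨⟨hk.1.1, hCR k hk.1.1 hk.1.2 hk.2⟩, hk.2⟩
  have hQR : (Q ∩ K : Set G) = (R ∩ K : Set G) := hmax' Q R <| by
    refine (Set.ssubset_iff_of_subset ?_).2 ⟨z, ⟨⟨hzQ, hzR⟩, hzK⟩, fun h => hzD h.1⟩
    exact fun k hk => ⟨⟨hk.1.2, hCR k hk.1.1 hk.1.2 hk.2⟩, hk.2⟩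
  exact hPQ (hPR.trans hQR.symm)

/-- The Baer–Suzuki theorem for `p`-groups. -/
theorem IsPGroup.normalClosure_singleton {G : Type*} [Group G] [Finite G] {p : ℕ}
    [Fact p.Prime] {x : G}
    (h : ∀ g : G, IsPGroup p (Subgroup.closure ({x, g⁻¹ * x * g} : Set G))) :
    IsPGroup p (Subgroup.normalClosure ({x} : Set G)) := by
  have hK : ∀ g : G, ∀ k ∈ Group.conjugatesOfSet ({x} : Set G),
      g * k * g⁻¹ ∈ Group.conjugatesOfSet ({x} : Set G) :=
    fun g k hk => Group.conj_mem_conjugatesOfSet hk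
  have hpair : ∀ y ∈ Group.conjugatesOfSet ({x} : Set G),
      ∀ z ∈ Group.conjugatesOfSet ({x} : Set G),
        IsPGroup p (Subgroup.closure ({y, z} : Set G)) := by
    intro y hy z hz
    simp only [Group.mem_conjugatesOfSet_iff, Set.mem_singleton_iff, exists_eq_left,
      isConj_iff] at hy hz
    obtain ⟨a, rfl⟩ := hy
    obtain ⟨b, rfl⟩ := hz
    have hz : MulAut.conj a ((b⁻¹ * a)⁻¹ * x * (b⁻¹ * a)) = b * x * b⁻¹ := by
      rw [MulAut.conj_apply]
      group
    have heq : Subgroup.closure ({a * x * a⁻¹, b * x * b⁻¹} : Set G) =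
        (Subgroup.closure {x, (b⁻¹ * a)⁻¹ * x * (b⁻¹ * a)}).map (MulAut.conj a).toMonoidHom := by
      rw [MonoidHom.map_closure, Set.image_pair, ← hz]
      rfl
    rw [heq]
    exact (h _).map _
  obtain ⟨P⟩ : Nonempty (Sylow p G) := inferInstance
  refine P.isPGroup'.to_le ((Subgroup.closure_le _).2 fun k hk => ?_)
  obtain ⟨Q, hQ⟩ := (hpair k hk k hk).exists_le_sylow
  have hkQ : k ∈ (Q ∩ Group.conjugatesOfSet ({x} : Set G) : Set G) :=
    ⟨hQ (Subgroup.subset_closure (by simp)), hk⟩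
  rw [Sylow.inter_eq_of_isPGroup_closure_pair hK hpair Q P] at hkQ
  exact hkQ.1

/-- In a finite nilpotent group, a set of `p`-elements generates a `p`-group. -/
theorem IsPGroup.closure_of_isNilpotent {G : Type*} [Group G] [Finite G] [Group.IsNilpotent G]
    {p : ℕ} [Fact p.Prime] {S : Set G} (hS : ∀ s ∈ S, IsPGroup p (Subgroup.zpowers s)) :
    IsPGroup p (Subgroup.closure S) := by
  obtain ⟨P⟩ : Nonempty (Sylow p G) := inferInstance
  refine P.isPGroup'.to_le ((Subgroup.closure_le _).2 fun s hs => ?_)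
  exact sup_eq_right.1 (P.is_maximal' ((hS s hs).to_sup_of_normal_right P.isPGroup') le_sup_right)
    (Subgroup.mem_zpowers s)

/-- In a finite group, the join of normal `p`-subgroups, one for each prime `p` in a finite set,
is nilpotent. -/
theorem Group.isNilpotent_iSup_of_isPGroup {G : Type*} [Group G] [Finite G] {s : Finset ℕ}
    (hs : ∀ p ∈ s, p.Prime) (T : s → Subgroup G) [∀ p, (T p).Normal]
    (hT : ∀ p : s, IsPGroup p (T p)) : Group.IsNilpotent (⨆ p, T p : Subgroup G) := by
  have hcomm : Pairwise fun p q : s => ∀ a b : G, a ∈ T p → b ∈ T q → Commute a b := by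
    intro p q hpq
    have : Fact (p : ℕ).Prime := ⟨hs p p.2⟩
    have : Fact (q : ℕ).Prime := ⟨hs q q.2⟩
    exact Subgroup.commute_of_normal_of_disjoint _ _ inferInstance inferInstance
      (IsPGroup.disjoint_of_ne p q (fun h => hpq (Subtype.ext h)) _ _ (hT p) (hT q))
  have : ∀ p : s, Group.IsNilpotent (T p) := fun p =>
    have : Fact (p : ℕ).Prime := ⟨hs p p.2⟩
    (hT p).isNilpotent
  rw [← Subgroup.noncommPiCoprod_range (hcomm := hcomm)]
  exact Group.nilpotent_of_surjective _ (MonoidHom.rangeRestrict_surjective _)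

/-- A normal subgroup containing `x ^ ordCompl[p] (orderOf x)` for every prime divisor `p` of the
order of `x` contains `x`. -/
theorem Subgroup.mem_of_pow_ordCompl_mem {G : Type*} [Group G] [Finite G] {x : G}
    {H : Subgroup G} [H.Normal]
    (h : ∀ p ∈ (orderOf x).primeFactors, x ^ (ordCompl[p] (orderOf x)) ∈ H) : x ∈ H := by
  rw [← QuotientGroup.eq_one_iff, ← orderOf_eq_one_iff]
  by_contra hne
  obtain ⟨p, hp, hdvd⟩ := Nat.exists_prime_and_dvd hne
  have hx : orderOf x ≠ 0 := (orderOf_pos x).ne'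
  have hpx : p ∣ orderOf x := hdvd.trans (orderOf_map_dvd (QuotientGroup.mk' H) x)
  refine Nat.not_dvd_ordCompl hp hx (hdvd.trans (orderOf_dvd_of_pow_eq_one ?_))
  rw [← QuotientGroup.mk_pow, QuotientGroup.eq_one_iff]
  exact h p (Nat.mem_primeFactors.2 ⟨hp, hpx, hx⟩)

theorem baer_suzuki
    (G : Type*) [Group G] [Finite G] (x : G)
    (h : ∀ g : G, Group.IsNilpotent ↥(Subgroup.closure ({x, g⁻¹ * x * g} : Set G))) :
    Group.IsNilpotent ↥(Subgroup.normalClosure ({x} : Set G)) := by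
  let y : ℕ → G := fun p => x ^ (ordCompl[p] (orderOf x))
  have hy : ∀ p, y p ^ p ^ (orderOf x).factorization p = 1 := fun p => by
    rw [← pow_mul, mul_comm, Nat.ordProj_mul_ordCompl_eq_self, pow_orderOf_eq_one]
  let T : (orderOf x).primeFactors → Subgroup G := fun p => Subgroup.normalClosure {y p}
  have hT : ∀ p : (orderOf x).primeFactors, IsPGroup p (T p) := by
    intro p
    have : Fact (p : ℕ).Prime := ⟨Nat.prime_of_mem_primeFactors p.2⟩
    refine IsPGroup.normalClosure_singleton fun g => ?_
    have := h g
    set L := Subgroup.closure ({x, g⁻¹ * x * g} : Set G)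
    have hxL : x ∈ L := Subgroup.subset_closure (by simp)
    have hgL : g⁻¹ * x * g ∈ L := Subgroup.subset_closure (by simp)
    have hconj : (g⁻¹ * x * g) ^ (ordCompl[(p : ℕ)] (orderOf x)) = g⁻¹ * y p * g := by
      simpa using conj_pow (a := g⁻¹) (b := x) (i := ordCompl[(p : ℕ)] (orderOf x))
    have hpow : ∀ s : L, s ^ (p : ℕ) ^ (orderOf x).factorization p = 1 →
        IsPGroup p (Subgroup.zpowers s) := by
      rintro s hs ⟨_, n, rfl⟩
      refine ⟨(orderOf x).factorization p, Subtype.ext ?_⟩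
      simp only [Subgroup.coe_pow, Subgroup.coe_one]
      rw [← zpow_natCast, zpow_comm, zpow_natCast, hs, one_zpow]
    have hpair : IsPGroup p (Subgroup.closure ({⟨x, hxL⟩ ^ (ordCompl[(p : ℕ)] (orderOf x)),
        ⟨g⁻¹ * x * g, hgL⟩ ^ (ordCompl[(p : ℕ)] (orderOf x))} : Set L)) := by
      refine IsPGroup.closure_of_isNilpotent ?_
      rintro s (rfl | rfl)
      · exact hpow _ (Subtype.ext (hy p))
      · refine hpow _ (Subtype.ext ?_)
        rw [Subgroup.coe_pow, Subgroup.coe_pow, hconj]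
        have hconj' := conj_pow (a := g⁻¹) (b := y p) (i := (p : ℕ) ^ (orderOf x).factorization p)
        rw [hy, inv_inv] at hconj'
        simpa using hconj'
    have heq : Subgroup.closure ({y p, g⁻¹ * y p * g} : Set G) =
        (Subgroup.closure ({⟨x, hxL⟩ ^ (ordCompl[(p : ℕ)] (orderOf x)),
          ⟨g⁻¹ * x * g, hgL⟩ ^ (ordCompl[(p : ℕ)] (orderOf x))} : Set L)).map L.subtype := by
      rw [MonoidHom.map_closure, Set.image_pair, ← hconj]
      rfl
    rw [heq]
    exact hpair.map _
  have hnil := Group.isNilpotent_iSup_of_isPGroup (fun p => Nat.prime_of_mem_primeFactors) T hT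
  have hx : x ∈ ⨆ p, T p := Subgroup.mem_of_pow_ordCompl_mem fun p hp =>
    Subgroup.mem_iSup_of_mem (⟨p, hp⟩ : (orderOf x).primeFactors)
      (Subgroup.subset_normalClosure (Set.mem_singleton _))
  have hle : Subgroup.normalClosure {x} ≤ ⨆ p, T p :=
    Subgroup.normalClosure_le_normal (Set.singleton_subset_iff.2 hx)
  exact Group.nilpotent_of_mulEquiv (Subgroup.subgroupOfEquivOfLe hle)
end

section
/- Let G be a finite group and x ∈ G. Then the normal closure ⟨x^G⟩ is solvable if and only if every 7 conjugates of x generate a solvable group; that is, if and only if for all g₁, …, g₇ ∈ G the subgroup generated by g₁⁻¹xg₁, …, g₇⁻¹xg₇ is solvable. -/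
namespace SolvableRadical

/-- `pResidual q H` is the subgroup of `H` generated by the elements of order prime to `q`.
For finite `H` and prime `q` it is the smallest normal subgroup of `q`-power index. -/
def pResidual {G : Type*} [Group G] (q : ℕ) (H : Subgroup G) : Subgroup G :=
  Subgroup.closure {g | g ∈ H ∧ (orderOf g).Coprime q}

/-- The iterated residual of `H` along a list, whose last entry is applied first. -/
def iterResidual {G : Type*} [Group G] (s : List ℕ) (H : Subgroup G) : Subgroup G :=
  s.foldr pResidual H

section Residual

variable {G : Type*} [Group G] {q : ℕ}

@[simp] lemma iterResidual_nil (H : Subgroup G) : iterResidual [] H = H := rfl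

@[simp] lemma iterResidual_cons (q : ℕ) (s : List ℕ) (H : Subgroup G) :
    iterResidual (q :: s) H = pResidual q (iterResidual s H) := rfl

lemma pResidual_le (q : ℕ) (H : Subgroup G) : pResidual q H ≤ H :=
  (Subgroup.closure_le _).2 fun _ hg => hg.1

lemma mem_pResidual {H : Subgroup G} {g : G} (hg : g ∈ H) (h : (orderOf g).Coprime q) :
    g ∈ pResidual q H :=
  Subgroup.subset_closure ⟨hg, h⟩

lemma pResidual_mono (q : ℕ) : Monotone (pResidual (G := G) q) := fun _ _ h =>
  Subgroup.closure_mono fun _ hg => ⟨h hg.1, hg.2⟩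

lemma iterResidual_mono (s : List ℕ) : Monotone (iterResidual (G := G) s) := by
  induction s with
  | nil => exact monotone_id
  | cons q s ih => exact (pResidual_mono q).comp ih

lemma iterResidual_le (s : List ℕ) (H : Subgroup G) : iterResidual s H ≤ H := by
  induction s with
  | nil => exact le_rfl
  | cons q s ih => exact (pResidual_le q _).trans ih

/-- In a finite group some `q`-power of every element has order prime to `q`. -/
lemma exists_coprime_orderOf_pow [Finite G] (hq : q.Prime) (g : G) :
    ∃ k, (orderOf (g ^ q ^ k)).Coprime q := by
  have h0 : orderOf g ≠ 0 := (orderOf_pos g).ne'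
  refine ⟨(orderOf g).factorization q, ?_⟩
  rw [orderOf_pow_of_dvd (pow_ne_zero _ hq.ne_zero) (Nat.ordProj_dvd _ _)]
  exact (Nat.coprime_ordCompl hq h0).symm

lemma exists_pow_mem_pResidual [Finite G] (hq : q.Prime) {H : Subgroup G} {g : G} (hg : g ∈ H) :
    ∃ k, g ^ q ^ k ∈ pResidual q H :=
  let ⟨k, hk⟩ := exists_coprime_orderOf_pow hq g
  ⟨k, mem_pResidual (H.pow_mem hg _) hk⟩

lemma map_pResidual [Finite G] {G' : Type*} [Group G'] (hq : q.Prime) (f : G →* G')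
    (H : Subgroup G) : (pResidual q H).map f = pResidual q (H.map f) := by
  apply le_antisymm
  · rw [pResidual, MonoidHom.map_closure, Subgroup.closure_le]
    rintro _ ⟨g, hg, rfl⟩
    exact mem_pResidual (Subgroup.mem_map_of_mem f hg.1)
      (hg.2.coprime_dvd_left (orderOf_map_dvd f g))
  · refine (Subgroup.closure_le _).2 ?_
    rintro _ ⟨⟨g, hg, rfl⟩, hc⟩
    obtain ⟨k, hk⟩ := exists_pow_mem_pResidual hq hg
    have h1 : f g ^ q ^ k ∈ (pResidual q H).map f := by
      rw [← map_pow]; exact Subgroup.mem_map_of_mem f hk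
    obtain ⟨m, hm⟩ := exists_pow_eq_self_of_coprime (hc.symm.pow_left k)
    change f g ∈ _
    rw [← hm]
    exact Subgroup.pow_mem _ h1 m

lemma map_iterResidual [Finite G] {G' : Type*} [Group G'] [Finite G'] {s : List ℕ}
    (hs : ∀ q ∈ s, q.Prime) (f : G →* G') (H : Subgroup G) :
    (iterResidual s H).map f = iterResidual s (H.map f) := by
  induction s with
  | nil => rfl
  | cons q s ih =>
    simp only [List.mem_cons, forall_eq_or_imp] at hs
    rw [iterResidual_cons, map_pResidual hs.1, ih hs.2, iterResidual_cons]

/-- An element normalizing `H` normalizes each iterated residual of `H`. -/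
lemma normalizer_le_normalizer_iterResidual [Finite G] {s : List ℕ} (hs : ∀ q ∈ s, q.Prime)
    (H : Subgroup G) :
    Subgroup.normalizer (H : Set G) ≤ Subgroup.normalizer (iterResidual s H : Set G) := by
  intro g hg
  rw [Subgroup.mem_normalizer_iff_map_conj_eq] at hg ⊢
  rw [map_iterResidual hs, hg]

lemma iterResidual_normal [Finite G] {s : List ℕ} (hs : ∀ q ∈ s, q.Prime)
    (H : Subgroup G) [H.Normal] : (iterResidual s H).Normal := by
  rw [← Subgroup.normalizer_eq_top_iff, eq_top_iff]
  exact (Subgroup.normalizer_eq_top_iff.2 ‹_›).ge.trans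
    (normalizer_le_normalizer_iterResidual hs H)

lemma pResidual_normal [Finite G] (hq : q.Prime) (H : Subgroup G) [H.Normal] :
    (pResidual q H).Normal :=
  iterResidual_normal (s := [q]) (by simpa using hq) H

lemma pResidual_eq_bot_iff [Finite G] (hq : q.Prime) {H : Subgroup G} :
    pResidual q H = ⊥ ↔ IsPGroup q H := by
  constructor
  · rintro h ⟨g, hg⟩
    obtain ⟨k, hk⟩ := exists_pow_mem_pResidual hq hg
    refine ⟨k, ?_⟩
    rw [h, Subgroup.mem_bot] at hk
    exact Subtype.ext hk
  · intro h
    rw [eq_bot_iff]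
    refine (Subgroup.closure_le _).2 ?_
    rintro g ⟨hg, hc⟩
    have := Fact.mk hq
    obtain ⟨k, hk⟩ := IsPGroup.iff_orderOf.1 h ⟨g, hg⟩
    rw [Subgroup.orderOf_mk] at hk
    rw [hk] at hc
    have : q ^ k = 1 := by
      rcases k.eq_zero_or_pos with rfl | hk0
      · simp
      · exact absurd ((Nat.coprime_pow_left_iff hk0 _ _).1 hc)
          (by rw [Nat.coprime_self]; exact hq.ne_one)
    rw [this, orderOf_eq_one_iff] at hk
    simp [hk]

lemma pResidual_eq_self_of_ne {r : ℕ} (hq : q.Prime) (hr : r.Prime) (hqr : q ≠ r)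
    {H : Subgroup G} (h : IsPGroup q H) : pResidual r H = H := by
  refine le_antisymm (pResidual_le _ _) fun g hg => mem_pResidual hg ?_
  have := Fact.mk hq
  obtain ⟨k, hk⟩ := IsPGroup.iff_orderOf.1 h ⟨g, hg⟩
  rw [Subgroup.orderOf_mk] at hk
  rw [hk]
  exact ((Nat.coprime_primes hq hr).2 hqr).pow_left k

lemma pResidual_iSup [Finite G] (hq : q.Prime) {ι : Type*} (A : ι → Subgroup G)
    [hA : ∀ i, (A i).Normal] : pResidual q (⨆ i, A i) = ⨆ i, pResidual q (A i) := by
  apply le_antisymm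
  · have hn : ∀ i, (pResidual q (A i)).Normal := fun i =>
      pResidual_normal hq (A i)
    obtain ⟨B, hB⟩ : ∃ B, B = ⨆ i, pResidual q (A i) := ⟨_, rfl⟩
    rw [← hB]
    have : B.Normal := hB ▸ Subgroup.iSup_normal _
    have h1 : ∀ i, IsPGroup q ((A i).map (QuotientGroup.mk' B)) := by
      intro i
      rw [← pResidual_eq_bot_iff hq, ← map_pResidual hq, Subgroup.map_eq_bot_iff,
        QuotientGroup.ker_mk']
      exact hB ▸ le_iSup (fun i => pResidual q (A i)) i
    have : ∀ i, ((A i).map (QuotientGroup.mk' B)).Normal := fun i =>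
      (hA i).map _ (QuotientGroup.mk'_surjective B)
    have := Fact.mk hq
    have h2 := Sylow.iSup_of_normal _ h1
    rw [← Subgroup.map_iSup, ← pResidual_eq_bot_iff hq, ← map_pResidual hq,
      Subgroup.map_eq_bot_iff, QuotientGroup.ker_mk'] at h2
    exact h2
  · exact iSup_le fun i => pResidual_mono q (le_iSup A i)

lemma iterResidual_iSup [Finite G] {s : List ℕ} (hs : ∀ q ∈ s, q.Prime) {ι : Type*}
    (A : ι → Subgroup G) [∀ i, (A i).Normal] :
    iterResidual s (⨆ i, A i) = ⨆ i, iterResidual s (A i) := by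
  induction s with
  | nil => rfl
  | cons q s ih =>
    simp only [List.mem_cons, forall_eq_or_imp] at hs
    have := fun i => iterResidual_normal hs.2 (A i)
    simp only [iterResidual_cons, ih hs.2, pResidual_iSup hs.1]

/-- A nontrivial solvable subgroup has a proper `q`-residual for some prime `q`. -/
lemma exists_pResidual_lt [Finite G] {H : Subgroup G} [Group.IsSolvable H] (hH : H ≠ ⊥) :
    ∃ q, q.Prime ∧ pResidual q H < H := by
  have : Nontrivial H := (Subgroup.nontrivial_iff_ne_bot H).2 hH
  have hlt := Group.IsSolvable.commutator_lt_top_of_nontrivial H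
  have hcard : Nat.card (Abelianization H) ≠ 1 := by
    intro h
    exact hlt.ne (Subgroup.index_eq_one.1 h)
  obtain ⟨q, hq, hdvd⟩ := Nat.exists_prime_and_dvd hcard
  have := Fact.mk hq
  refine ⟨q, hq, lt_of_le_of_ne (pResidual_le _ _) fun heq => ?_⟩
  have htop : pResidual q (⊤ : Subgroup H) = ⊤ := by
    apply Subgroup.map_injective H.subtype_injective
    rw [map_pResidual hq, ← MonoidHom.range_eq_map, H.range_subtype, heq]
  have habs : pResidual q (⊤ : Subgroup (Abelianization H)) = ⊤ := by
    have := map_pResidual hq (Abelianization.of (G := H)) ⊤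
    rw [htop, ← MonoidHom.range_eq_map,
      (MonoidHom.range_eq_top (f := Abelianization.of)).2 (QuotientGroup.mk'_surjective _)] at this
    exact this.symm
  obtain ⟨a, ha⟩ := exists_prime_orderOf_dvd_card' (G := Abelianization H) q hdvd
  have : ∀ b ∈ pResidual q (⊤ : Subgroup (Abelianization H)), (orderOf b).Coprime q := by
    intro b hb
    induction hb using Subgroup.closure_induction with
    | mem b hb => exact hb.2
    | one => simp
    | mul b c _ _ hb hc =>
      exact (hb.mul_left hc).coprime_dvd_left ((Commute.all b c).orderOf_mul_dvd_mul_orderOf)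
    | inv b _ hb => rwa [orderOf_inv]
  have h1 := this a (by rw [habs]; trivial)
  rw [ha, Nat.coprime_self] at h1
  exact hq.one_lt.ne' h1

end Residual

section BaerSuzuki

variable {G : Type*} [Group G] {q : ℕ}

/-- Proper subgroups of a finite `q`-group are proper in their normalizers. -/
lemma exists_mem_normalizer_of_lt [Finite G] [Fact q.Prime] {P M : Subgroup G}
    (hP : IsPGroup q P) (hMP : M < P) :
    ∃ g ∈ P, g ∈ Subgroup.normalizer (M : Set G) ∧ g ∉ M := by
  have := hP.isNilpotent
  have hlt : M.subgroupOf P < ⊤ := by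
    rw [lt_top_iff_ne_top, Ne, Subgroup.subgroupOf_eq_top]
    exact not_le_of_gt hMP
  obtain ⟨g, hg, hgM⟩ := SetLike.exists_of_lt (Group.normalizerCondition_of_isNilpotent _ hlt)
  refine ⟨g, g.2, ?_, fun h => hgM (Subgroup.mem_subgroupOf.2 h)⟩
  rw [Subgroup.mem_normalizer_iff] at hg ⊢
  intro h
  constructor
  · intro hh
    exact (hg ⟨h, hMP.le hh⟩).1 hh
  · intro hh
    have hhP : h ∈ P := by
      have := P.mul_mem (P.mul_mem (P.inv_mem g.2) (hMP.le hh)) g.2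
      rwa [show (g : G)⁻¹ * (g * h * (g : G)⁻¹) * g = h by group] at this
    exact (hg ⟨h, hhP⟩).2 hh

lemma mem_normalizer_closure [Finite G] {S : Set G} {g : G} (h : ∀ x ∈ S, g * x * g⁻¹ ∈ S) :
    g ∈ Subgroup.normalizer (Subgroup.closure S : Set G) := by
  rw [Subgroup.mem_normalizer_iff_map_conj_eq]
  have : (Subgroup.closure S).map (MulAut.conj g).toMonoidHom ≤ Subgroup.closure S := by
    rw [MonoidHom.map_closure]
    apply Subgroup.closure_mono
    rintro _ ⟨x, hx, rfl⟩
    exact h x hx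
  exact Subgroup.eq_of_le_of_card_ge this
    (Subgroup.card_map_of_injective (MulAut.conj g).injective).ge

lemma exists_mem_normalizer_notMem [Finite G] [Fact q.Prime] {S : Set G}
    (hS : ∀ a ∈ S, ∀ g : G, g * a * g⁻¹ ∈ S) {P D : Subgroup G} (hP : IsPGroup q P)
    (hDP : D ≤ P) (hD : Subgroup.closure (S ∩ D) = D) {c : G} (hc : c ∈ S) (hcP : c ∈ P)
    (hcD : c ∉ D) :
    ∃ a ∈ S, a ∈ P ∧ a ∈ Subgroup.normalizer (D : Set G) ∧ a ∉ D := by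
  by_contra! hcon
  obtain ⟨M, hM⟩ : ∃ M, M = P ⊓ Subgroup.normalizer (D : Set G) := ⟨_, rfl⟩
  have hDM : D ≤ M := hM ▸ le_inf hDP Subgroup.le_normalizer
  have hSM : ∀ a ∈ S, a ∈ M → a ∈ D := by
    intro a ha haM
    rw [hM] at haM
    exact hcon a ha haM.1 haM.2
  have hlt : M < P := by
    refine lt_of_le_of_ne (hM ▸ inf_le_left) fun h => hcD (hSM c hc (h ▸ hcP))
  obtain ⟨g, hgP, hgM, hg⟩ := exists_mem_normalizer_of_lt hP hlt
  refine hg ?_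
  rw [hM]
  refine ⟨hgP, ?_⟩
  rw [← hD]
  refine mem_normalizer_closure fun x hx => ⟨hS x hx.1 g, hSM _ (hS x hx.1 g) ?_⟩
  exact (Subgroup.mem_normalizer_iff.1 hgM x).1 (hDM hx.2)

/-- The Baer-Suzuki theorem. -/
theorem isPGroup_closure_of_pairs [Finite G] (hq : q.Prime) {S : Set G}
    (hS : ∀ a ∈ S, ∀ g : G, g * a * g⁻¹ ∈ S)
    (h : ∀ a ∈ S, ∀ b ∈ S, IsPGroup q (Subgroup.closure {a, b})) :
    IsPGroup q (Subgroup.closure S) := by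
  have := Fact.mk hq
  by_cases hall : ∀ P Q : Sylow q G, S ∩ P ⊆ Q
  · obtain ⟨Q⟩ : Nonempty (Sylow q G) := inferInstance
    refine Q.2.to_le ((Subgroup.closure_le _).2 fun a ha => ?_)
    obtain ⟨P, hP⟩ := (h a ha a ha).exists_le_sylow
    exact hall P Q ⟨ha, hP (Subgroup.subset_closure (by simp))⟩
  exfalso
  push Not at hall
  let T := {p : Sylow q G × Sylow q G // ¬ S ∩ p.1 ⊆ p.2}
  have : Nonempty T := by
    obtain ⟨P, Q, hPQ⟩ := hall
    exact ⟨⟨(P, Q), hPQ⟩⟩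
  obtain ⟨⟨⟨P, Q⟩, hPQ⟩, hmax⟩ :=
    Finite.exists_max fun p : T => (S ∩ (p.1.1 ∩ p.1.2)).ncard
  replace hmax : ∀ P' Q' : Sylow q G, (S ∩ (P ∩ Q)).ncard < (S ∩ (P' ∩ Q')).ncard →
      S ∩ P' ⊆ Q' := fun P' Q' hlt => by
    by_contra hn
    exact absurd (hmax ⟨(P', Q'), hn⟩) (not_le.2 hlt)
  have hcard : ∀ P Q : Sylow q G, S ∩ P ⊆ Q → S ∩ Q ⊆ P := by
    intro P Q hPQ
    obtain ⟨g, hg⟩ := MulAction.exists_smul_eq G Q P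
    have hle : (S ∩ Q).ncard ≤ (S ∩ P).ncard := by
      refine Set.ncard_le_ncard_of_injOn (fun x => g * x * g⁻¹) ?_ ?_
      · rintro x ⟨hx, hxQ⟩
        refine ⟨hS x hx g, ?_⟩
        rw [← hg]
        exact ⟨x, hxQ, rfl⟩
      · intro x _ y _ hxy
        simpa using hxy
    have heq : S ∩ P = S ∩ Q :=
      Set.eq_of_subset_of_ncard_le (fun x hx => ⟨hx.1, hPQ hx⟩) hle
    rw [← heq]
    exact Set.inter_subset_right
  have hQP : ¬ S ∩ Q ⊆ P := fun h' => hPQ (hcard Q P h')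
  obtain ⟨D, hD⟩ : ∃ D, D = Subgroup.closure (S ∩ (P ∩ Q)) := ⟨_, rfl⟩
  have hDle : D ≤ (P : Subgroup G) ⊓ Q := by
    rw [hD]; exact (Subgroup.closure_le _).2 fun x hx => hx.2
  have hSD : S ∩ (P ∩ Q) ⊆ D := by rw [hD]; exact Subgroup.subset_closure
  have hDD : Subgroup.closure (S ∩ D) = D := by
    refine le_antisymm ((Subgroup.closure_le _).2 Set.inter_subset_right) ?_
    nth_rw 1 [hD]
    exact Subgroup.closure_mono fun x hx => ⟨hx.1, hSD hx⟩
  obtain ⟨c, ⟨hc, hcP⟩, hcQ⟩ := Set.not_subset.1 hPQ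
  obtain ⟨d, ⟨hd, hdQ⟩, hdP⟩ := Set.not_subset.1 hQP
  obtain ⟨a, haS, haP, haN, haD⟩ := exists_mem_normalizer_notMem hS P.2
    (hDle.trans inf_le_left) hDD hc hcP fun h' => hcQ (hDle h').2
  obtain ⟨b, hbS, hbQ, hbN, hbD⟩ := exists_mem_normalizer_notMem hS Q.2
    (hDle.trans inf_le_right) hDD hd hdQ fun h' => hdP (hDle h').1
  have hDp : IsPGroup q D := P.2.to_le (hDle.trans inf_le_left)
  have hsup := IsPGroup.to_sup_of_normal_left' hDp (h a haS b hbS)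
    ((Subgroup.closure_le _).2 (by
      rintro x (rfl | rfl)
      exacts [haN, hbN]))
  obtain ⟨R, hR⟩ := hsup.exists_le_sylow
  have hDR : D ≤ R := le_sup_left.trans hR
  have hab : Subgroup.closure {a, b} ≤ (R : Subgroup G) := le_sup_right.trans hR
  have h1 : S ∩ R ⊆ P := by
    refine hcard P R (hmax P R (Set.ncard_lt_ncard ⟨fun x hx => ⟨hx.1, hx.2.1, hDR (hSD hx)⟩,
      fun hsub => haD (hSD (hsub ⟨haS, haP, hab (Subgroup.subset_closure (by simp))⟩))⟩))
  have h2 : S ∩ Q ⊆ R := by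
    refine hmax Q R (Set.ncard_lt_ncard ⟨fun x hx => ⟨hx.1, hx.2.2, hDR (hSD hx)⟩,
      fun hsub => hbD (hSD (hsub ⟨hbS, hbQ, hab (Subgroup.subset_closure (by simp))⟩))⟩)
  exact hQP fun x hx => h1 ⟨hx.1, h2 hx⟩

end BaerSuzuki

section Moving

variable {H : Type*} [Group H]

lemma mem_normalizer_of_conj_mem [Finite H] {K : Subgroup H} {g : H}
    (h : ∀ x ∈ K, g * x * g⁻¹ ∈ K) : g ∈ Subgroup.normalizer (K : Set H) := by
  have := mem_normalizer_closure (S := (K : Set H)) h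
  rwa [Subgroup.closure_eq] at this

lemma commutator_mem_of_normalClosure_eq_top {x : H} (hx : Subgroup.normalClosure {x} = ⊤)
    {N Z : Subgroup H} [hN : N.Normal] [Z.Normal] (h : ∀ m ∈ N, x⁻¹ * (m⁻¹ * x * m) ∈ Z)
    (g : H) {m : H} (hm : m ∈ N) : g⁻¹ * (m⁻¹ * g * m) ∈ Z := by
  have := hN.map (QuotientGroup.mk' Z) (QuotientGroup.mk'_surjective Z)
  have hle : Subgroup.normalClosure {x} ≤ (Subgroup.centralizer
      (N.map (QuotientGroup.mk' Z) : Set (H ⧸ Z))).comap (QuotientGroup.mk' Z) := by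
    refine Subgroup.normalClosure_le_normal ?_
    rintro _ rfl
    rw [SetLike.mem_coe, Subgroup.mem_comap, Subgroup.mem_centralizer_iff]
    rintro _ ⟨m, hm, rfl⟩
    rw [← map_mul, ← map_mul, eq_comm]
    refine (QuotientGroup.eq (s := Z)).2 ?_ |>.symm
    simpa [mul_assoc] using h m hm
  have hg : g ∈ (Subgroup.centralizer
      (N.map (QuotientGroup.mk' Z) : Set (H ⧸ Z))).comap (QuotientGroup.mk' Z) :=
    hle (by rw [hx]; trivial)
  rw [Subgroup.mem_comap, Subgroup.mem_centralizer_iff] at hg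
  have := hg _ (Subgroup.mem_map_of_mem _ hm)
  rw [← map_mul, ← map_mul] at this
  have := (QuotientGroup.eq (s := Z)).1 this
  simpa [mul_assoc] using this

/-- If `x` normally generates a finite solvable group, then `x` or a commutator `[x, m]` moves
every coset of a given proper subgroup. -/
theorem exists_forall_conj_notMem [Finite H] [Group.IsSolvable H] {x : H}
    (hx : Subgroup.normalClosure {x} = ⊤) {S : Subgroup H} (hS : S ≠ ⊤) :
    ∃ u, (u = x ∨ ∃ m, u = x⁻¹ * (m⁻¹ * x * m)) ∧ ∀ g, g⁻¹ * u * g ∉ S := by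
  obtain ⟨M, hM, hSM⟩ := (eq_top_or_exists_le_coatom S).resolve_left hS
  suffices h : ∃ u, (u = x ∨ ∃ m, u = x⁻¹ * (m⁻¹ * x * m)) ∧ ∀ g, g⁻¹ * u * g ∉ M by
    obtain ⟨u, hu, h⟩ := h
    exact ⟨u, hu, fun g hg => h g (hSM hg)⟩
  by_cases hnM : M.Normal
  · refine ⟨x, Or.inl rfl, fun g hg => hM.1 ?_⟩
    rw [eq_top_iff, ← hx]
    refine Subgroup.normalClosure_le_normal (Set.singleton_subset_iff.2 ?_)
    have := hnM.conj_mem _ hg g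
    rwa [show g * (g⁻¹ * x * g) * g⁻¹ = x by group] at this
  obtain ⟨N, ⟨hN, hNM⟩, hmin⟩ := (Set.toFinite {N : Subgroup H | N.Normal ∧ ¬ N ≤ M}).exists_minimal
    ⟨⊤, inferInstance, fun h => hM.1 (top_le_iff.1 h)⟩
  have hNbot : N ≠ ⊥ := by rintro rfl; exact hNM bot_le
  have hcomm : ⁅N, N⁆ ≤ M := by
    by_contra hcon
    have hlt := Group.IsSolvable.commutator_lt_of_ne_bot hNbot
    exact absurd (hmin ⟨inferInstance, hcon⟩ hlt.le) (not_le_of_gt hlt)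
  have htop : M ⊔ N = ⊤ := hM.2 _ (lt_of_le_of_ne le_sup_left fun h => hNM (h ▸ le_sup_right))
  have hZ : (N ⊓ M).Normal := by
    rw [← Subgroup.normalizer_eq_top_iff, eq_top_iff, ← htop]
    refine sup_le ?_ ?_
    · intro g hg
      exact mem_normalizer_of_conj_mem fun y hy =>
        ⟨hN.conj_mem _ hy.1 _, M.mul_mem (M.mul_mem hg hy.2) (M.inv_mem hg)⟩
    · intro g hg
      refine mem_normalizer_of_conj_mem fun y hy => ⟨hN.conj_mem _ hy.1 _, ?_⟩
      have := M.mul_mem (hcomm (Subgroup.commutator_mem_commutator hg hy.1)) hy.2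
      rwa [commutatorElement_def, inv_mul_cancel_right] at this
  have huN : ∀ g, ∀ m ∈ N, g⁻¹ * (m⁻¹ * g * m) ∈ N := fun g m hm => by
    have := N.mul_mem (hN.conj_mem _ (N.inv_mem hm) g⁻¹) hm
    simpa [mul_assoc] using this
  by_cases hex : ∃ m ∈ N, x⁻¹ * (m⁻¹ * x * m) ∉ M
  · obtain ⟨m, hm, hmM⟩ := hex
    refine ⟨_, Or.inr ⟨m, rfl⟩, fun g hg => hmM ?_⟩
    have h1 : g⁻¹ * (x⁻¹ * (m⁻¹ * x * m)) * g ∈ N ⊓ M := by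
      refine ⟨?_, hg⟩
      have := hN.conj_mem _ (huN x m hm) g⁻¹
      rwa [inv_inv] at this
    have := hZ.conj_mem _ h1 g
    rw [show ∀ y, g * (g⁻¹ * y * g) * g⁻¹ = y by intro y; group] at this
    exact this.2
  · exfalso
    push Not at hex
    refine hnM ?_
    rw [← Subgroup.normalizer_eq_top_iff, eq_top_iff, ← htop]
    refine sup_le Subgroup.le_normalizer fun m hm => mem_normalizer_of_conj_mem fun y hy => ?_
    have := commutator_mem_of_normalClosure_eq_top hx (Z := N ⊓ M)
      (fun m hm => ⟨huN x m hm, hex m hm⟩) y (N.inv_mem hm)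
    have := M.mul_mem hy this.2
    rwa [mul_inv_cancel_left, inv_inv] at this

end Moving

section Fixed

variable {H W : Type*} [Group H] [AddCommGroup W] [DistribMulAction H W]

/-- The conjugate of an endomorphism by the action of a group element. -/
def conjEnd (h : H) (e : AddMonoid.End W) : AddMonoid.End W :=
  DistribMulAction.toAddMonoidEnd H W h * e * DistribMulAction.toAddMonoidEnd H W h⁻¹

@[simp] lemma conjEnd_apply (h : H) (e : AddMonoid.End W) (v : W) :
    conjEnd h e v = h • e (h⁻¹ • v) := rfl

lemma end_mul_apply (g k : AddMonoid.End W) (v : W) : (g * k) v = g (k v) := rfl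

lemma sq_card_fixedBy_le_of_idempotents [Finite W] (u : H) (P : Set (AddMonoid.End W))
    (hidem : ∀ e ∈ P, e * e = e) (horth : ∀ e ∈ P, ∀ f ∈ P, e ≠ f → e * f = 0)
    (hker : ∀ v : W, (∀ e ∈ P, e v = 0) → v = 0)
    (hconj : ∀ e ∈ P, conjEnd u e ∈ P) (hne : ∀ e ∈ P, conjEnd u e ≠ e) :
    Nat.card (MulAction.fixedBy W u) ^ 2 ≤ Nat.card W := by
  classical
  have : Finite (AddMonoid.End W) := DFunLike.finite _
  obtain ⟨T, ⟨hTP, hT⟩, hmax⟩ := (Set.toFinite {T : Set (AddMonoid.End W) |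
    T ⊆ P ∧ ∀ e ∈ T, ∀ f ∈ T, conjEnd u e ≠ f}).exists_maximal
    ⟨∅, Set.empty_subset _, fun e he => he.elim⟩
  have hkill : ∀ a ∈ MulAction.fixedBy W u, (∀ e ∈ T, e a = 0) → a = 0 := by
    intro a ha hTa
    have ha' : u⁻¹ • a = a := by rw [inv_smul_eq_iff]; exact ha.symm
    refine hker a fun f hf => ?_
    by_contra hfa
    have hfT : f ∉ T := fun h => hfa (hTa f h)
    refine hfT (hmax (y := insert f T) ⟨Set.insert_subset hf hTP, ?_⟩ (Set.subset_insert _ _)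
      (Set.mem_insert _ _))
    rintro e (rfl | he) g (rfl | hg) heg
    · exact hne _ hf heg
    · have h1 := hTa g hg
      rw [← heg, conjEnd_apply, ha', smul_eq_zero_iff_eq] at h1
      exact hfa h1
    · refine hfa ?_
      rw [← heg, conjEnd_apply, ha', hTa e he, smul_zero]
    · exact hT e he g hg heg
  have hTfin : T.Finite := Set.toFinite T
  let φ : MulAction.fixedBy W u × MulAction.fixedBy W u → W := fun p =>
    ∑ e ∈ hTfin.toFinset, e p.1 + u • ∑ e ∈ hTfin.toFinset, e p.2
  have hsum : ∀ f ∈ T, ∀ a : W, f (∑ e ∈ hTfin.toFinset, e a) = f a := by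
    intro f hf a
    rw [map_sum, Finset.sum_eq_single f]
    · exact DFunLike.congr_fun (hidem f (hTP hf)) a
    · intro e he hef
      exact DFunLike.congr_fun (horth f (hTP hf) e (hTP (by simpa using he)) (Ne.symm hef)) a
    · intro h; exact absurd (by simpa using hf) h
  have hsum' : ∀ f ∈ T, ∀ b : W, u • b = b → f (u • ∑ e ∈ hTfin.toFinset, e b) = 0 := by
    intro f hf b hb
    rw [Finset.smul_sum, map_sum]
    refine Finset.sum_eq_zero fun e he => ?_
    have he : e ∈ T := by simpa using he
    have := DFunLike.congr_fun (horth f (hTP hf) _ (hconj e (hTP he)) (hT e he f hf).symm) b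
    rw [end_mul_apply, conjEnd_apply, inv_smul_eq_iff.2 hb.symm] at this
    exact this
  have hsum'' : ∀ f ∈ T, ∀ a : W, f (u⁻¹ • ∑ e ∈ hTfin.toFinset, e a) = 0 := by
    intro f hf a
    rw [Finset.smul_sum, map_sum]
    refine Finset.sum_eq_zero fun e he => ?_
    have he : e ∈ T := by simpa using he
    have := DFunLike.congr_fun (horth _ (hconj f (hTP hf)) _ (hTP he) (hT f hf e he)) a
    rw [end_mul_apply, conjEnd_apply] at this
    exact (smul_eq_zero_iff_eq _).1 this
  have hφ : Function.Injective φ := by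
    rintro ⟨⟨a, ha⟩, ⟨b, hb⟩⟩ ⟨⟨a', ha'⟩, ⟨b', hb'⟩⟩ h
    simp only [φ] at h
    have hsub : ∀ c c' : W, c ∈ MulAction.fixedBy W u → c' ∈ MulAction.fixedBy W u →
        (∀ f ∈ T, f c = f c') → c = c' := fun c c' hc hc' hf => by
      rw [← sub_eq_zero]
      refine hkill _ ?_ fun e he => by rw [map_sub, hf e he, sub_self]
      rw [MulAction.mem_fixedBy] at hc hc' ⊢
      rw [smul_sub, hc, hc']
    have h1 : a = a' := hsub a a' ha ha' fun f hf => by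
      have := congrArg f h
      rwa [map_add, map_add, hsum f hf, hsum f hf, hsum' f hf _ hb, hsum' f hf _ hb', add_zero,
        add_zero] at this
    have h2 : b = b' := hsub b b' hb hb' fun f hf => by
      have := congrArg (fun v => f (u⁻¹ • v)) h
      simp only [smul_add, map_add, inv_smul_smul] at this
      rwa [hsum'' f hf, hsum'' f hf, zero_add, zero_add, hsum f hf, hsum f hf] at this
    simp [h1, h2]
  have := Nat.card_le_card_of_injective φ hφ
  rwa [Nat.card_prod, ← sq] at this

end Fixed

lemma exists_pow_mul_self_eq {M : Type*} [Monoid M] [Finite M] (b : M) :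
    ∃ k, k ≠ 0 ∧ b ^ k * b ^ k = b ^ k := by
  obtain ⟨i, j, hij, h⟩ : ∃ i j, i < j ∧ b ^ i = b ^ j := by
    obtain ⟨i, j, hne, h⟩ := Finite.exists_ne_map_eq_of_infinite (fun n : ℕ => b ^ n)
    rcases lt_or_gt_of_ne hne with hlt | hlt
    exacts [⟨i, j, hlt, h⟩, ⟨j, i, hlt, h.symm⟩]
  obtain ⟨p, rfl⟩ := Nat.exists_eq_add_of_lt hij
  have h1 : ∀ n, i ≤ n → b ^ (n + (p + 1)) = b ^ n := by
    intro n hn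
    obtain ⟨c, rfl⟩ := Nat.exists_eq_add_of_le hn
    rw [show i + c + (p + 1) = c + (i + p + 1) by ring, pow_add, ← h, ← pow_add, add_comm]
  have h2 : ∀ m n, i ≤ n → b ^ (n + m * (p + 1)) = b ^ n := by
    intro m n hn
    induction m with
    | zero => simp
    | succ m ih => rw [add_mul, one_mul, ← add_assoc, h1 _ (by omega), ih]
  refine ⟨(i + 1) * (p + 1), by positivity, ?_⟩
  rw [← pow_add, h2]
  nlinarith

section Fixed

variable {H W : Type*} [Group H] [AddCommGroup W] [DistribMulAction H W]

lemma conjEnd_mul (h : H) (e f : AddMonoid.End W) :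
    conjEnd h (e * f) = conjEnd h e * conjEnd h f := by
  ext v; simp [end_mul_apply]

lemma conjEnd_conjEnd (g h : H) (e : AddMonoid.End W) :
    conjEnd g (conjEnd h e) = conjEnd (g * h) e := by
  ext v; simp [mul_smul]

@[simp] lemma conjEnd_one (e : AddMonoid.End W) : conjEnd (1 : H) e = e := by
  ext v; simp

@[simp] lemma conjEnd_zero (h : H) : conjEnd h (0 : AddMonoid.End W) = 0 := by
  ext v; simp

lemma card_fixedBy_conj (m x : H) :
    Nat.card (MulAction.fixedBy W (m * x * m⁻¹)) = Nat.card (MulAction.fixedBy W x) := by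
  open Pointwise in
  rw [← MulAction.smul_fixedBy, Set.natCard_smul_set]

lemma card_fixedBy_mul_le [Finite W] {c d u : H}
    (h : ∀ v : W, c • v = v → d • v = v → u • v = v) :
    Nat.card (MulAction.fixedBy W c) * Nat.card (MulAction.fixedBy W d) ≤
      Nat.card W * Nat.card (MulAction.fixedBy W u) := by
  let F : H → AddSubgroup W := fun h =>
    { carrier := MulAction.fixedBy W h
      zero_mem' := smul_zero h
      add_mem' := fun {a b} ha hb => by
        rw [MulAction.mem_fixedBy] at *
        rw [smul_add, ha, hb]
      neg_mem' := fun {a} ha => by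
        rw [MulAction.mem_fixedBy] at *
        rw [smul_neg, ha] }
  have hF : F c ⊓ F d ≤ F u := fun v hv => h v hv.1 hv.2
  have h1 := AddSubgroup.index_inf_le (H := F c) (K := F d)
  have h2 := (F c).card_mul_index
  have h3 := (F d).card_mul_index
  have h4 := (F c ⊓ F d).card_mul_index
  have h5 := AddSubgroup.card_le_of_le hF
  change Nat.card (F c) * Nat.card (F d) ≤ Nat.card W * Nat.card (F u)
  have hpos : 0 < Nat.card W := Nat.card_pos
  refine Nat.le_of_mul_le_mul_left ?_ hpos
  calc Nat.card W * (Nat.card (F c) * Nat.card (F d))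
      = Nat.card (F c) * Nat.card (F d) * (Nat.card (F c ⊓ F d : AddSubgroup W) *
        (F c ⊓ F d).index) := by rw [h4]; ring
    _ ≤ Nat.card (F c) * Nat.card (F d) * (Nat.card (F u) * ((F c).index * (F d).index)) := by
        gcongr
    _ = (Nat.card (F c) * (F c).index) * (Nat.card (F d) * (F d).index) * Nat.card (F u) := by
        ring
    _ = Nat.card W * (Nat.card W * Nat.card (F u)) := by rw [h2, h3]; ring

end Fixed

/-- The only subgroups of `W` invariant under `H` are `⊥` and `⊤`. -/
def ActsIrreducibly (H W : Type*) [Group H] [AddCommGroup W] [DistribMulAction H W] : Prop :=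
  ∀ U : AddSubgroup W, (∀ h : H, ∀ v ∈ U, h • v ∈ U) → U = ⊥ ∨ U = ⊤

section Irreducible

variable {H W : Type*} [Group H] [AddCommGroup W] [DistribMulAction H W]

lemma ActsIrreducibly.eq_zero_of_conjEnd (hirr : ActsIrreducibly H W) {e : AddMonoid.End W}
    (he : e ≠ 0) {v : W} (hv : ∀ h : H, conjEnd h e v = 0) : v = 0 := by
  let U : AddSubgroup W :=
    { carrier := {v | ∀ h : H, conjEnd h e v = 0}
      zero_mem' := fun h => map_zero _
      add_mem' := fun {a b} ha hb h => by rw [map_add, ha h, hb h, add_zero]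
      neg_mem' := fun {a} ha h => by rw [map_neg, ha h, neg_zero] }
  have hvU : v ∈ U := hv
  rcases hirr U (fun g w hw h => by
    have := hw (g⁻¹ * h)
    rw [← conjEnd_conjEnd, conjEnd_apply, inv_inv, smul_eq_zero_iff_eq] at this
    exact this) with h | h
  · rwa [h] at hvU
  · refine absurd ?_ he
    ext w
    have hw : w ∈ U := by rw [h]; trivial
    simpa using hw 1

lemma ActsIrreducibly.eq_zero_of_central [FaithfulSMul H W] (hirr : ActsIrreducibly H W) {z : H}
    (hz : ∀ h, h * z = z * h) (hz1 : z ≠ 1) {v : W} (hv : z • v = v) : v = 0 := by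
  refine hirr.eq_zero_of_conjEnd (e := DistribMulAction.toAddMonoidEnd H W z - 1) ?_ (v := v) ?_
  · intro h
    refine hz1 (FaithfulSMul.eq_of_smul_eq_smul (α := W) fun w => ?_)
    rw [one_smul]
    exact sub_eq_zero.1 (DFunLike.congr_fun h w)
  · intro h
    have : (DistribMulAction.toAddMonoidEnd H W z - 1) (h⁻¹ • v) = z • (h⁻¹ • v) - h⁻¹ • v := rfl
    rw [conjEnd_apply, this, ← mul_smul, ← hz, mul_smul, hv, sub_self, smul_zero]

lemma ActsIrreducibly.sq_card_fixedBy_le_of_central [Finite W] [FaithfulSMul H W]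
    (hirr : ActsIrreducibly H W) {z : H} (hz : ∀ h, h * z = z * h) (hz1 : z ≠ 1) :
    Nat.card (MulAction.fixedBy W z) ^ 2 ≤ Nat.card W := by
  have : Subsingleton (MulAction.fixedBy W z) := ⟨fun a b => Subtype.ext <| by
    rw [hirr.eq_zero_of_central hz hz1 a.2, hirr.eq_zero_of_central hz hz1 b.2]⟩
  have hpos : 0 < Nat.card W := Nat.card_pos
  have h1 : Nat.card (MulAction.fixedBy W z) ≤ 1 := Finite.card_le_one_iff_subsingleton.2 this
  calc _ ≤ 1 ^ 2 := Nat.pow_le_pow_left h1 2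
    _ = 1 := one_pow 2
    _ ≤ _ := hpos

lemma exists_sq_card_fixedBy_le_of_not_fixed [Finite H] [Group.IsSolvable H] [Finite W]
    (hirr : ActsIrreducibly H W) {x : H} (hx : Subgroup.normalClosure {x} = ⊤)
    {A : Subring (AddMonoid.End W)} (hcomm : ∀ a ∈ A, ∀ b ∈ A, a * b = b * a)
    (hconj : ∀ h : H, ∀ a ∈ A, conjEnd h a ∈ A)
    (hfix : ∃ e ∈ A, e * e = e ∧ ∃ h : H, conjEnd h e ≠ e) :
    ∃ u, (u = x ∨ ∃ m, u = x⁻¹ * (m⁻¹ * x * m)) ∧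
      Nat.card (MulAction.fixedBy W u) ^ 2 ≤ Nat.card W := by
  have : Finite (AddMonoid.End W) := DFunLike.finite _
  obtain ⟨e, ⟨heA, hee, hnf⟩, hmin⟩ := Set.exists_min_image
    {e : AddMonoid.End W | e ∈ A ∧ e * e = e ∧ ∃ h : H, conjEnd h e ≠ e}
    (fun e => (Set.range e).ncard) (Set.toFinite _) hfix
  let S : Subgroup H :=
    { carrier := {h | conjEnd h e = e}
      one_mem' := conjEnd_one e
      mul_mem' := fun {a b} ha hb => by
        rw [Set.mem_ofPred_eq] at *
        rw [← conjEnd_conjEnd, hb, ha]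
      inv_mem' := fun {a} ha => by
        rw [Set.mem_ofPred_eq] at *
        nth_rw 1 [← ha]
        rw [conjEnd_conjEnd, inv_mul_cancel, conjEnd_one] }
  have hS : S ≠ ⊤ := by
    rintro h
    obtain ⟨g, hg⟩ := hnf
    exact hg (show g ∈ S by rw [h]; trivial)
  obtain ⟨u, hu, huS⟩ := exists_forall_conj_notMem hx hS
  have hidem : ∀ h : H, conjEnd h e * conjEnd h e = conjEnd h e := fun h => by
    rw [← conjEnd_mul, hee]
  have hlt : ∀ f ∈ A, f * f = f → e * f = f → f ≠ e → ∀ h : H, conjEnd h f = f := by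
    intro f hfA hff hef hfe
    by_contra! hcon
    refine absurd (hmin f ⟨hfA, hff, hcon⟩) (not_le.2 (Set.ncard_lt_ncard ⟨?_, ?_⟩))
    · rintro _ ⟨v, rfl⟩
      exact ⟨f v, DFunLike.congr_fun hef v⟩
    · intro hsub
      refine hfe ?_
      rw [← hef, hcomm e heA f hfA]
      ext v
      obtain ⟨w, hw⟩ := hsub ⟨v, rfl⟩
      rw [end_mul_apply, ← hw]
      exact DFunLike.congr_fun hff w
  have hdich : ∀ h : H, e * conjEnd h e = 0 ∨ e * conjEnd h e = e := by
    intro h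
    by_contra! hcon
    obtain ⟨e', he'⟩ : ∃ e', e' = conjEnd h e := ⟨_, rfl⟩
    rw [← he'] at hcon
    have he'A : e' ∈ A := he' ▸ hconj h e heA
    have hc := hcomm e heA e' he'A
    have he'e' : e' * e' = e' := he' ▸ hidem h
    have h1 : e * (e * e') = e * e' := by rw [← mul_assoc, hee]
    have h2 : (e * e') * e = e * e' := by rw [mul_assoc, ← hc, h1]
    have h3 : (e * e') * (e * e') = e * e' := by rw [← mul_assoc, h2, mul_assoc, he'e']
    have hf1 := hlt (e * e') (A.mul_mem heA he'A) h3 h1 hcon.2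
    have hf2 := hlt (e - e * e') (A.sub_mem heA (A.mul_mem heA he'A))
      (by rw [mul_sub, sub_mul, sub_mul, hee, h1, h2, h3]; simp)
      (by rw [mul_sub, hee, h1]) (by simpa using hcon.1)
    obtain ⟨g, hg⟩ := hnf
    refine hg ?_
    have hadd : ∀ a b : AddMonoid.End W, conjEnd g (a + b) = conjEnd g a + conjEnd g b := by
      intro a b
      ext v
      exact smul_add g (a (g⁻¹ • v)) (b (g⁻¹ • v))
    calc conjEnd g e = conjEnd g (e * e' + (e - e * e')) := by rw [add_sub_cancel]
      _ = e := by rw [hadd, hf1, hf2, add_sub_cancel]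
  have horth : ∀ h : H, conjEnd h e ≠ e → e * conjEnd h e = 0 := by
    intro h hne
    refine (hdich h).resolve_right fun h1 => hne ?_
    rcases hdich h⁻¹ with h2 | h2
    · have h3 := congrArg (conjEnd h) h2
      rw [conjEnd_mul, conjEnd_conjEnd, mul_inv_cancel, conjEnd_one, conjEnd_zero,
        hcomm _ (hconj h e heA) e heA, h1] at h3
      rw [h3, conjEnd_zero]
    · have h3 := congrArg (conjEnd h) h2
      rw [conjEnd_mul, conjEnd_conjEnd, mul_inv_cancel, conjEnd_one,
        hcomm _ (hconj h e heA) e heA, h1] at h3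
      exact h3.symm
  refine ⟨u, hu, sq_card_fixedBy_le_of_idempotents u (Set.range fun h : H => conjEnd h e)
    ?_ ?_ ?_ ?_ ?_⟩
  · rintro _ ⟨h, rfl⟩
    exact hidem h
  · rintro _ ⟨g, rfl⟩ _ ⟨h, rfl⟩ hne
    have h1 : conjEnd h e = conjEnd g (conjEnd (g⁻¹ * h) e) := by
      rw [conjEnd_conjEnd, mul_inv_cancel_left]
    simp only at hne ⊢
    rw [h1] at hne ⊢
    rw [← conjEnd_mul, horth, conjEnd_zero]
    rintro h2
    exact hne (by rw [h2])
  · intro v hv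
    refine hirr.eq_zero_of_conjEnd (e := e) ?_ fun h => hv _ ⟨h, rfl⟩
    rintro rfl
    obtain ⟨g, hg⟩ := hnf
    exact hg (conjEnd_zero g)
  · rintro _ ⟨h, rfl⟩
    exact ⟨u * h, (conjEnd_conjEnd u h e).symm⟩
  · rintro _ ⟨h, rfl⟩ heq
    refine huS h ?_
    change conjEnd (h⁻¹ * u * h) e = e
    rw [mul_assoc, ← conjEnd_conjEnd, ← conjEnd_conjEnd, heq, conjEnd_conjEnd, inv_mul_cancel,
      conjEnd_one]

/-- Commuting nilpotent endomorphisms have a common zero. -/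
lemma exists_ne_zero_nilpotent_apply_eq_zero [Finite W] [Nontrivial W]
    {A : Subring (AddMonoid.End W)} (hcomm : ∀ a ∈ A, ∀ b ∈ A, a * b = b * a) :
    ∃ v : W, v ≠ 0 ∧ ∀ b ∈ A, (∃ k : ℕ, b ^ k = 0) → b v = 0 := by
  obtain ⟨U, ⟨hU, hUA⟩, hmin⟩ := (Set.toFinite {U : AddSubgroup W |
    U ≠ ⊥ ∧ ∀ a ∈ A, ∀ v ∈ U, a v ∈ U}).exists_minimal ⟨⊤, top_ne_bot, fun _ _ _ _ => trivial⟩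
  obtain ⟨v, hvU, hv⟩ := U.bot_or_exists_ne_zero.resolve_left hU
  refine ⟨v, hv, fun b hb hk => ?_⟩
  by_contra hbv
  have hbot : U ⊓ AddMonoidHom.ker b = ⊥ := by
    by_contra hne
    have hle : U ≤ U ⊓ AddMonoidHom.ker b := hmin ⟨hne, fun a ha w hw => ⟨hUA a ha w hw.1, by
      have hbw : b w = 0 := hw.2
      have := DFunLike.congr_fun (hcomm a ha b hb) w
      rw [end_mul_apply, end_mul_apply, hbw, map_zero] at this
      exact this.symm⟩⟩ inf_le_left
    exact hbv (hle hvU).2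
  have hpow : ∀ k : ℕ, (b ^ k) v ∈ U ∧ (b ^ k) v ≠ 0 := by
    intro k
    induction k with
    | zero => simpa using ⟨hvU, hv⟩
    | succ k ih =>
      rw [pow_succ', end_mul_apply]
      refine ⟨hUA b hb _ ih.1, fun h0 => ih.2 ?_⟩
      have : (b ^ k) v ∈ U ⊓ AddMonoidHom.ker b := ⟨ih.1, h0⟩
      rwa [hbot] at this
  obtain ⟨k, hk⟩ := hk
  exact (hpow k).2 (by rw [hk]; rfl)

end Irreducible

section Irreducible

variable {H W : Type*} [Group H] [AddCommGroup W] [DistribMulAction H W]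

lemma exists_sq_card_fixedBy_le_of_comm [Finite H] [Group.IsSolvable H] [Finite W] [Nontrivial W]
    [FaithfulSMul H W] (hirr : ActsIrreducibly H W) {x : H}
    (hx : Subgroup.normalClosure {x} = ⊤) {N : Subgroup H} [hN : N.Normal]
    (hab : ∀ a ∈ N, ∀ b ∈ N, a * b = b * a) {m : H} (hu : x⁻¹ * (m⁻¹ * x * m) ∈ N)
    (hu1 : x⁻¹ * (m⁻¹ * x * m) ≠ 1) :
    ∃ u, (u = x ∨ ∃ m, u = x⁻¹ * (m⁻¹ * x * m)) ∧
      Nat.card (MulAction.fixedBy W u) ^ 2 ≤ Nat.card W := by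
  have : Finite (AddMonoid.End W) := DFunLike.finite _
  let ρ := DistribMulAction.toAddMonoidEnd H W
  have hρ : ∀ (h : H) (v : W), ρ h v = h • v := fun _ _ => rfl
  let B : Subring (AddMonoid.End W) := Subring.centralizer (ρ '' N)
  let A : Subring (AddMonoid.End W) := Subring.centralizer B
  have hNB : ∀ n ∈ N, ρ n ∈ B := by
    intro n hn
    rw [Subring.mem_centralizer_iff]
    rintro _ ⟨k, hk, rfl⟩
    rw [← map_mul, ← map_mul, hab k hk n hn]
  have hNA : ∀ n ∈ N, ρ n ∈ A := by
    intro n hn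
    rw [Subring.mem_centralizer_iff]
    intro b hb
    exact ((Subring.mem_centralizer_iff.1 hb) _ ⟨n, hn, rfl⟩).symm
  have hAB : A ≤ B := by
    intro a ha
    rw [Subring.mem_centralizer_iff] at ha ⊢
    rintro _ ⟨n, hn, rfl⟩
    exact ha _ (hNB n hn)
  have hcomm : ∀ a ∈ A, ∀ b ∈ A, a * b = b * a := fun a ha b hb =>
    (Subring.mem_centralizer_iff.1 hb) a (hAB ha)
  have hcρ : ∀ h n : H, conjEnd h (ρ n) = ρ (h * n * h⁻¹) := by
    intro h n
    simp only [map_mul]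
    rfl
  have hBc : ∀ h : H, ∀ b ∈ B, conjEnd h b ∈ B := by
    intro h b hb
    rw [Subring.mem_centralizer_iff] at hb ⊢
    rintro _ ⟨n, hn, rfl⟩
    have h1 := congrArg (conjEnd h) (hb _ ⟨_, hN.conj_mem n hn h⁻¹, rfl⟩)
    rw [conjEnd_mul, conjEnd_mul, hcρ] at h1
    rwa [show h * (h⁻¹ * n * h⁻¹⁻¹) * h⁻¹ = n by group] at h1
  have hAc : ∀ h : H, ∀ a ∈ A, conjEnd h a ∈ A := by
    intro h a ha
    rw [Subring.mem_centralizer_iff] at ha ⊢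
    intro b hb
    have h1 := congrArg (conjEnd h) (ha _ (hBc h⁻¹ b hb))
    rwa [conjEnd_mul, conjEnd_mul, conjEnd_conjEnd, mul_inv_cancel, conjEnd_one] at h1
  by_cases hfix : ∃ e ∈ A, e * e = e ∧ ∃ h : H, conjEnd h e ≠ e
  · exact exists_sq_card_fixedBy_le_of_not_fixed hirr hx hcomm hAc hfix
  push Not at hfix
  refine ⟨_, Or.inr ⟨m, rfl⟩, ?_⟩
  obtain ⟨u, hu'⟩ : ∃ u, u = x⁻¹ * (m⁻¹ * x * m) := ⟨_, rfl⟩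
  rw [← hu'] at hu hu1 ⊢
  obtain ⟨b, hb⟩ : ∃ b, b = ρ u - 1 := ⟨_, rfl⟩
  have hbv : ∀ v : W, b v = u • v - v := fun v => by rw [hb]; rfl
  have hbA : b ∈ A := hb ▸ A.sub_mem (hNA u hu) A.one_mem
  obtain ⟨k, hk0, hk⟩ := exists_pow_mul_self_eq b
  by_cases hbk : b ^ k = 0
  · exfalso
    obtain ⟨v, hv, hkill⟩ := exists_ne_zero_nilpotent_apply_eq_zero hcomm
    have hb0 : b ≠ 0 := by
      intro h0
      refine hu1 (FaithfulSMul.eq_of_smul_eq_smul (α := W) fun w => ?_)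
      rw [one_smul, ← sub_eq_zero, ← hbv, h0]
      rfl
    have hcpow : ∀ (h : H) (k : ℕ), conjEnd h (b ^ k) = conjEnd h b ^ k := by
      intro h k
      induction k with
      | zero =>
        ext w
        exact smul_inv_smul h w
      | succ k ih => rw [pow_succ, pow_succ, conjEnd_mul, ih]
    refine hv (hirr.eq_zero_of_conjEnd hb0 fun h => hkill _ (hAc h b hbA) ⟨k, ?_⟩)
    rw [← hcpow, hbk, conjEnd_zero]
  · have hinj : ∀ v : W, u • v = v → v = 0 := by
      intro v hv
      refine hirr.eq_zero_of_conjEnd hbk fun h => ?_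
      rw [hfix _ (A.pow_mem hbA k) hk h]
      obtain ⟨j, rfl⟩ := Nat.exists_eq_succ_of_ne_zero hk0
      rw [pow_succ, end_mul_apply, hbv, hv, sub_self, map_zero]
    have : Subsingleton (MulAction.fixedBy W u) := ⟨fun a b => Subtype.ext <| by
      rw [hinj _ a.2, hinj _ b.2]⟩
    have hpos : 0 < Nat.card W := Nat.card_pos
    have h1 : Nat.card (MulAction.fixedBy W u) ≤ 1 := Finite.card_le_one_iff_subsingleton.2 this
    calc _ ≤ 1 ^ 2 := Nat.pow_le_pow_left h1 2
      _ = 1 := one_pow 2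
      _ ≤ _ := hpos

lemma exists_sq_card_fixedBy_le [Finite H] [Group.IsSolvable H] [Finite W] [Nontrivial W]
    [FaithfulSMul H W] (hirr : ActsIrreducibly H W) {x : H}
    (hx : Subgroup.normalClosure {x} = ⊤) (hx1 : x ≠ 1) :
    ∃ u, (u = x ∨ ∃ m, u = x⁻¹ * (m⁻¹ * x * m)) ∧
      Nat.card (MulAction.fixedBy W u) ^ 2 ≤ Nat.card W := by
  by_cases hc : Subgroup.center H = ⊤
  · refine ⟨x, Or.inl rfl, hirr.sq_card_fixedBy_le_of_central (fun h => ?_) hx1⟩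
    exact Subgroup.mem_center_iff.1 (by rw [hc]; trivial) h
  obtain ⟨N, ⟨hN, hNc⟩, hmin⟩ := (Set.toFinite
    {N : Subgroup H | N.Normal ∧ ¬ N ≤ Subgroup.center H}).exists_minimal
    ⟨⊤, inferInstance, fun h => hc (top_le_iff.1 h)⟩
  have hmin' : ∀ M : Subgroup H, M.Normal → M < N → M ≤ Subgroup.center H := by
    intro M hM hlt
    by_contra hcon
    exact absurd (hmin ⟨hM, hcon⟩ hlt.le) (not_le_of_gt hlt)
  have huN : ∀ g m, m ∈ N → g⁻¹ * (m⁻¹ * g * m) ∈ N := fun g m hm => by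
    have := N.mul_mem (hN.conj_mem _ (N.inv_mem hm) g⁻¹) hm
    simpa [mul_assoc] using this
  obtain ⟨m, hm, hu1⟩ : ∃ m ∈ N, x⁻¹ * (m⁻¹ * x * m) ≠ 1 := by
    by_contra! hcon
    refine hNc fun n hn => Subgroup.mem_center_iff.2 fun g => ?_
    have := commutator_mem_of_normalClosure_eq_top hx (Z := ⊥) (by simpa using hcon) g hn
    rw [Subgroup.mem_bot, inv_mul_eq_one, mul_assoc, eq_inv_mul_iff_mul_eq] at this
    exact this.symm
  have hu := huN x m hm
  obtain ⟨u, hu'⟩ : ∃ u, u = x⁻¹ * (m⁻¹ * x * m) := ⟨_, rfl⟩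
  by_cases hn : ∃ n ∈ N, u⁻¹ * (n⁻¹ * u * n) ≠ 1
  · refine ⟨u, Or.inr ⟨m, hu'⟩, ?_⟩
    obtain ⟨n, hn, hz1⟩ := hn
    have hNbot : N ≠ ⊥ := by rintro rfl; exact hNc bot_le
    have hz : u⁻¹ * (n⁻¹ * u * n) ∈ Subgroup.center H := by
      refine hmin' ⁅N, N⁆ inferInstance (Group.IsSolvable.commutator_lt_of_ne_bot hNbot) ?_
      have := Subgroup.commutator_mem_commutator (N.inv_mem (hu' ▸ hu)) (N.inv_mem hn)
      simpa [commutatorElement_def, mul_assoc] using this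
    rw [Subgroup.mem_center_iff] at hz
    have h2 : ∀ v : W, u • v = v → (n⁻¹ * u * n⁻¹⁻¹) • v = v →
        (u⁻¹ * (n⁻¹ * u * n)) • v = v := fun v hv hv' => by
      rw [inv_inv] at hv'
      rw [mul_smul, hv', inv_smul_eq_iff, hv]
    have h3 := card_fixedBy_mul_le h2
    rw [card_fixedBy_conj, ← sq] at h3
    have : Subsingleton (MulAction.fixedBy W (u⁻¹ * (n⁻¹ * u * n))) := ⟨fun a b => Subtype.ext <| by
      rw [hirr.eq_zero_of_central hz hz1 a.2, hirr.eq_zero_of_central hz hz1 b.2]⟩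
    have h4 := Finite.card_le_one_iff_subsingleton.2 this
    nlinarith
  push Not at hn
  have hcen : u ∈ N ⊓ Subgroup.centralizer (N : Set H) := by
    refine ⟨hu' ▸ hu, Subgroup.mem_centralizer_iff.2 fun n hnN => ?_⟩
    have := hn n hnN
    rw [inv_mul_eq_one, mul_assoc, eq_inv_mul_iff_mul_eq] at this
    exact this
  by_cases hNle : N ⊓ Subgroup.centralizer (N : Set H) < N
  · refine ⟨u, Or.inr ⟨m, hu'⟩, hirr.sq_card_fixedBy_le_of_central ?_ (hu' ▸ hu1)⟩
    exact Subgroup.mem_center_iff.1 (hmin' _ inferInstance hNle hcen)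
  · have hNle : N ≤ Subgroup.centralizer (N : Set H) := by
      by_contra hcon
      exact hNle (inf_le_left.lt_of_ne fun h => hcon (inf_eq_left.1 h))
    exact exists_sq_card_fixedBy_le_of_comm hirr hx (N := N)
      (fun a ha b hb => Subgroup.mem_centralizer_iff.1 (hNle hb) a ha) hu hu1

/-- A normal generator of a finite solvable faithful irreducible linear group fixes at most
`|W| ^ (3 / 4)` vectors. -/
theorem card_fixedBy_pow_four_le [Finite H] [Group.IsSolvable H] [Finite W] [Nontrivial W]
    [FaithfulSMul H W] (hirr : ActsIrreducibly H W) {x : H}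
    (hx : Subgroup.normalClosure {x} = ⊤) (hx1 : x ≠ 1) :
    Nat.card (MulAction.fixedBy W x) ^ 4 ≤ Nat.card W ^ 3 := by
  obtain ⟨u, hu, hle⟩ := exists_sq_card_fixedBy_le (W := W) hirr hx hx1
  have hpos : 0 < Nat.card W := Nat.card_pos
  rcases hu with rfl | ⟨m, rfl⟩
  · calc Nat.card (MulAction.fixedBy W u) ^ 4 = (Nat.card (MulAction.fixedBy W u) ^ 2) ^ 2 := by ring
      _ ≤ Nat.card W ^ 2 := Nat.pow_le_pow_left hle 2
      _ ≤ Nat.card W ^ 3 := Nat.pow_le_pow_right hpos (by norm_num)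
  · have h2 : ∀ v : W, x • v = v → (m⁻¹ * x * m⁻¹⁻¹) • v = v →
        (x⁻¹ * (m⁻¹ * x * m)) • v = v := fun v hv hv' => by
      rw [inv_inv] at hv'
      rw [mul_smul, hv', inv_smul_eq_iff, hv]
    have h3 := card_fixedBy_mul_le h2
    rw [card_fixedBy_conj, ← sq] at h3
    calc Nat.card (MulAction.fixedBy W x) ^ 4 = (Nat.card (MulAction.fixedBy W x) ^ 2) ^ 2 := by ring
      _ ≤ (Nat.card W * Nat.card (MulAction.fixedBy W (x⁻¹ * (m⁻¹ * x * m)))) ^ 2 :=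
        Nat.pow_le_pow_left h3 2
      _ = Nat.card W ^ 2 * Nat.card (MulAction.fixedBy W (x⁻¹ * (m⁻¹ * x * m))) ^ 2 := by ring
      _ ≤ Nat.card W ^ 2 * Nat.card W := by gcongr
      _ = Nat.card W ^ 3 := by ring

end Irreducible

/-- Version of `card_fixedBy_pow_four_le` for actions by automorphisms on an abelian group. -/
lemma card_fixed_pow_four_le {L V : Type*} [Group L] [Finite L] [Group.IsSolvable L] [CommGroup V]
    [Finite V] [Nontrivial V] (φ : L →* MulAut V)
    (hirr : ∀ U : Subgroup V, (∀ g, ∀ v ∈ U, φ g v ∈ U) → U = ⊥ ∨ U = ⊤) {c : L}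
    (hc : Subgroup.normalClosure {c} ⊔ φ.ker = ⊤) (hc1 : φ c ≠ 1) :
    Nat.card {v : V // φ c v = v} ^ 4 ≤ Nat.card V ^ 3 := by
  let act : DistribMulAction φ.range (Additive V) :=
    { smul := fun h v => Additive.ofMul (h.1 v.toMul)
      one_smul := fun _ => rfl
      mul_smul := fun _ _ _ => rfl
      smul_zero := fun h => congrArg Additive.ofMul (map_one h.1)
      smul_add := fun h v w => congrArg Additive.ofMul (map_mul h.1 v.toMul w.toMul) }
  have : FaithfulSMul φ.range (Additive V) := ⟨fun {g h} hgh => Subtype.ext <|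
    MulEquiv.ext fun v => hgh (Additive.ofMul v)⟩
  have hsol : Group.IsSolvable φ.range :=
    Group.isSolvable_of_surjective φ.rangeRestrict_surjective
  have hirr' : ActsIrreducibly φ.range (Additive V) := by
    intro U hU
    rcases hirr (AddSubgroup.toSubgroup' U) (fun g v hv => hU ⟨φ g, g, rfl⟩ (Additive.ofMul v) hv)
      with h | h
    · left
      exact AddSubgroup.toSubgroup'.injective (h.trans (map_bot AddSubgroup.toSubgroup').symm)
    · right
      exact AddSubgroup.toSubgroup'.injective (h.trans (map_top AddSubgroup.toSubgroup').symm)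
  have hgen : Subgroup.normalClosure {φ.rangeRestrict c} = ⊤ := by
    have := congrArg (Subgroup.map φ.rangeRestrict) hc
    rw [Subgroup.map_sup, Subgroup.map_normalClosure _ _ φ.rangeRestrict_surjective,
      Set.image_singleton, ← MonoidHom.range_eq_map,
      MonoidHom.range_eq_top.2 φ.rangeRestrict_surjective,
      (Subgroup.map_eq_bot_iff _).2 (MonoidHom.ker_rangeRestrict φ).ge, sup_bot_eq] at this
    exact this
  have key := card_fixedBy_pow_four_le hirr' hgen fun h => hc1 (congrArg Subtype.val h)
  have h1 : Nat.card (MulAction.fixedBy (Additive V) (φ.rangeRestrict c)) =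
      Nat.card {v : V // φ c v = v} := Nat.card_congr
    { toFun := fun v => ⟨v.1.toMul, v.2⟩
      invFun := fun v => ⟨Additive.ofMul v.1, v.2⟩
      left_inv := fun _ => rfl
      right_inv := fun _ => rfl }
  have h2 : Nat.card (Additive V) = Nat.card V := Nat.card_congr Additive.toMul
  rw [h1, h2] at key
  exact key

section Frame

variable {L : Type*} [Group L]

lemma exists_conj_mem_of_sup_eq [Finite L] {r : ℕ} [Fact r.Prime] {X V R R' : Subgroup L}
    [V.Normal] (hdisj : ∀ P : Subgroup L, IsPGroup r P → P ⊓ V = ⊥) (hR : IsPGroup r R)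
    (hR' : IsPGroup r R') (hRX : R ⊔ V = X) (hRX' : R' ⊔ V = X) :
    ∃ w ∈ V, ∀ e ∈ R, w * e * w⁻¹ ∈ R' := by
  have hRle : R ≤ X := hRX ▸ le_sup_left
  have hRle' : R' ≤ X := hRX' ▸ le_sup_left
  obtain ⟨P, hP⟩ := (hR.comap_subtype (K := X)).exists_le_sylow
  obtain ⟨P', hP'⟩ := (hR'.comap_subtype (K := X)).exists_le_sylow
  have hPR : ∀ y ∈ P', (y : L) ∈ R' := by
    intro y hy
    have hyX : (y : L) ∈ R' ⊔ V := hRX' ▸ y.2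
    obtain ⟨ρ, hρ, v, hv, hρv⟩ := Subgroup.mem_sup_of_normal_right.1 hyX
    have hρP : (⟨ρ, hRle' hρ⟩ : X) ∈ P' := hP' hρ
    have h1 : (⟨ρ, hRle' hρ⟩ : X)⁻¹ * y ∈ P' := mul_mem (inv_mem hρP) hy
    have h2 : v ∈ (P' : Subgroup X).map X.subtype := by
      refine ⟨_, h1, ?_⟩
      change ρ⁻¹ * (y : L) = v
      rw [← hρv, inv_mul_cancel_left]
    have h3 : v ∈ (P' : Subgroup X).map X.subtype ⊓ V := ⟨h2, hv⟩
    rw [hdisj _ (P'.2.map X.subtype), Subgroup.mem_bot] at h3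
    rwa [← hρv, h3, mul_one]
  obtain ⟨x, hx⟩ := MulAction.exists_smul_eq X P P'
  have hxX : (x : L) ∈ R ⊔ V := hRX ▸ x.2
  obtain ⟨w, hw, ρ, hρ, hwρ⟩ := Subgroup.mem_sup_of_normal_left.1 (sup_comm R V ▸ hxX)
  refine ⟨w, hw, fun e he => ?_⟩
  have heR : ρ⁻¹ * e * ρ ∈ R := R.mul_mem (R.mul_mem (R.inv_mem hρ) he) hρ
  have h1 : (⟨ρ⁻¹ * e * ρ, hRle heR⟩ : X) ∈ P := hP heR
  have h2 : x * ⟨ρ⁻¹ * e * ρ, hRle heR⟩ * x⁻¹ ∈ P' := by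
    rw [← hx]
    exact ⟨_, h1, rfl⟩
  have h3 := hPR _ h2
  change (x : L) * (ρ⁻¹ * e * ρ) * (x : L)⁻¹ ∈ R' at h3
  rwa [← hwρ, show w * ρ * (ρ⁻¹ * e * ρ) * (w * ρ)⁻¹ = w * e * w⁻¹ by group] at h3

/-- A minimal normal abelian subgroup `V`, of order prime to `r`, contained in every nontrivial normal subgroup,
below a normal subgroup `X` such that `X / V` is a nontrivial `r`-group. -/
structure IsFrame (r : ℕ) (V X : Subgroup L) : Prop where
  prime : r.Prime
  normal : V.Normal
  normal_above : X.Normal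
  lt : V < X
  ne_bot : V ≠ ⊥
  comm : ∀ a ∈ V, ∀ b ∈ V, a * b = b * a
  le_of_normal : ∀ N : Subgroup L, N.Normal → N ≠ ⊥ → V ≤ N
  disj : ∀ P : Subgroup L, IsPGroup r P → P ⊓ V = ⊥
  exists_pow_mem : ∀ g ∈ X, ∃ k, g ^ r ^ k ∈ V

namespace IsFrame

variable {r : ℕ} {V X : Subgroup L} [Finite L]

/-- A subgroup normalized by a supplement of `V` and centralized or normalized by `V` is normal. -/
lemma normal_of_sup_eq_top {M N : Subgroup L} (hMV : M ⊔ V = ⊤)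
    (hM : ∀ g ∈ M, ∀ n ∈ N, g * n * g⁻¹ ∈ N) (hV : ∀ g ∈ V, ∀ n ∈ N, g * n * g⁻¹ ∈ N) :
    N.Normal := by
  rw [← Subgroup.normalizer_eq_top_iff, eq_top_iff, ← hMV]
  exact sup_le (fun g hg => mem_normalizer_of_conj_mem (hM g hg))
    (fun g hg => mem_normalizer_of_conj_mem (hV g hg))

lemma exists_complement (h : IsFrame r V X) : ∃ R : Subgroup L, IsPGroup r R ∧ R ⊔ V = X := by
  have := Fact.mk h.prime
  have := h.normal
  obtain ⟨P⟩ : Nonempty (Sylow r X) := inferInstance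
  refine ⟨(P : Subgroup X).map X.subtype, P.2.map _, ?_⟩
  have hquot : IsPGroup r (X ⧸ V.subgroupOf X) := by
    intro g
    obtain ⟨g, rfl⟩ := QuotientGroup.mk_surjective g
    obtain ⟨k, hk⟩ := h.exists_pow_mem g g.2
    refine ⟨k, ?_⟩
    rw [← QuotientGroup.mk_pow]
    exact (QuotientGroup.eq_one_iff _).2 hk
  obtain ⟨n, hn⟩ := IsPGroup.iff_card.1 hquot
  have h1 : ((P : Subgroup X) ⊔ V.subgroupOf X).index ∣ (P : Subgroup X).index :=
    Subgroup.index_dvd_of_le le_sup_left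
  have h2 : ((P : Subgroup X) ⊔ V.subgroupOf X).index ∣ r ^ n := by
    rw [← hn]
    exact Subgroup.index_dvd_of_le le_sup_right
  have hcop : ((P : Subgroup X).index).Coprime (r ^ n) :=
    (((Nat.Prime.coprime_iff_not_dvd h.prime).2 P.not_dvd_index).pow_left n).symm
  have h3 : (P : Subgroup X) ⊔ V.subgroupOf X = ⊤ :=
    Subgroup.index_eq_one.1 (Nat.eq_one_of_dvd_coprimes hcop h1 h2)
  have h4 := congrArg (Subgroup.map X.subtype) h3
  rwa [Subgroup.map_sup, Subgroup.map_subgroupOf_eq_of_le h.lt.le, ← MonoidHom.range_eq_map,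
    X.range_subtype] at h4

lemma normalizer_sup (h : IsFrame r V X) {R : Subgroup L} (hR : IsPGroup r R)
    (hRX : R ⊔ V = X) : Subgroup.normalizer (R : Set L) ⊔ V = ⊤ := by
  have := Fact.mk h.prime
  have := h.normal
  refine eq_top_iff.2 fun g _ => ?_
  have hconj : R.map (MulAut.conj g).toMonoidHom ⊔ V = X := by
    have h1 := congrArg (Subgroup.map (MulAut.conj g).toMonoidHom) hRX
    have hN : ∀ N : Subgroup L, N.Normal → N.map (MulAut.conj g).toMonoidHom = N := fun N hN =>
      Subgroup.mem_normalizer_iff_map_conj_eq.1 (by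
        rw [Subgroup.normalizer_eq_top_iff.2 hN]; trivial)
    rwa [Subgroup.map_sup, hN V h.normal, hN X h.normal_above] at h1
  obtain ⟨w, hw, hwR⟩ := exists_conj_mem_of_sup_eq h.disj (hR.map _) hR hconj hRX
  have hwg : w * g ∈ Subgroup.normalizer (R : Set L) := mem_normalizer_of_conj_mem fun e he => by
    have := hwR _ (Subgroup.mem_map_of_mem _ he)
    rwa [show (MulAut.conj g).toMonoidHom e = g * e * g⁻¹ from rfl,
      show w * (g * e * g⁻¹) * w⁻¹ = w * g * e * (w * g)⁻¹ by group] at this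
  have h2 := mul_mem (Subgroup.mem_sup_right (S := Subgroup.normalizer (R : Set L))
    (V.inv_mem hw)) (Subgroup.mem_sup_left hwg)
  rwa [inv_mul_cancel_left] at h2

lemma normalizer_inf (h : IsFrame r V X) {R : Subgroup L} (hR : IsPGroup r R)
    (hRX : R ⊔ V = X) : Subgroup.normalizer (R : Set L) ⊓ V = ⊥ := by
  have hsup := h.normalizer_sup hR hRX
  by_contra hne
  have hnorm : (Subgroup.normalizer (R : Set L) ⊓ V).Normal := by
    refine normal_of_sup_eq_top hsup (fun g hg n hn => ⟨?_, h.normal.conj_mem n hn.2 g⟩)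
      fun g hg n hn => ?_
    · exact Subgroup.mul_mem _ (Subgroup.mul_mem _ hg hn.1) (Subgroup.inv_mem _ hg)
    · rwa [h.comm g hg n hn.2, mul_inv_cancel_right]
  have hVM : V ≤ Subgroup.normalizer (R : Set L) := (h.le_of_normal _ hnorm hne).trans inf_le_left
  rw [sup_eq_left.2 hVM, Subgroup.normalizer_eq_top_iff] at hsup
  by_cases hRbot : R = ⊥
  · rw [hRbot, bot_sup_eq] at hRX
    exact h.lt.ne hRX
  · have h1 := h.disj R hR
    rw [inf_eq_right.2 (h.le_of_normal R hsup hRbot)] at h1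
    exact h.ne_bot h1

lemma centralizer_le (h : IsFrame r V X) : Subgroup.centralizer (V : Set L) ≤ V := by
  have := h.normal
  obtain ⟨R, hR, hRX⟩ := h.exists_complement
  have hsup := h.normalizer_sup hR hRX
  have hinf := h.normalizer_inf hR hRX
  have hVC : V ≤ Subgroup.centralizer (V : Set L) := fun v hv =>
    Subgroup.mem_centralizer_iff.2 fun w hw => h.comm w hw v hv
  have hbot : Subgroup.centralizer (V : Set L) ⊓ Subgroup.normalizer (R : Set L) = ⊥ := by
    by_contra hne
    have hnorm : (Subgroup.centralizer (V : Set L) ⊓ Subgroup.normalizer (R : Set L)).Normal := by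
      refine normal_of_sup_eq_top hsup (fun g hg n hn => ⟨?_, ?_⟩) fun g hg n hn => ?_
      · exact Subgroup.normal_centralizer.conj_mem n hn.1 g
      · exact Subgroup.mul_mem _ (Subgroup.mul_mem _ hg hn.2) (Subgroup.inv_mem _ hg)
      · rwa [Subgroup.mem_centralizer_iff.1 hn.1 g hg, mul_inv_cancel_right]
    have hle := (h.le_of_normal _ hnorm hne).trans inf_le_right
    rw [inf_eq_right.2 hle] at hinf
    exact h.ne_bot hinf
  intro g hg
  have hgtop : g ∈ Subgroup.normalizer (R : Set L) ⊔ V := by rw [hsup]; trivial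
  obtain ⟨m, hm, v, hv, rfl⟩ := Subgroup.mem_sup_of_normal_right.1 hgtop
  have hmC : m ∈ Subgroup.centralizer (V : Set L) ⊓ Subgroup.normalizer (R : Set L) := by
    refine ⟨?_, hm⟩
    have := mul_mem hg (inv_mem (hVC hv))
    rwa [mul_inv_cancel_right] at this
  rw [hbot, Subgroup.mem_bot] at hmC
  rwa [hmC, one_mul]

omit [Finite L] in
lemma inf_isPGroup (h : IsFrame r V X) {E : Subgroup L} (hE : E ⊓ V = ⊥) :
    IsPGroup r (E ⊓ X : Subgroup L) := by
  rintro ⟨g, hgE, hgX⟩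
  obtain ⟨k, hk⟩ := h.exists_pow_mem g hgX
  refine ⟨k, Subtype.ext ?_⟩
  have : g ^ r ^ k ∈ E ⊓ V := ⟨E.pow_mem hgE _, hk⟩
  rwa [hE] at this

omit [Finite L] in
lemma inf_sup_eq (h : IsFrame r V X) {E : Subgroup L} (hE : E ⊔ V = ⊤) : E ⊓ X ⊔ V = X := by
  have := h.normal
  refine le_antisymm (sup_le inf_le_right h.lt.le) fun g hg => ?_
  have hgtop : g ∈ E ⊔ V := by rw [hE]; trivial
  obtain ⟨e, he, v, hv, rfl⟩ := Subgroup.mem_sup_of_normal_right.1 hgtop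
  have heX : e ∈ X := by
    have := mul_mem hg (inv_mem (h.lt.le hv))
    rwa [mul_inv_cancel_right] at this
  exact mul_mem (Subgroup.mem_sup_left ⟨he, heX⟩) (Subgroup.mem_sup_right hv)

/-- Any two complements of `V` are conjugate under `V`. -/
lemma exists_conj_mem (h : IsFrame r V X) {E E' : Subgroup L} (hE : E ⊔ V = ⊤) (hE' : E' ⊔ V = ⊤)
    (hinf : E ⊓ V = ⊥) (hinf' : E' ⊓ V = ⊥) : ∃ w ∈ V, ∀ e ∈ E, w * e * w⁻¹ ∈ E' := by
  have := Fact.mk h.prime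
  have := h.normal
  obtain ⟨w, hw, hconj⟩ := exists_conj_mem_of_sup_eq h.disj (h.inf_isPGroup hinf)
    (h.inf_isPGroup hinf') (h.inf_sup_eq hE) (h.inf_sup_eq hE')
  obtain ⟨w', hw', hconj'⟩ := exists_conj_mem_of_sup_eq h.disj (h.inf_isPGroup hinf')
    (h.inf_isPGroup hinf) (h.inf_sup_eq hE') (h.inf_sup_eq hE)
  refine ⟨w, hw, fun e he => ?_⟩
  have hmap : (E ⊓ X).map (MulAut.conj w).toMonoidHom = E' ⊓ X := by
    refine Subgroup.eq_of_le_of_card_ge ?_ ?_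
    · rintro _ ⟨y, hy, rfl⟩
      exact hconj y hy
    · rw [Subgroup.card_map_of_injective (MulAut.conj w).injective,
        ← Subgroup.card_map_of_injective (K := (E' ⊓ X : Subgroup L))
          (f := (MulAut.conj w').toMonoidHom) (MulAut.conj w').injective]
      refine Subgroup.card_le_of_le ?_
      rintro _ ⟨y, hy, rfl⟩
      exact hconj' y hy
  have hnX := h.normal_above
  have hnE : ∀ g ∈ E', g ∈ Subgroup.normalizer ((E' ⊓ X : Subgroup L) : Set L) := fun g hg =>
    mem_normalizer_of_conj_mem fun y hy =>
      ⟨E'.mul_mem (E'.mul_mem hg hy.1) (E'.inv_mem hg), hnX.conj_mem y hy.2 g⟩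
  have hwe : w * e * w⁻¹ ∈ Subgroup.normalizer ((E' ⊓ X : Subgroup L) : Set L) := by
    refine mem_normalizer_of_conj_mem fun y hy => ?_
    rw [← hmap] at hy ⊢
    obtain ⟨z, hz, rfl⟩ := hy
    refine ⟨e * z * e⁻¹, ⟨E.mul_mem (E.mul_mem he hz.1) (E.inv_mem he), hnX.conj_mem z hz.2 e⟩, ?_⟩
    simp only [MulEquiv.toMonoidHom_eq_coe, MonoidHom.coe_coe, MulAut.conj_apply]
    group
  have htop : w * e * w⁻¹ ∈ E' ⊔ V := by rw [hE']; trivial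
  obtain ⟨e', he', v, hv, heq⟩ := Subgroup.mem_sup_of_normal_right.1 htop
  have hv' : v ∈ Subgroup.normalizer ((E' ⊓ X : Subgroup L) : Set L) ⊓ V := by
    refine ⟨?_, hv⟩
    have := mul_mem (inv_mem (hnE e' he')) hwe
    rwa [← heq, inv_mul_cancel_left] at this
  rw [h.normalizer_inf (h.inf_isPGroup hinf') (h.inf_sup_eq hE'), Subgroup.mem_bot] at hv'
  rwa [← heq, hv', mul_one]

end IsFrame

end Frame

namespace IsFrame

variable {L : Type*} [Group L] [Finite L] [Group.IsSolvable L] {r : ℕ} {V X : Subgroup L}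

/-- The centralizer in `V` of an element whose normal closure supplements `V` is small. -/
lemma card_commute_pow_four_le (h : IsFrame r V X) {c : L}
    (hc : Subgroup.normalClosure {c} ⊔ V = ⊤) :
    Nat.card {v : V // c * v * c⁻¹ = v} ^ 4 ≤ Nat.card V ^ 3 := by
  have := h.normal
  let : CommGroup V := { (inferInstance : Group V) with
    mul_comm := fun a b => Subtype.ext (h.comm a a.2 b b.2) }
  have : Nontrivial V := (Subgroup.nontrivial_iff_ne_bot V).2 h.ne_bot
  have hker : V ≤ (MulAut.conjNormal (H := V)).ker := fun v hv => by
    refine MonoidHom.mem_ker.2 (MulEquiv.ext fun w => Subtype.ext ?_)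
    rw [MulAut.conjNormal_apply, h.comm v hv w w.2, mul_inv_cancel_right]
    rfl
  have key := card_fixed_pow_four_le (MulAut.conjNormal (H := V)) ?_ (c := c) ?_ ?_
  · simpa only [Subtype.ext_iff, MulAut.conjNormal_apply] using key
  · intro U hU
    by_cases hbot : U = ⊥
    · exact Or.inl hbot
    · right
      have hn : (U.map V.subtype).Normal := ⟨by
        rintro _ ⟨u, hu, rfl⟩ g
        exact ⟨_, hU g u hu, MulAut.conjNormal_apply g u⟩⟩
      have hle := h.le_of_normal _ hn
        (mt (Subgroup.map_eq_bot_iff_of_injective _ V.subtype_injective).1 hbot)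
      refine eq_top_iff.2 fun v _ => ?_
      obtain ⟨u, hu, huv⟩ := hle v.2
      rwa [← Subtype.ext huv]
  · exact eq_top_iff.2 (hc ▸ sup_le_sup_left hker _)
  · intro h1
    have hcV : c ∈ V := h.centralizer_le <| Subgroup.mem_centralizer_iff.2 fun v hv => by
      have h2 := congrArg (fun f : MulAut V => ((f ⟨v, hv⟩ : V) : L)) h1
      simp only [MulAut.conjNormal_apply, MulAut.one_apply] at h2
      exact (mul_inv_eq_iff_eq_mul.1 h2).symm
    have hle : Subgroup.normalClosure {c} ≤ V :=
      Subgroup.normalClosure_le_normal (Set.singleton_subset_iff.2 hcV)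
    rw [sup_eq_right.2 hle] at hc
    exact h.lt.not_ge (hc ▸ le_top)

lemma exists_inf_ne_bot (h : IsFrame r V X) {c : Fin 5 → L}
    (hc : ∀ i, Subgroup.normalClosure {c i} ⊔ V = ⊤)
    (hsup : ∀ v : Fin 5 → V, Subgroup.closure (Set.range fun i => v i * c i * (v i : L)⁻¹) ⊔ V = ⊤) :
    ∃ v : Fin 5 → V, Subgroup.closure (Set.range fun i => v i * c i * (v i : L)⁻¹) ⊓ V ≠ ⊥ := by
  by_contra! hbot
  have hcomm : ∀ v : Fin 5 → V, ∃ w : V, ∀ i, c i * (w⁻¹ * v i : V) * (c i)⁻¹ = (w⁻¹ * v i : V) := by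
    intro v
    obtain ⟨w, hw, hconj⟩ := h.exists_conj_mem (hsup 1) (hsup v) (hbot 1) (hbot v)
    refine ⟨⟨w, hw⟩, fun i => ?_⟩
    have h1 : w * c i * w⁻¹ ∈ Subgroup.closure (Set.range fun i => v i * c i * (v i : L)⁻¹) :=
      hconj _ (Subgroup.subset_closure ⟨i, by simp⟩)
    have h2 : v i * c i * (v i : L)⁻¹ ∈
        Subgroup.closure (Set.range fun i => v i * c i * (v i : L)⁻¹) :=
      Subgroup.subset_closure ⟨i, rfl⟩
    have h3 : (w * c i * w⁻¹) * (v i * c i * (v i : L)⁻¹)⁻¹ ∈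
        Subgroup.closure (Set.range fun i => v i * c i * (v i : L)⁻¹) ⊓ V := by
      refine ⟨Subgroup.mul_mem _ h1 (Subgroup.inv_mem _ h2), ?_⟩
      rw [show (w * c i * w⁻¹) * (v i * c i * (v i : L)⁻¹)⁻¹ =
        w * (c i * (w⁻¹ * v i) * (c i)⁻¹) * (v i : L)⁻¹ by group]
      exact V.mul_mem (V.mul_mem hw (h.normal.conj_mem _ (V.mul_mem (V.inv_mem hw) (v i).2) _))
        (V.inv_mem (v i).2)
    rw [hbot v, Subgroup.mem_bot, mul_inv_eq_one] at h3
    change c i * (w⁻¹ * v i) * (c i)⁻¹ = w⁻¹ * v i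
    calc c i * (w⁻¹ * v i) * (c i)⁻¹ = w⁻¹ * (w * c i * w⁻¹) * v i * (c i)⁻¹ := by group
      _ = w⁻¹ * v i := by rw [h3]; group
  have hsurj : Function.Surjective
      fun p : V × (∀ i : Fin 5, {v : V // c i * v * (c i)⁻¹ = v}) => fun i => p.1 * (p.2 i : V) := by
    intro v
    obtain ⟨w, hw⟩ := hcomm v
    exact ⟨(w, fun i => ⟨w⁻¹ * v i, hw i⟩), funext fun i => mul_inv_cancel_left w (v i)⟩
  have hle := Nat.card_le_card_of_surjective _ hsurj
  rw [Nat.card_prod, Nat.card_fun, Nat.card_pi, Nat.card_fin] at hle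
  have hV : 1 < Nat.card V := Subgroup.one_lt_card_iff_ne_bot V |>.2 h.ne_bot
  have h4 : Nat.card V ^ 4 ≤ ∏ i, Nat.card {v : V // c i * v * (c i)⁻¹ = v} :=
    Nat.le_of_mul_le_mul_left (by rwa [← pow_succ']) (zero_lt_one.trans hV)
  have h5 : (Nat.card V ^ 4) ^ 4 ≤ ∏ _i : Fin 5, Nat.card V ^ 3 :=
    (Nat.pow_le_pow_left h4 4).trans (by
      rw [← Finset.prod_pow]
      exact Finset.prod_le_prod' fun i _ => h.card_commute_pow_four_le (hc i))
  rw [Finset.prod_const, Finset.card_univ, Fintype.card_fin, ← pow_mul, ← pow_mul] at h5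
  exact absurd ((Nat.pow_le_pow_iff_right hV).1 h5) (by norm_num)

end IsFrame

section FiveGeneration

universe u

/-- If some iterated residual of the subgroup generated by a conjugation-invariant set is
nontrivial, then it is already nontrivial for the subgroup generated by five elements of the set. -/
def FiveGen (s : List ℕ) (L : Type u) [Group L] : Prop :=
  ∀ C : Set L, (∀ c ∈ C, ∀ g, g * c * g⁻¹ ∈ C) → iterResidual s (Subgroup.closure C) ≠ ⊥ →
    ∃ c : Fin 5 → L, (∀ i, c i ∈ C) ∧ iterResidual s (Subgroup.closure (Set.range c)) ≠ ⊥

lemma fiveGen_nil (L : Type u) [Group L] : FiveGen [] L := by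
  intro C _ hne
  obtain ⟨c, hc, hc1⟩ : ∃ c ∈ C, c ≠ 1 := by
    by_contra! h
    exact hne (Subgroup.closure_eq_bot_iff.2 h)
  refine ⟨fun _ => c, fun _ => hc, fun h => hc1 ?_⟩
  exact Subgroup.closure_eq_bot_iff.1 h (Set.mem_range_self 0)

variable {s t : List ℕ} {L : Type u} [Group L]

lemma conj_mem_isConj {a c : L} (h : IsConj a c) (g : L) : IsConj a (g * c * g⁻¹) :=
  h.trans (isConj_iff.2 ⟨g, rfl⟩)

lemma closure_isConj (a : L) :
    Subgroup.closure {b | IsConj a b} = Subgroup.normalClosure {a} := by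
  rw [Subgroup.normalClosure]
  congr 1
  ext b
  simp [Group.mem_conjugatesOfSet_iff]

lemma closure_le_normalClosure {ι : Type*} {c : ι → L} {a : L} (hc : ∀ i, IsConj a (c i)) :
    Subgroup.closure (Set.range c) ≤ Subgroup.normalClosure {a} := by
  rw [← closure_isConj]
  exact Subgroup.closure_mono (Set.range_subset_iff.2 hc)

variable [Finite L]

lemma FiveGen.exists_not_le (hs : ∀ q ∈ s, q.Prime) {N : Subgroup L} [N.Normal]
    (h : FiveGen s (L ⧸ N)) {C : Set L} (hC : ∀ c ∈ C, ∀ g, g * c * g⁻¹ ∈ C)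
    (hne : ¬ iterResidual s (Subgroup.closure C) ≤ N) :
    ∃ c : Fin 5 → L, (∀ i, c i ∈ C) ∧
      ¬ iterResidual s (Subgroup.closure (Set.range c)) ≤ N := by
  have key : ∀ D : Set L, iterResidual s (Subgroup.closure (QuotientGroup.mk' N '' D)) = ⊥ ↔
      iterResidual s (Subgroup.closure D) ≤ N := fun D => by
    rw [← MonoidHom.map_closure, ← map_iterResidual hs, Subgroup.map_eq_bot_iff,
      QuotientGroup.ker_mk']
  obtain ⟨c, hc, hcne⟩ := h (QuotientGroup.mk' N '' C) (by
    rintro _ ⟨c, hc, rfl⟩ g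
    obtain ⟨g, rfl⟩ := QuotientGroup.mk'_surjective N g
    exact ⟨_, hC c hc g, by simp⟩) (mt (key C).1 hne)
  choose d hd hdc using hc
  refine ⟨d, hd, mt (key _).2 ?_⟩
  rwa [← Set.range_comp, show QuotientGroup.mk' N ∘ d = c from funext hdc]

lemma fiveGen_of_normalClosure (hs : ∀ q ∈ s, q.Prime)
    (h : ∀ a : L, iterResidual s (Subgroup.normalClosure {a}) ≠ ⊥ →
      ∃ c : Fin 5 → L, (∀ i, IsConj a (c i)) ∧
        iterResidual s (Subgroup.closure (Set.range c)) ≠ ⊥) : FiveGen s L := by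
  intro C hC hne
  have hcl : Subgroup.closure C = ⨆ a : C, Subgroup.normalClosure {(a : L)} := by
    refine le_antisymm ((Subgroup.closure_le _).2 fun a ha => ?_) (iSup_le fun a => ?_)
    · exact Subgroup.mem_iSup_of_mem (⟨a, ha⟩ : C)
        (Subgroup.subset_normalClosure (Set.mem_singleton a))
    · rw [← closure_isConj]
      refine Subgroup.closure_mono fun b hb => ?_
      obtain ⟨g, rfl⟩ := isConj_iff.1 hb
      exact hC a a.2 g
  obtain ⟨a, ha⟩ : ∃ a : C, iterResidual s (Subgroup.normalClosure {(a : L)}) ≠ ⊥ := by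
    by_contra! hbot
    rw [hcl, iterResidual_iSup hs] at hne
    exact hne (iSup_eq_bot.2 hbot)
  obtain ⟨c, hc, hcne⟩ := h a ha
  refine ⟨c, fun i => ?_, hcne⟩
  obtain ⟨g, hg⟩ := isConj_iff.1 (hc i)
  exact hg ▸ hC a a.2 g

/-- An abelian subgroup contained in every nontrivial normal subgroup is a `q`-group. -/
lemma exists_prime_isPGroup {V : Subgroup L} (hV : V.Normal) (hbot : V ≠ ⊥)
    (hcomm : ∀ a ∈ V, ∀ b ∈ V, a * b = b * a)
    (hmin : ∀ N : Subgroup L, N.Normal → N ≠ ⊥ → V ≤ N) : ∃ q, q.Prime ∧ IsPGroup q V := by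
  obtain ⟨q, hq, hdvd⟩ := Nat.exists_prime_and_dvd
    (fun h => hbot (Subgroup.card_eq_one.1 h) : Nat.card V ≠ 1)
  have := Fact.mk hq
  obtain ⟨a, ha⟩ := exists_prime_orderOf_dvd_card' (G := V) q hdvd
  let N : Subgroup L :=
    { carrier := {v | v ∈ V ∧ v ^ q = 1}
      mul_mem' := fun {x y} hx hy => ⟨V.mul_mem hx.1 hy.1, by
        rw [(show Commute x y from hcomm x hx.1 y hy.1).mul_pow, hx.2, hy.2, one_mul]⟩
      one_mem' := ⟨V.one_mem, one_pow q⟩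
      inv_mem' := fun {x} hx => ⟨V.inv_mem hx.1, by rw [inv_pow, hx.2, inv_one]⟩ }
  have hN : N.Normal := ⟨fun n hn g => ⟨hV.conj_mem n hn.1 g, by
    rw [conj_pow, hn.2, mul_one, mul_inv_cancel]⟩⟩
  have haN : (a : L) ∈ N := ⟨a.2, by
    rw [← ha, ← Subgroup.coe_pow, pow_orderOf_eq_one, Subgroup.coe_one]⟩
  have hNbot : N ≠ ⊥ := fun h => by
    rw [h, Subgroup.mem_bot, OneMemClass.coe_eq_one] at haN
    rw [haN, orderOf_one] at ha
    exact hq.one_lt.ne ha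
  exact ⟨q, hq, fun v => ⟨1, Subtype.ext (by simpa using (hmin N hN hNbot v.2).2)⟩⟩

lemma isPGroup_of_pResidual {r : ℕ} (hr : r.Prime) {X : Subgroup L}
    (h : IsPGroup r (pResidual r X)) : IsPGroup r X := by
  rintro ⟨g, hg⟩
  obtain ⟨k, hk⟩ := exists_pow_mem_pResidual hr hg
  obtain ⟨j, hj⟩ := h ⟨_, hk⟩
  refine ⟨k + j, Subtype.ext ?_⟩
  have := congrArg Subtype.val hj
  simpa [pow_add, pow_mul] using this

/-- The induction step of `fiveGen` when a frame is present and the five given elements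
generate a proper subgroup modulo the bottom of the frame. -/
lemma IsFrame.iterResidual_closure_ne_bot [Group.IsSolvable L] {r : ℕ} {V X : Subgroup L}
    (h : IsFrame r V X) (ht : ∀ q ∈ t, q.Prime) {K₀ : Subgroup L} (hV : V ≤ K₀)
    {C : Set K₀} (hC : ∀ c ∈ C, ∀ g, g * c * g⁻¹ ∈ C)
    (hne : ¬ iterResidual t ((Subgroup.closure C).map K₀.subtype) ≤ V) :
    iterResidual (r :: t) (Subgroup.closure C) ≠ ⊥ := by
  intro hbot
  rw [iterResidual_cons, pResidual_eq_bot_iff h.prime] at hbot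
  have hn : (Subgroup.closure C).Normal := by
    rw [← Subgroup.normalizer_eq_top_iff, eq_top_iff]
    exact fun g _ => mem_normalizer_closure fun c hc => hC c hc g
  have hYn := iterResidual_normal ht (Subgroup.closure C)
  rw [← map_iterResidual ht] at hne
  set Y := iterResidual t (Subgroup.closure C)
  have hdisj := h.disj _ (hbot.map K₀.subtype)
  refine hne (le_trans ?_ h.centralizer_le)
  rintro _ ⟨y, hy, rfl⟩
  refine Subgroup.mem_centralizer_iff.2 fun v hv => ?_
  have h1 : v * (y : L) * v⁻¹ * (y : L)⁻¹ ∈ Y.map K₀.subtype ⊓ V := by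
    refine ⟨⟨⟨v, hV hv⟩ * y * ⟨v, hV hv⟩⁻¹ * y⁻¹,
      Y.mul_mem (hYn.conj_mem y hy _) (Y.inv_mem hy), rfl⟩, ?_⟩
    rw [show v * (y : L) * v⁻¹ * (y : L)⁻¹ = v * ((y : L) * v⁻¹ * (y : L)⁻¹) by group]
    exact V.mul_mem hv (h.normal.conj_mem _ (V.inv_mem hv) _)
  rw [hdisj, Subgroup.mem_bot, mul_inv_eq_one, mul_inv_eq_iff_eq_mul] at h1
  exact h1

lemma IsFrame.exists_of_sup_eq_top [Group.IsSolvable L] {r : ℕ} {V X : Subgroup L}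
    (h : IsFrame r V X) {a : L} (hV : V ≤ iterResidual s (Subgroup.normalClosure {a}))
    {c : Fin 5 → L} (hc : ∀ i, IsConj a (c i)) (htop : Subgroup.closure (Set.range c) ⊔ V = ⊤) :
    ∃ d : Fin 5 → L, (∀ i, IsConj a (d i)) ∧
      iterResidual s (Subgroup.closure (Set.range d)) ≠ ⊥ := by
  have hnc : ∀ i, Subgroup.normalClosure {c i} ⊔ V = ⊤ := fun i => by
    refine eq_top_iff.2 (htop ▸ sup_le_sup_right (closure_le_normalClosure fun j => ?_) V)
    exact (hc i).symm.trans (hc j)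
  have hsup : ∀ v : Fin 5 → V,
      Subgroup.closure (Set.range fun i => v i * c i * (v i : L)⁻¹) ⊔ V = ⊤ := by
    intro v
    refine eq_top_iff.2 (htop ▸ sup_le ((Subgroup.closure_le _).2 ?_) le_sup_right)
    rintro _ ⟨i, rfl⟩
    set K := Subgroup.closure (Set.range fun i => v i * c i * (v i : L)⁻¹) ⊔ V
    have hvK : (v i : L) ∈ K := Subgroup.mem_sup_right (v i).2
    have hcK : v i * c i * (v i : L)⁻¹ ∈ K :=
      Subgroup.mem_sup_left (Subgroup.subset_closure ⟨i, rfl⟩)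
    have := K.mul_mem (K.mul_mem (K.inv_mem hvK) hcK) hvK
    rwa [show (v i : L)⁻¹ * (v i * c i * (v i : L)⁻¹) * v i = c i by group] at this
  obtain ⟨v, hv⟩ := h.exists_inf_ne_bot hnc hsup
  refine ⟨fun i => v i * c i * (v i : L)⁻¹, fun i => conj_mem_isConj (hc i) _, fun hbot => ?_⟩
  have hsup' := hsup v
  set K := Subgroup.closure (Set.range fun i => v i * c i * (v i : L)⁻¹)
  have hn : (K ⊓ V).Normal := by
    refine IsFrame.normal_of_sup_eq_top hsup' (fun g hg n hn => ⟨?_, h.normal.conj_mem n hn.2 g⟩)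
      fun g hg n hn => ?_
    · exact K.mul_mem (K.mul_mem hg hn.1) (K.inv_mem hg)
    · rwa [h.comm g hg n hn.2, mul_inv_cancel_right]
  rw [sup_eq_left.2 ((h.le_of_normal _ hn hv).trans inf_le_left)] at hsup'
  refine h.ne_bot (eq_bot_iff.2 (hV.trans ?_))
  rw [← hbot, hsup']
  exact iterResidual_mono s le_top

lemma FiveGen.of_subgroup (hs : ∀ q ∈ s, q.Prime) {K : Subgroup L} (h : FiveGen s K) {C : Set L}
    (hC : ∀ c ∈ C, ∀ g, g * c * g⁻¹ ∈ C)
    (hne : iterResidual s (Subgroup.closure (K.subtype ⁻¹' C)) ≠ ⊥) :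
    ∃ c : Fin 5 → L, (∀ i, c i ∈ C) ∧ iterResidual s (Subgroup.closure (Set.range c)) ≠ ⊥ := by
  obtain ⟨c, hc, hcne⟩ := h (K.subtype ⁻¹' C) (fun c hc g => hC c hc g) hne
  refine ⟨K.subtype ∘ c, hc, ?_⟩
  rw [Set.range_comp, ← MonoidHom.map_closure, ← map_iterResidual hs]
  exact mt (Subgroup.map_eq_bot_iff_of_injective _ K.subtype_injective).1 hcne

lemma FiveGen.cons [Group.IsSolvable L] {r : ℕ} (hr : r.Prime) (ht : ∀ q ∈ t, q.Prime)
    (htail : ∀ (M : Type u) [Group M] [Finite M] [Group.IsSolvable M], FiveGen t M)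
    (hcard : ∀ (M : Type u) [Group M] [Finite M] [Group.IsSolvable M],
      Nat.card M < Nat.card L → FiveGen (r :: t) M) : FiveGen (r :: t) L := by
  have hs : ∀ q ∈ r :: t, q.Prime := by simpa using ⟨hr, ht⟩
  refine fiveGen_of_normalClosure hs fun a ha => ?_
  have hCconj : ∀ c ∈ {b | IsConj a b}, ∀ g, g * c * g⁻¹ ∈ {b | IsConj a b} :=
    fun c hc g => conj_mem_isConj hc g
  obtain ⟨V, hV⟩ : ∃ V, V = iterResidual (r :: t) (Subgroup.normalClosure {a}) := ⟨_, rfl⟩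
  obtain ⟨X, hX⟩ : ∃ X, X = iterResidual t (Subgroup.normalClosure {a}) := ⟨_, rfl⟩
  have hVX : V = pResidual r X := by rw [hV, hX, iterResidual_cons]
  have hVn : V.Normal := hV ▸ iterResidual_normal hs _
  have hXn : X.Normal := hX ▸ iterResidual_normal ht _
  have hVle : V ≤ X := hVX ▸ pResidual_le _ _
  have hVbot : V ≠ ⊥ := hV ▸ ha
  have hquot : ∀ N : Subgroup L, N ≠ ⊥ → N.index < Nat.card L := fun N hN => by
    rw [← N.card_mul_index]
    exact lt_mul_of_one_lt_left (Nat.pos_of_ne_zero N.index_ne_zero_of_finite)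
      ((Subgroup.one_lt_card_iff_ne_bot N).2 hN)
  by_cases hmin : ∀ N : Subgroup L, N.Normal → N ≠ ⊥ → V ≤ N
  swap
  · push Not at hmin
    obtain ⟨N, hN, hNbot, hVN⟩ := hmin
    obtain ⟨c, hc, hcne⟩ := (hcard (L ⧸ N) (hquot N hNbot)).exists_not_le hs hCconj
      (by rwa [closure_isConj, ← hV])
    exact ⟨c, hc, fun h => hcne (h ▸ bot_le)⟩
  have hcomm : ∀ a ∈ V, ∀ b ∈ V, a * b = b * a := by
    have hlt := Group.IsSolvable.commutator_lt_of_ne_bot hVbot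
    have hbot : ⁅V, V⁆ = ⊥ := by
      by_contra hne
      exact hlt.not_ge (hmin _ inferInstance hne)
    intro a ha b hb
    exact (Subgroup.mem_centralizer_iff.1
      (Subgroup.commutator_eq_bot_iff_le_centralizer.1 hbot hb) a ha)
  obtain ⟨q, hq, hqV⟩ := exists_prime_isPGroup hVn hVbot hcomm hmin
  have hqr : q ≠ r := by
    rintro rfl
    exact hVbot (hVX ▸ (pResidual_eq_bot_iff hr).2 (isPGroup_of_pResidual hr (hVX ▸ hqV)))
  rcases hVle.eq_or_lt with heq | hlt
  · obtain ⟨c, hc, hcne⟩ := htail L {b | IsConj a b} hCconj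
      (by rwa [closure_isConj, ← hX, ← heq])
    refine ⟨c, hc, ?_⟩
    have hle : iterResidual t (Subgroup.closure (Set.range c)) ≤ V := by
      rw [heq, hX]
      exact iterResidual_mono t (closure_le_normalClosure hc)
    rwa [iterResidual_cons, pResidual_eq_self_of_ne hq hr hqr (hqV.to_le hle)]
  have hframe : IsFrame r V X :=
    { prime := hr
      normal := hVn
      normal_above := hXn
      lt := hlt
      ne_bot := hVbot
      comm := hcomm
      le_of_normal := hmin
      disj := fun P hP => by
        have := Fact.mk hr
        have := Fact.mk hq
        exact (IsPGroup.disjoint_of_ne r q hqr.symm P V hP hqV).eq_bot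
      exists_pow_mem := fun g hg => hVX ▸ exists_pow_mem_pResidual hr hg }
  obtain ⟨c, hc, hcne⟩ := (htail (L ⧸ V)).exists_not_le ht hCconj
    (by rw [closure_isConj, ← hX]; exact hlt.not_ge)
  by_cases htop : Subgroup.closure (Set.range c) ⊔ V = ⊤
  · exact hframe.exists_of_sup_eq_top hV.le hc htop
  obtain ⟨K₀, hK₀⟩ : ∃ K₀, K₀ = Subgroup.closure (Set.range c) ⊔ V := ⟨_, rfl⟩
  rw [← hK₀] at htop
  have hK₀c : ∀ i, c i ∈ K₀ := fun i =>
    hK₀ ▸ Subgroup.mem_sup_left (Subgroup.subset_closure (Set.mem_range_self i))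
  refine (hcard K₀ ?_).of_subgroup hs hCconj (hframe.iterResidual_closure_ne_bot ht
    (hK₀ ▸ le_sup_right) (fun c hc g => hCconj c hc g) fun hle => hcne (le_trans ?_ hle))
  · exact lt_of_le_of_ne (Subgroup.card_le_card_group K₀) (mt (Subgroup.eq_top_of_card_eq K₀) htop)
  · refine iterResidual_mono t ?_
    rw [MonoidHom.map_closure]
    refine Subgroup.closure_mono ?_
    rintro _ ⟨i, rfl⟩
    exact ⟨⟨c i, hK₀c i⟩, hc i, rfl⟩

theorem fiveGen (s : List ℕ) (hs : ∀ q ∈ s, q.Prime) (L : Type u) [Group L] [Finite L]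
    [Group.IsSolvable L] : FiveGen s L := by
  induction s generalizing L with
  | nil => exact fiveGen_nil L
  | cons r t ih =>
    simp only [List.mem_cons, forall_eq_or_imp] at hs
    obtain ⟨n, hn⟩ : ∃ n, n = Nat.card L := ⟨_, rfl⟩
    induction n using Nat.strong_induction_on generalizing L with
    | _ n ihn =>
      exact FiveGen.cons hs.1 hs.2 (fun M _ _ _ => ih hs.2 M)
        fun M _ _ _ hM => ihn _ (hn ▸ hM) M rfl

end FiveGeneration

section Power

variable {G : Type*} [Group G] [Finite G] {q : ℕ}

/-- The transfer of `Y` into a central subgroup `A` is the power map. -/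
lemma exists_hom_eq_pow_relIndex {A Y : Subgroup G} (hcen : ∀ a ∈ A, ∀ y ∈ Y, a * y = y * a) :
    ∃ f : Y →* A.subgroupOf Y, ∀ y, ((f y : Y) : G) = (y : G) ^ A.relIndex Y := by
  let : CommGroup (A.subgroupOf Y) := { (inferInstance : Group (A.subgroupOf Y)) with
    mul_comm := fun a b => Subtype.ext (Subtype.ext (hcen _ a.2 _ b.1.2)) }
  have key : ∀ (y : Y) (k : ℕ) (g₀ : Y), g₀⁻¹ * y ^ k * g₀ ∈ A.subgroupOf Y →
      g₀⁻¹ * y ^ k * g₀ = y ^ k := by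
    intro y k g₀ h
    have h1 : g₀⁻¹ * y ^ k * g₀ * g₀⁻¹ = g₀⁻¹ * (g₀⁻¹ * y ^ k * g₀) :=
      Subtype.ext (hcen _ h _ g₀⁻¹.2)
    calc g₀⁻¹ * y ^ k * g₀ = g₀ * (g₀⁻¹ * (g₀⁻¹ * y ^ k * g₀)) := by group
      _ = y ^ k := by rw [← h1]; group
  refine ⟨MonoidHom.transfer (MonoidHom.id (A.subgroupOf Y)), fun y => ?_⟩
  rw [MonoidHom.transfer_eq_pow _ y (key y)]
  rfl

lemma exists_pow_mem_of_central (hq : q.Prime) {A Y : Subgroup G} (hAY : A ≤ Y)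
    (hcen : ∀ a ∈ A, ∀ y ∈ Y, a * y = y * a) (hA : IsPGroup q A) (hbot : A ≠ ⊥)
    (hcop : (A.relIndex Y).Coprime q) {S : Set G} (hS : Subgroup.closure S = Y) :
    ∃ x ∈ S, ∃ m, x ^ m ∈ A ∧ x ^ m ≠ 1 := by
  obtain ⟨f, hf⟩ := exists_hom_eq_pow_relIndex hcen
  by_contra! h
  have hmem : ∀ y : Y, (y : G) ^ A.relIndex Y ∈ A := fun y => hf y ▸ (f y).2
  have hle : Y ≤ f.ker.map Y.subtype := by
    conv_lhs => rw [← hS]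
    refine (Subgroup.closure_le _).2 fun x hx => ?_
    have hxY : x ∈ Y := hS ▸ Subgroup.subset_closure hx
    refine ⟨⟨x, hxY⟩, MonoidHom.mem_ker.2 (Subtype.ext (Subtype.ext ?_)), rfl⟩
    rw [hf]
    exact h x hx _ (hmem ⟨x, hxY⟩)
  refine hbot ((Subgroup.eq_bot_iff_forall A).2 fun a ha => ?_)
  obtain ⟨y, hy, rfl⟩ := hle (hAY ha)
  have h1 : (y : G) ^ A.relIndex Y = 1 := by
    rw [← hf, MonoidHom.mem_ker.1 hy]; rfl
  have := Fact.mk hq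
  obtain ⟨k, hk⟩ := hA ⟨_, ha⟩
  have hk' : (y : G) ^ q ^ k = 1 := congrArg Subtype.val hk
  have h3 := Nat.dvd_gcd (orderOf_dvd_of_pow_eq_one h1) (orderOf_dvd_of_pow_eq_one hk')
  rw [(hcop.pow_right k : Nat.gcd _ _ = 1), Nat.dvd_one, orderOf_eq_one_iff] at h3
  exact h3

lemma relIndex_pResidual_coprime {r : ℕ} (hq : q.Prime) (hr : r.Prime) (hqr : r ≠ q)
    (X : Subgroup G) : ((pResidual r X).relIndex X).Coprime q := by
  have hn : ((pResidual r X).subgroupOf X).Normal :=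
    Subgroup.normal_subgroupOf_iff_le_normalizer (pResidual_le r X) |>.2 <|
      Subgroup.le_normalizer.trans
        (normalizer_le_normalizer_iterResidual (s := [r]) (by simpa using hr) X)
  have hp : IsPGroup r (X ⧸ (pResidual r X).subgroupOf X) := by
    intro g
    obtain ⟨g, rfl⟩ := QuotientGroup.mk_surjective g
    obtain ⟨k, hk⟩ := exists_pow_mem_pResidual hr g.2
    refine ⟨k, ?_⟩
    rw [← QuotientGroup.mk_pow]
    exact (QuotientGroup.eq_one_iff _).2 hk
  have := Fact.mk hr
  obtain ⟨n, hn⟩ := IsPGroup.iff_card.1 hp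
  rw [Subgroup.relIndex, Subgroup.index, hn]
  exact ((Nat.coprime_primes hr hq).2 hqr).pow_left n

/-- A central `q`-subgroup of index prime to `q` in an iterated residual of `Y` has
index prime to `q` in `Y`. -/
lemma relIndex_coprime_of_iterResidual (hq : q.Prime) {s : List ℕ} (hs : ∀ r ∈ s, r.Prime)
    {A Y : Subgroup G} (hcen : ∀ a ∈ A, ∀ y ∈ Y, a * y = y * a) (hA : IsPGroup q A)
    (hbot : A ≠ ⊥) (hle : A ≤ iterResidual s Y) (hcop : (A.relIndex (iterResidual s Y)).Coprime q) :
    (A.relIndex Y).Coprime q := by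
  induction s with
  | nil => exact hcop
  | cons r s ih =>
    simp only [List.mem_cons, forall_eq_or_imp] at hs
    rw [iterResidual_cons] at hle hcop
    have hle' := hle.trans (pResidual_le r _)
    refine ih hs.2 hle' ?_
    rw [← Subgroup.relIndex_mul_relIndex _ _ _ hle (pResidual_le r _)]
    refine hcop.mul_left (relIndex_pResidual_coprime hq hs.1 ?_ _)
    rintro rfl
    obtain ⟨x, hx, m, hxA, hx1⟩ := exists_pow_mem_of_central hq hle
      (fun a ha y hy => hcen a ha y (iterResidual_le s Y (pResidual_le r _ hy))) hA hbot hcop rfl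
    have := Fact.mk hq
    obtain ⟨k, hk⟩ := hA ⟨_, hxA⟩
    have hk' : (x ^ m) ^ r ^ k = 1 := congrArg Subtype.val hk
    have h3 := Nat.dvd_gcd (orderOf_pow_dvd (x := x) m) (orderOf_dvd_of_pow_eq_one hk')
    rw [(hx.2.pow_right k : Nat.gcd _ _ = 1), Nat.dvd_one, orderOf_eq_one_iff] at h3
    exact hx1 h3

/-- A nontrivial iterated residual of `closure S` that is a `q`-group contains a nontrivial element
of the form `x ^ m` or `[a, x]` with `x ∈ S`, `a` in the residual. -/
lemma exists_pow_or_commutator_mem (hq : q.Prime) {s : List ℕ} (hs : ∀ r ∈ s, r.Prime) (S : Set G)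
    (hA : IsPGroup q (iterResidual s (Subgroup.closure S)))
    (hbot : iterResidual s (Subgroup.closure S) ≠ ⊥) :
    ∃ x ∈ S, ∃ ρ ∈ iterResidual s (Subgroup.closure S), ρ ≠ 1 ∧
      ((∃ m, ρ = x ^ m) ∨ ∃ a, ρ = a * x * a⁻¹ * x⁻¹) := by
  set A := iterResidual s (Subgroup.closure S)
  by_cases hcen : ∀ x ∈ S, ∀ a ∈ A, a * x = x * a
  · have hcen' : ∀ a ∈ A, ∀ y ∈ Subgroup.closure S, a * y = y * a := fun a ha y hy => by
      have hle : Subgroup.closure S ≤ Subgroup.centralizer {a} :=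
        (Subgroup.closure_le _).2 fun x hx => Subgroup.mem_centralizer_singleton_iff.2
          (hcen x hx a ha).symm
      exact (Subgroup.mem_centralizer_singleton_iff.1 (hle hy)).symm
    obtain ⟨x, hx, m, hxA, hx1⟩ := exists_pow_mem_of_central hq (iterResidual_le s _) hcen' hA hbot
      (relIndex_coprime_of_iterResidual hq hs hcen' hA hbot le_rfl (by simp)) rfl
    exact ⟨x, hx, _, hxA, hx1, Or.inl ⟨m, rfl⟩⟩
  · push Not at hcen
    obtain ⟨x, hx, a, ha, hax⟩ := hcen
    refine ⟨x, hx, a * x * a⁻¹ * x⁻¹, ?_, fun h => hax ?_, Or.inr ⟨a, rfl⟩⟩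
    · have hxn := normalizer_le_normalizer_iterResidual hs (Subgroup.closure S)
        (Subgroup.le_normalizer (Subgroup.subset_closure hx))
      have := A.mul_mem ha ((Subgroup.mem_normalizer_iff.1 hxn _).1 (A.inv_mem ha))
      rwa [show a * (x * a⁻¹ * x⁻¹) = a * x * a⁻¹ * x⁻¹ by group] at this
    · rwa [mul_inv_eq_one, mul_inv_eq_iff_eq_mul] at h

end Power

section Main

universe u

variable {G : Type u} [Group G]

lemma isSolvable_of_le {H K : Subgroup G} (h : H ≤ K) (hK : Group.IsSolvable K) :
    Group.IsSolvable H :=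
  Group.isSolvable_of_isSolvable_injective (Subgroup.inclusion_injective h)

lemma isSolvable_of_map_mk' {N H : Subgroup G} [N.Normal] (hN : Group.IsSolvable N)
    (hH : Group.IsSolvable (H.map (QuotientGroup.mk' N))) : Group.IsSolvable H := by
  have := isSolvable_of_le (inf_le_right : H ⊓ N ≤ N) hN
  refine Group.isSolvable_of_ker_le_range (Subgroup.inclusion (inf_le_left : H ⊓ N ≤ H))
    ((QuotientGroup.mk' N).subgroupMap H) fun g hg => ?_
  have h1 : QuotientGroup.mk' N g = 1 := congrArg Subtype.val (MonoidHom.mem_ker.1 hg)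
  exact ⟨⟨g, g.2, (QuotientGroup.eq_one_iff _).1 h1⟩, rfl⟩

variable [Finite G]

/-- For a finite family of solvable subgroups, not all trivial, there is an iterated residual
which is a `q`-group on each member and nontrivial on some member. -/
lemma exists_iterResidual_isPGroup {ι : Type*} [Finite ι] (K : ι → Subgroup G)
    (hK : ∀ i, Group.IsSolvable (K i)) (hne : ∃ i, K i ≠ ⊥) :
    ∃ s : List ℕ, (∀ r ∈ s, r.Prime) ∧ ∃ q, q.Prime ∧
      (∀ i, IsPGroup q (iterResidual s (K i))) ∧ ∃ i, iterResidual s (K i) ≠ ⊥ := by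
  have := Fintype.ofFinite ι
  suffices h : ∀ n, ∀ s : List ℕ, (∀ r ∈ s, r.Prime) → ∑ i, Nat.card (iterResidual s (K i)) = n →
      (∃ i, iterResidual s (K i) ≠ ⊥) → ∃ s : List ℕ, (∀ r ∈ s, r.Prime) ∧ ∃ q, q.Prime ∧
      (∀ i, IsPGroup q (iterResidual s (K i))) ∧ ∃ i, iterResidual s (K i) ≠ ⊥ from
    h _ [] (by simp) rfl hne
  intro n
  induction n using Nat.strong_induction_on with
  | _ n ih =>
    rintro s hs rfl ⟨i, hi⟩
    have := isSolvable_of_le (iterResidual_le s (K i)) (hK i)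
    obtain ⟨q, hq, hlt⟩ := exists_pResidual_lt hi
    by_cases hall : ∀ j, IsPGroup q (iterResidual s (K j))
    · exact ⟨s, hs, q, hq, hall, i, hi⟩
    push Not at hall
    obtain ⟨j, hj⟩ := hall
    refine ih _ ?_ (q :: s) (by simpa using ⟨hq, hs⟩) rfl
      ⟨j, mt (pResidual_eq_bot_iff hq).1 hj⟩
    exact Finset.sum_lt_sum (fun k _ => Subgroup.card_le_of_le (pResidual_le q _))
      ⟨i, Finset.mem_univ i, Set.ncard_lt_ncard hlt (Set.toFinite _)⟩

/-- Five conjugates suffice to witness a nontrivial iterated residual of a solvable subgroup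
generated by conjugates. -/
lemma exists_five_conj {s : List ℕ} (hs : ∀ r ∈ s, r.Prime) {ι : Type*} {x : G} {c : ι → G}
    (hc : ∀ i, IsConj x (c i)) (hsol : Group.IsSolvable (Subgroup.closure (Set.range c)))
    (hne : iterResidual s (Subgroup.closure (Set.range c)) ≠ ⊥) :
    ∃ e : Fin 5 → G, (∀ i, IsConj x (e i)) ∧
      iterResidual s (Subgroup.closure (Set.range e)) ≠ ⊥ := by
  refine (fiveGen s hs (Subgroup.closure (Set.range c))).of_subgroup hs
    (C := {b | IsConj x b}) (fun c hc g => conj_mem_isConj hc g) fun hbot => hne ?_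
  rw [← Subgroup.map_eq_bot_iff_of_injective _ (Subgroup.subtype_injective _),
    map_iterResidual hs] at hbot
  refine eq_bot_iff.2 (hbot ▸ iterResidual_mono s ?_)
  rw [MonoidHom.map_closure]
  refine Subgroup.closure_mono ?_
  rintro _ ⟨i, rfl⟩
  exact ⟨⟨c i, Subgroup.subset_closure ⟨i, rfl⟩⟩, hc i, rfl⟩

/-- If `ρ` together with each of its conjugates generates a `q`-group,
then the normal closure of `ρ` is a `q`-group. -/
lemma isPGroup_normalClosure {q : ℕ} (hq : q.Prime) {ρ : G}
    (h : ∀ g, IsPGroup q (Subgroup.closure {ρ, g * ρ * g⁻¹})) :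
    IsPGroup q (Subgroup.normalClosure {ρ}) := by
  rw [← closure_isConj]
  refine isPGroup_closure_of_pairs hq (fun a ha g => conj_mem_isConj ha g) fun a ha b hb => ?_
  obtain ⟨u, rfl⟩ := isConj_iff.1 ha
  obtain ⟨v, rfl⟩ := isConj_iff.1 hb
  have h1 := (h (u⁻¹ * v)).map (MulAut.conj u).toMonoidHom
  rw [MonoidHom.map_closure, Set.image_pair] at h1
  rw [show v * ρ * v⁻¹ = u * (u⁻¹ * v * ρ * (u⁻¹ * v)⁻¹) * u⁻¹ by group]
  exact h1

/-- If any seven conjugates of `x ≠ 1` generate a solvable group,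
then there is a nontrivial normal subgroup of prime power order. -/
lemma exists_normal_isPGroup {x : G} (hx : x ≠ 1)
    (h : ∀ c : Fin 7 → G, (∀ i, IsConj x (c i)) →
      Group.IsSolvable (Subgroup.closure (Set.range c))) :
    ∃ q, q.Prime ∧ ∃ N : Subgroup G, N.Normal ∧ N ≠ ⊥ ∧ IsPGroup q N := by
  obtain ⟨s, hs, q, hq, hall, ⟨c, hc⟩, hcne⟩ := exists_iterResidual_isPGroup
    (ι := {c : Fin 7 → G // ∀ i, IsConj x (c i)}) (fun c => Subgroup.closure (Set.range c.1))
    (fun c => h c.1 c.2) ⟨⟨fun _ => x, fun _ => IsConj.refl x⟩, fun hbot =>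
      hx (Subgroup.closure_eq_bot_iff.1 hbot (Set.mem_range_self 0))⟩
  obtain ⟨e, he, hene⟩ := exists_five_conj hs hc (h c hc) hcne
  have happ : ∀ y z : G, IsConj x y → IsConj x z → ∃ H : Subgroup G, (∀ i, e i ∈ H) ∧ y ∈ H ∧
      z ∈ H ∧ IsPGroup q (iterResidual s H) := by
    intro y z hy hz
    have hconj : ∀ i : Fin (5 + 2), IsConj x (Fin.append e ![y, z] i) := by
      refine Fin.addCases (fun i => ?_) fun i => ?_
      · rw [Fin.append_left]
        exact he i
      · rw [Fin.append_right]
        fin_cases i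
        exacts [hy, hz]
    have hmem : ∀ i : Fin (5 + 2), Fin.append e ![y, z] i ∈
        Subgroup.closure (Set.range (Fin.append e ![y, z])) :=
      fun i => Subgroup.subset_closure ⟨i, rfl⟩
    refine ⟨Subgroup.closure (Set.range (Fin.append e ![y, z])), fun i => ?_, ?_, ?_,
      hall ⟨Fin.append e ![y, z], hconj⟩⟩
    · simpa using hmem (Fin.castAdd 2 i)
    · have := hmem (Fin.natAdd 5 0)
      rwa [Fin.append_right] at this
    · have := hmem (Fin.natAdd 5 1)
      rwa [Fin.append_right] at this
  have hle : ∀ H : Subgroup G, (∀ i, e i ∈ H) →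
      iterResidual s (Subgroup.closure (Set.range e)) ≤ iterResidual s H := fun H hH =>
    iterResidual_mono s ((Subgroup.closure_le _).2 (Set.range_subset_iff.2 hH))
  obtain ⟨H₀, heH₀, -, -, hH₀⟩ := happ x x (IsConj.refl x) (IsConj.refl x)
  obtain ⟨y, ⟨i, rfl⟩, ρ, hρ, hρ1, hρy⟩ :=
    exists_pow_or_commutator_mem hq hs (Set.range e) (hH₀.to_le (hle H₀ heH₀)) hene
  obtain ⟨y, z, hy, hz, hρyz⟩ :
      ∃ y z, IsConj x y ∧ IsConj x z ∧ ρ ∈ Subgroup.closure {y, z} := by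
    rcases hρy with ⟨m, rfl⟩ | ⟨a, rfl⟩
    · exact ⟨e i, e i, he i, he i, Subgroup.pow_mem _ (Subgroup.subset_closure (by simp)) m⟩
    · exact ⟨a * e i * a⁻¹, e i, conj_mem_isConj (he i) a, he i,
        Subgroup.mul_mem _ (Subgroup.subset_closure (by simp))
          (Subgroup.inv_mem _ (Subgroup.subset_closure (by simp)))⟩
  refine ⟨q, hq, Subgroup.normalClosure {ρ}, Subgroup.normalClosure_normal, fun hbot => hρ1 ?_,
    isPGroup_normalClosure hq fun g => ?_⟩
  · have := Subgroup.subset_normalClosure (Set.mem_singleton ρ)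
    rwa [hbot] at this
  · obtain ⟨H, heH, hyH, hzH, hHq⟩ :=
      happ _ _ (conj_mem_isConj hy g) (conj_mem_isConj hz g)
    have hρH : ρ ∈ iterResidual s H := hle H heH hρ
    have hgρ : g * ρ * g⁻¹ ∈ H := by
      have hle' : Subgroup.closure {y, z} ≤ H.comap (MulAut.conj g).toMonoidHom := by
        refine (Subgroup.closure_le _).2 ?_
        rintro w (rfl | rfl)
        exacts [hyH, hzH]
      exact hle' hρyz
    have hQ : IsPGroup q (Subgroup.zpowers (g * ρ * g⁻¹)) := by
      have h1 : IsPGroup q (Subgroup.zpowers ρ) :=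
        hHq.to_le (Subgroup.zpowers_le.2 hρH)
      have h2 := h1.map (MulAut.conj g).toMonoidHom
      rwa [MonoidHom.map_zpowers] at h2
    have hnorm : Subgroup.zpowers (g * ρ * g⁻¹) ≤
        Subgroup.normalizer (iterResidual s H : Set G) :=
      Subgroup.zpowers_le.2 (normalizer_le_normalizer_iterResidual hs H
        (Subgroup.le_normalizer hgρ))
    refine (hHq.to_sup_of_normal_left' hQ hnorm).to_le ((Subgroup.closure_le _).2 ?_)
    rintro w (rfl | rfl)
    · exact Subgroup.mem_sup_left hρH
    · exact Subgroup.mem_sup_right (Subgroup.mem_zpowers _)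

omit [Finite G] in
lemma forall_isSolvable_quotient {x : G} (N : Subgroup G) [N.Normal] {n : ℕ}
    (h : ∀ c : Fin n → G, (∀ i, IsConj x (c i)) →
      Group.IsSolvable (Subgroup.closure (Set.range c)))
    (c : Fin n → G ⧸ N) (hc : ∀ i, IsConj (QuotientGroup.mk' N x) (c i)) :
    Group.IsSolvable (Subgroup.closure (Set.range c)) := by
  have hlift : ∀ i, ∃ d, IsConj x d ∧ QuotientGroup.mk' N d = c i := fun i => by
    obtain ⟨g, hg⟩ := isConj_iff.1 (hc i)
    obtain ⟨g, rfl⟩ := QuotientGroup.mk'_surjective N g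
    exact ⟨g * x * g⁻¹, isConj_iff.2 ⟨g, rfl⟩, by simpa using hg⟩
  choose d hd hdc using hlift
  have := h d hd
  have hmap : (Subgroup.closure (Set.range d)).map (QuotientGroup.mk' N) =
      Subgroup.closure (Set.range c) := by
    rw [MonoidHom.map_closure, ← Set.range_comp]
    exact congrArg (fun f => Subgroup.closure (Set.range f)) (funext hdc)
  rw [← hmap]
  exact Group.isSolvable_of_surjective (MonoidHom.subgroupMap_surjective _ _)

theorem isSolvable_normalClosure (x : G)
    (h : ∀ c : Fin 7 → G, (∀ i, IsConj x (c i)) →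
      Group.IsSolvable (Subgroup.closure (Set.range c))) :
    Group.IsSolvable (Subgroup.normalClosure {x}) := by
  obtain ⟨n, hn⟩ : ∃ n, n = Nat.card G := ⟨_, rfl⟩
  induction n using Nat.strong_induction_on generalizing G with
  | _ n ih =>
    by_cases hx : x = 1
    · have hbot : Subgroup.normalClosure {x} ≤ ⊥ :=
        Subgroup.normalClosure_le_normal (by simp [hx])
      exact isSolvable_of_le hbot inferInstance
    obtain ⟨q, hq, N, hN, hNbot, hNq⟩ := exists_normal_isPGroup hx h
    have := Fact.mk hq
    have := hNq.isNilpotent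
    have hNsol : Group.IsSolvable N := inferInstance
    refine isSolvable_of_map_mk' hNsol ?_
    rw [Subgroup.map_normalClosure _ _ (QuotientGroup.mk'_surjective N), Set.image_singleton]
    refine ih _ ?_ _ (forall_isSolvable_quotient N h) rfl
    rw [hn]
    change N.index < _
    rw [← N.card_mul_index]
    exact lt_mul_of_one_lt_left (Nat.pos_of_ne_zero N.index_ne_zero_of_finite)
      ((Subgroup.one_lt_card_iff_ne_bot N).2 hNbot)

end Main

end SolvableRadical

theorem solvable_radical_seven_conjugates
    (G : Type*) [Group G] [Finite G] (x : G) :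
    IsSolvable ↥(Subgroup.normalClosure ({x} : Set G)) ↔
      ∀ g₁ g₂ g₃ g₄ g₅ g₆ g₇ : G,
        IsSolvable ↥(Subgroup.closure
          ({g₁⁻¹ * x * g₁, g₂⁻¹ * x * g₂, g₃⁻¹ * x * g₃, g₄⁻¹ * x * g₄,
            g₅⁻¹ * x * g₅, g₆⁻¹ * x * g₆, g₇⁻¹ * x * g₇} : Set G)) := by
  constructor
  · intro h g₁ g₂ g₃ g₄ g₅ g₆ g₇
    refine SolvableRadical.isSolvable_of_le ((Subgroup.closure_le _).2 ?_) h
    have hmem : ∀ g, g⁻¹ * x * g ∈ Subgroup.normalClosure ({x} : Set G) := fun g => by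
      simpa using Subgroup.normalClosure_normal.conj_mem x
        (Subgroup.subset_normalClosure (Set.mem_singleton x)) g⁻¹
    rintro _ (rfl | rfl | rfl | rfl | rfl | rfl | rfl) <;> exact hmem _
  · intro h
    refine SolvableRadical.isSolvable_normalClosure x fun c hc => ?_
    have hconj : ∀ i, ∃ g, g⁻¹ * x * g = c i := fun i => by
      obtain ⟨g, hg⟩ := isConj_iff.1 (hc i)
      exact ⟨g⁻¹, by simpa using hg⟩
    choose g hg using hconj
    refine SolvableRadical.isSolvable_of_le (Subgroup.closure_mono ?_)
      (h (g 0) (g 1) (g 2) (g 3) (g 4) (g 5) (g 6))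
    rintro _ ⟨i, rfl⟩
    rw [← hg i]
    fin_cases i <;> simp
end

section
/- Let n ≥ 3 and let x ∈ SL(n, 𝔽₃) be a transvection, i.e. x is the transvection matrix I + c·E_{ij} for some indices i ≠ j and some nonzero scalar c ∈ 𝔽₃ (such a matrix has determinant 1). Then for every g ∈ SL(n, 𝔽₃) the subgroup ⟨x, g⁻¹xg⟩ generated by x and its conjugate is solvable, while the normal closure ⟨x^{SL(n,𝔽₃)}⟩ of x is not solvable. -/
open scoped commutatorElement

/-- A group generated by two elements `x`, `y` that normalize a solvable subgroup containing their
commutator is solvable. -/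
theorem isSolvable_closure_pair_of_commutator_mem {G : Type*} [Group G] {x y : G}
    (N : Subgroup G) [Group.IsSolvable N] (hxN : x ∈ Subgroup.normalizer (N : Set G))
    (hyN : y ∈ Subgroup.normalizer (N : Set G)) (hxy : ⁅x, y⁆ ∈ N) :
    Group.IsSolvable (Subgroup.closure ({x, y} : Set G)) := by
  set H := Subgroup.closure ({x, y} : Set G) with hH
  have hHN : H ≤ Subgroup.normalizer (N : Set G) := by
    rw [hH, Subgroup.closure_le]
    rintro t (rfl | rfl) <;> assumption
  have hxH : x ∈ H := Subgroup.subset_closure (by simp)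
  have hyH : y ∈ H := Subgroup.subset_closure (by simp)
  set K := Subgroup.normalizer (N : Set G)
  let q : H →* K ⧸ N.subgroupOf K :=
    (QuotientGroup.mk' (N.subgroupOf K)).comp (Subgroup.inclusion hHN)
  have hq : Commute (q ⟨x, hxH⟩) (q ⟨y, hyH⟩) := by
    rw [← commutatorElement_eq_one_iff_commute, ← map_commutatorElement]
    exact (QuotientGroup.eq_one_iff _).2 hxy
  have hcomm : ∀ s t : H, Commute (q s) (q t) := by
    have hgen : ∀ (r : H), Commute (q r) (q ⟨x, hxH⟩) → Commute (q r) (q ⟨y, hyH⟩) →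
        ∀ t : H, Commute (q r) (q t) := by
      rintro r hr₁ hr₂ ⟨t, ht⟩
      induction ht using Subgroup.closure_induction with
      | mem t ht =>
        rcases ht with rfl | rfl
        · exact hr₁
        · exact hr₂
      | one => exact (map_one q).symm ▸ Commute.one_right _
      | mul a b ha hb iha ihb =>
        have : q ⟨a * b, mul_mem ha hb⟩ = q ⟨a, ha⟩ * q ⟨b, hb⟩ := by rw [← map_mul]; rfl
        exact this ▸ iha.mul_right ihb
      | inv a ha iha =>
        have : q ⟨a⁻¹, inv_mem ha⟩ = (q ⟨a, ha⟩)⁻¹ := by rw [← map_inv]; rfl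
        exact this ▸ iha.inv_right
    intro s t
    exact hgen s (hgen _ (Commute.refl _) hq s).symm (hgen _ hq.symm (Commute.refl _) s).symm t
  have : Group.IsSolvable q.range := by
    refine Group.isSolvable_of_comm ?_
    rintro ⟨_, s, rfl⟩ ⟨_, t, rfl⟩
    exact Subtype.ext (hcomm s t)
  have : Group.IsSolvable (N ⊓ H : Subgroup G) :=
    Group.isSolvable_of_isSolvable_injective (Subgroup.inclusion_injective (inf_le_left : N ⊓ H ≤ N))
  refine Group.isSolvable_of_ker_le_range (Subgroup.inclusion (inf_le_right : N ⊓ H ≤ H))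
    q.rangeRestrict ?_
  intro t ht
  have ht' : q t = 1 := congrArg Subtype.val ht
  have htN : (t : G) ∈ N := by
    simpa [Subgroup.mem_subgroupOf] using (QuotientGroup.eq_one_iff _).1 ht'
  exact ⟨⟨t, htN, t.2⟩, rfl⟩

theorem isSolvable_closure_pair_of_commute_commutator {G : Type*} [Group G] {x y : G}
    (hx : Commute x ⁅x, y⁆) (hy : Commute y ⁅x, y⁆) :
    Group.IsSolvable (Subgroup.closure ({x, y} : Set G)) := by
  have hnorm : ∀ t : G, Commute t ⁅x, y⁆ →
      t ∈ Subgroup.normalizer (Subgroup.zpowers ⁅x, y⁆ : Set G) := by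
    intro t ht
    rw [Subgroup.mem_normalizer_iff]
    have key : ∀ s : G, Commute s ⁅x, y⁆ → ∀ h ∈ Subgroup.zpowers ⁅x, y⁆,
        s * h * s⁻¹ ∈ Subgroup.zpowers ⁅x, y⁆ := by
      rintro s hs _ ⟨k, rfl⟩
      have : s * ⁅x, y⁆ ^ k * s⁻¹ = ⁅x, y⁆ ^ k := by
        rw [(hs.zpow_right k).eq, mul_inv_cancel_right]
      simp only [this]
      exact ⟨k, rfl⟩
    refine fun h => ⟨key t ht h, fun hh => ?_⟩
    simpa [mul_assoc] using key t⁻¹ ht.inv_left _ hh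
  have : Group.IsSolvable (Subgroup.zpowers ⁅x, y⁆) := Group.isSolvable_of_comm (by
    rintro ⟨_, k, rfl⟩ ⟨_, l, rfl⟩
    exact Subtype.ext (zpow_mul_comm _ _ _))
  exact isSolvable_closure_pair_of_commutator_mem _ (hnorm x hx) (hnorm y hy)
    (Subgroup.mem_zpowers _)

theorem Subgroup.mem_normalizer_closure_of_conj_mem {G : Type*} [Group G] {S : Set G} {t : G}
    (h : ∀ s ∈ S, t * s * t⁻¹ ∈ closure S) (h' : ∀ s ∈ S, t⁻¹ * s * t ∈ closure S) :
    t ∈ normalizer (closure S : Set G) := by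
  have key : ∀ r : G, (∀ s ∈ S, r * s * r⁻¹ ∈ closure S) → ∀ s ∈ closure S,
      r * s * r⁻¹ ∈ closure S := by
    intro r hr
    have : closure S ≤ (closure S).comap (MulAut.conj r).toMonoidHom :=
      (closure_le _).2 fun s hs => by simpa using hr s hs
    exact fun s hs => by simpa using this hs
  rw [mem_normalizer_iff]
  refine fun s => ⟨key t h s, fun hs => ?_⟩
  simpa [mul_assoc] using key t⁻¹ (by simpa using h') _ hs

/-- The quotient of the braid group on three strands by the cubes of the standard generators, which
is isomorphic to `SL(2, 3)`, is solvable. -/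
theorem isSolvable_closure_pair_of_braid {G : Type*} [Group G] {x y : G}
    (hx : x ^ 3 = 1) (hy : y ^ 3 = 1) (hxy : x * y * x = y * x * y) :
    Group.IsSolvable (Subgroup.closure ({x, y} : Set G)) := by
  have hx2 : x * x = x⁻¹ := eq_inv_of_mul_eq_one_left (by rw [← hx, pow_three'])
  have hy2 : y⁻¹ * y⁻¹ = y := by
    rw [← mul_inv_rev, inv_eq_iff_mul_eq_one, ← hy, pow_three', mul_assoc]
  set a := x * y⁻¹ with ha
  set b := y⁻¹ * x with hb
  set N := Subgroup.closure ({a, b} : Set G)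
  have haN : a ∈ N := Subgroup.subset_closure (by simp)
  have hbN : b ∈ N := Subgroup.subset_closure (by simp)
  have hab : a * b = x * y * x := by
    calc a * b = x * (y⁻¹ * y⁻¹) * x := by simp only [ha, hb]; group
      _ = x * y * x := by rw [hy2]
  have hsq : ⁅a, b⁆ = (x * y * x) * (x * y * x) := by
    calc ⁅a, b⁆ = (a * b) * (y * (x * x)⁻¹ * y) := by
          rw [commutatorElement_def]; simp only [ha, hb]; group
      _ = (x * y * x) * (y * x * y) := by rw [hab, hx2, inv_inv]
      _ = _ := by rw [hxy]
  have hsx : x * y * x * x = y * (x * y * x) := by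
    nth_rewrite 1 [hxy]; simp only [mul_assoc]
  have hsy : x * y * x * y = x * (x * y * x) := by
    nth_rewrite 2 [hxy]; simp only [mul_assoc]
  have hcx : Commute x ⁅a, b⁆ := by
    rw [hsq]
    refine Eq.symm ?_
    rw [mul_assoc, hsx, ← mul_assoc, hsy, mul_assoc]
  have hcy : Commute y ⁅a, b⁆ := by
    rw [hsq]
    refine Eq.symm ?_
    rw [mul_assoc, hsy, ← mul_assoc, hsx, mul_assoc]
  have : Group.IsSolvable N := isSolvable_closure_pair_of_commute_commutator
    (hcx.mul_left hcy.inv_left) (hcy.inv_left.mul_left hcx)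
  have hxa : x * a * x⁻¹ = (a * b)⁻¹ := by
    calc x * a * x⁻¹ = (x * x) * y⁻¹ * x⁻¹ := by simp only [ha]; group
      _ = (a * b)⁻¹ := by rw [hx2, hab]; group
  have hxb : x⁻¹ * b * x = (a * b)⁻¹ := by
    calc x⁻¹ * b * x = x⁻¹ * y⁻¹ * (x * x) := by simp only [hb]; group
      _ = (a * b)⁻¹ := by rw [hx2, hab]; group
  have hya : y * a * y⁻¹ = a * b := by
    calc y * a * y⁻¹ = y * x * (y⁻¹ * y⁻¹) := by simp only [ha]; group
      _ = a * b := by rw [hy2, hab, hxy]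
  have hyb : y⁻¹ * b * y = a * b := by
    calc y⁻¹ * b * y = (y⁻¹ * y⁻¹) * x * y := by simp only [hb]; group
      _ = a * b := by rw [hy2, hab, hxy]
  refine isSolvable_closure_pair_of_commutator_mem N ?_ ?_ ?_
  · refine Subgroup.mem_normalizer_closure_of_conj_mem ?_ ?_
    · rintro s (rfl | rfl)
      · exact hxa ▸ inv_mem (mul_mem haN hbN)
      · have : x * b * x⁻¹ = a := by simp only [ha, hb]; group
        rwa [this]
    · rintro s (rfl | rfl)
      · have : x⁻¹ * a * x = b := by simp only [ha, hb]; group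
        rwa [this]
      · exact hxb ▸ inv_mem (mul_mem haN hbN)
  · refine Subgroup.mem_normalizer_closure_of_conj_mem ?_ ?_
    · rintro s (rfl | rfl)
      · exact hya ▸ mul_mem haN hbN
      · have : y * b * y⁻¹ = a := by simp only [ha, hb]; group
        rwa [this]
    · rintro s (rfl | rfl)
      · have : y⁻¹ * a * y = b := by simp only [ha, hb]; group
        rwa [this]
      · exact hyb ▸ mul_mem haN hbN
  · have : ⁅x, y⁆ = b := by
      rw [commutatorElement_def, mul_inv_eq_iff_eq_mul, mul_inv_eq_iff_eq_mul, hb]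
      calc x * y = y⁻¹ * (y * x * y) := by group
        _ = y⁻¹ * x * y * x := by rw [← hxy]; group
    exact this ▸ hbN

section Ring

variable {G R : Type*} [Group G] [Ring R] {f : G →* R} {x y : G} {A B : R}

theorem MonoidHom.map_inv_eq_one_sub (hx : f x = 1 + A) (hA : A * A = 0) :
    f x⁻¹ = 1 - A := by
  have h₁ : f x⁻¹ * (1 + A) = 1 := by rw [← hx, ← map_mul, inv_mul_cancel, map_one]
  have h₂ : (1 + A) * (1 - A) = 1 := by
    calc (1 + A) * (1 - A) = 1 - A * A := by noncomm_ring
      _ = 1 := by rw [hA, sub_zero]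
  exact left_inv_eq_right_inv h₁ h₂

theorem isSolvable_closure_pair_of_mul_mul_eq_zero (hf : Function.Injective f)
    (hx : f x = 1 + A) (hy : f y = 1 + B) (hA : A * A = 0) (hB : B * B = 0)
    (hAB : A * B * A = 0) (hBA : B * A * B = 0) :
    Group.IsSolvable (Subgroup.closure ({x, y} : Set G)) := by
  have hc : f ⁅x, y⁆ = 1 + (A * B - B * A) := by
    rw [commutatorElement_def, map_mul, map_mul, map_mul, hx, hy, f.map_inv_eq_one_sub hx hA,
      f.map_inv_eq_one_sub hy hB]
    have hABB : A * (B * B) = 0 := by rw [hB, mul_zero]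
    simp only [mul_assoc] at hAB hBA
    simp [mul_add, add_mul, mul_sub, sub_mul, mul_assoc, hA, hB, hAB, hBA]
    abel
  simp only [mul_assoc] at hAB hBA
  have hAAB : A * (A * B) = 0 := by rw [← mul_assoc, hA, zero_mul]
  have hBBA : B * (B * A) = 0 := by rw [← mul_assoc, hB, zero_mul]
  refine isSolvable_closure_pair_of_commute_commutator (hf ?_) (hf ?_)
  · rw [map_mul, map_mul, hc, hx]
    simp [mul_add, add_mul, mul_sub, sub_mul, mul_assoc, hA, hAB, hAAB]
    abel
  · rw [map_mul, map_mul, hc, hy]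
    simp [mul_add, add_mul, mul_sub, sub_mul, mul_assoc, hB, hBA, hBBA]
    abel

theorem isSolvable_closure_pair_of_mul_mul_eq_neg [CharP R 3] (hf : Function.Injective f)
    (hx : f x = 1 + A) (hy : f y = 1 + B) (hA : A * A = 0) (hB : B * B = 0)
    (hAB : A * B * A = -A) (hBA : B * A * B = -B) :
    Group.IsSolvable (Subgroup.closure ({x, y} : Set G)) := by
  have h3 : (3 : R) = 0 := by exact_mod_cast CharP.cast_eq_zero R 3
  have cube : ∀ {t : G} {C : R}, f t = 1 + C → C * C = 0 → t ^ 3 = 1 := by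
    intro t C ht hC
    apply hf
    rw [map_pow, map_one, ht, pow_succ, pow_two]
    calc (1 + C) * (1 + C) * (1 + C) = 1 + 3 * C + 3 * (C * C) + C * C * C := by noncomm_ring
      _ = 1 := by simp [hC, h3]
  refine isSolvable_closure_pair_of_braid (cube hx hA) (cube hy hB) (hf ?_)
  simp only [map_mul, hx, hy]
  calc (1 + A) * (1 + B) * (1 + A)
      = 1 + A + A + B + A * B + B * A + A * A + A * B * A := by noncomm_ring
    _ = 1 + B + B + A + B * A + A * B + B * B + B * A * B := by rw [hA, hB, hAB, hBA]; abel
    _ = (1 + B) * (1 + A) * (1 + B) := by noncomm_ring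

end Ring

/-- Two elements `1 + A` and `1 + B` with `A² = B² = 0` such that `ABA` and `BAB` are the same
multiple of `A` and `B` generate a solvable group in characteristic three. -/
theorem isSolvable_closure_pair_of_mul_mul_eq_smul {G R : Type*} [Group G] [Ring R]
    [Algebra (ZMod 3) R] [CharP R 3] {f : G →* R} (hf : Function.Injective f) {x y : G} {A B : R}
    (hx : f x = 1 + A) (hy : f y = 1 + B) (hA : A * A = 0) (hB : B * B = 0) (s : ZMod 3)
    (hAB : A * B * A = s • A) (hBA : B * A * B = s • B) :
    Group.IsSolvable (Subgroup.closure ({x, y} : Set G)) := by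
  have hs : ∀ s : ZMod 3, s = 0 ∨ s = -1 ∨ s = 1 := by decide
  rcases hs s with rfl | rfl | rfl
  · exact isSolvable_closure_pair_of_mul_mul_eq_zero hf hx hy hA hB (by simpa using hAB)
      (by simpa using hBA)
  · exact isSolvable_closure_pair_of_mul_mul_eq_neg hf hx hy hA hB (by simpa using hAB)
      (by simpa using hBA)
  · have hy' : f y⁻¹ = 1 + -B := by rw [f.map_inv_eq_one_sub hy hB, sub_eq_add_neg]
    have := isSolvable_closure_pair_of_mul_mul_eq_neg hf hx hy' hA (by simpa using hB)
      (by simpa using hAB) (by simpa using hBA)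
    have hle : Subgroup.closure ({x, y} : Set G) ≤ Subgroup.closure {x, y⁻¹} := by
      rw [Subgroup.closure_le]
      rintro t (rfl | rfl)
      · exact Subgroup.subset_closure (by simp)
      · exact inv_mem_iff.1 (Subgroup.subset_closure (by simp))
    exact Group.isSolvable_of_isSolvable_injective (Subgroup.inclusion_injective hle)

namespace Matrix.SpecialLinearGroup

variable {ι : Type*} [Fintype ι] [DecidableEq ι]

theorem isSolvable_closure_transvection_conj {i j : ι} (hij : i ≠ j) (c : ZMod 3)
    (g : SpecialLinearGroup ι (ZMod 3)) :
    Group.IsSolvable (Subgroup.closure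
      ({transvection hij c, g⁻¹ * transvection hij c * g} :
        Set (SpecialLinearGroup ι (ZMod 3)))) := by
  have : Nonempty ι := ⟨i⟩
  set A : Matrix ι ι (ZMod 3) := single i j c with hAdef
  have hA : A * A = 0 := single_mul_single_of_ne _ _ _ _ hij.symm _
  have hAMA : ∀ M : Matrix ι ι (ZMod 3), A * M * A = trace (A * M) • A := by
    intro M
    rw [hAdef, trace_single_mul, single_mul_mul_single]
    simp
  set P := coeMonoidHom g with hP
  set Q := coeMonoidHom g⁻¹ with hQ
  have hPQ : P * Q = 1 := by rw [hP, hQ, ← map_mul, mul_inv_cancel, map_one]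
  have hQP : Q * P = 1 := by rw [hP, hQ, ← map_mul, inv_mul_cancel, map_one]
  have hx : coeMonoidHom (transvection hij c) = 1 + A := rfl
  have hy : coeMonoidHom (g⁻¹ * transvection hij c * g) = 1 + Q * A * P := by
    rw [map_mul, map_mul, hx, ← hP, ← hQ, mul_add, add_mul, mul_one, hQP]
  have htr : trace (A * (P * A * Q)) = trace (A * (Q * A * P)) := by
    rw [trace_mul_comm]
    simp only [mul_assoc]
    rw [trace_mul_comm]
    simp only [mul_assoc]
  refine isSolvable_closure_pair_of_mul_mul_eq_smul coeMonoidHom_injective hx hy hA ?_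
    (trace (A * (Q * A * P))) (hAMA _) ?_
  · calc Q * A * P * (Q * A * P) = Q * A * (P * Q) * A * P := by simp only [mul_assoc]
      _ = Q * (A * A) * P := by rw [hPQ]; simp only [mul_assoc, one_mul]
      _ = 0 := by rw [hA, mul_zero, zero_mul]
  · calc Q * A * P * A * (Q * A * P) = Q * (A * (P * A * Q) * A) * P := by
          simp only [mul_assoc]
      _ = _ := by rw [hAMA, htr, mul_smul_comm, smul_mul_assoc]

section Field

variable {F : Type*} [Field F]

theorem commutator_transvection {i j k : ι} (hij : i ≠ j) (hjk : j ≠ k) (hik : i ≠ k) (a b : F) :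
    ⁅transvection hij a, transvection hjk b⁆ = transvection hik (a * b) := by
  rw [commutatorElement_def, mul_inv_eq_iff_eq_mul, mul_inv_eq_iff_eq_mul]
  apply coeMonoidHom_injective
  simp only [map_mul, coeMonoidHom_apply, transvection_coe]
  simp [mul_add, add_mul, hjk.symm, hik.symm]
  abel

theorem transvection_mem_of_ne_right {N : Subgroup (SpecialLinearGroup ι F)} [N.Normal]
    {i j k : ι} {hij : i ≠ j} {c : F} (hc : c ≠ 0) (h : transvection hij c ∈ N) (hjk : j ≠ k)
    (hik : i ≠ k) (d : F) : transvection hik d ∈ N := by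
  rw [← mul_inv_cancel_left₀ hc d, ← commutator_transvection hij hjk]
  exact Subgroup.commutator_le_left N ⊤
    (Subgroup.commutator_mem_commutator h (Subgroup.mem_top _))

theorem transvection_mem_of_ne_left {N : Subgroup (SpecialLinearGroup ι F)} [N.Normal]
    {i j k : ι} {hij : i ≠ j} {c : F} (hc : c ≠ 0) (h : transvection hij c ∈ N) (hki : k ≠ i)
    (hkj : k ≠ j) (d : F) : transvection hkj d ∈ N := by
  rw [← div_mul_cancel₀ d hc, ← commutator_transvection hki hij]
  exact Subgroup.commutator_le_right ⊤ N
    (Subgroup.commutator_mem_commutator (Subgroup.mem_top _) h)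

/-- A normal subgroup of `SL(ι, F)` with `3 ≤ |ι|` containing a nontrivial transvection contains all
transvections. -/
theorem transvection_mem_of_transvection_mem (hι : 3 ≤ Fintype.card ι)
    {N : Subgroup (SpecialLinearGroup ι F)} [N.Normal] {i j : ι} {hij : i ≠ j} {c : F}
    (hc : c ≠ 0) (h : transvection hij c ∈ N) {p q : ι} (hpq : p ≠ q) (d : F) :
    transvection hpq d ∈ N := by
  have third : ∀ a b : ι, ∃ k, k ≠ a ∧ k ≠ b := fun a b => by
    obtain ⟨k, hk⟩ := Finset.exists_mem_notMem_of_card_lt_card (s := {a, b}) (t := Finset.univ)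
      (lt_of_le_of_lt Finset.card_le_two hι)
    exact ⟨k, by simpa using hk⟩
  have row : ∀ {a b b' : ι} {hab : a ≠ b} (hab' : a ≠ b'), transvection hab (1 : F) ∈ N →
      ∀ e : F, transvection hab' e ∈ N := by
    intro a b b' hab hab' hN e
    by_cases hb : b = b'
    · subst hb
      obtain ⟨k, hka, hkb⟩ := third a b
      exact transvection_mem_of_ne_right one_ne_zero
        (transvection_mem_of_ne_right one_ne_zero hN hkb.symm hka.symm 1) hkb hab' e
    · exact transvection_mem_of_ne_right one_ne_zero hN hb hab' e
  obtain ⟨k, hki, hkj⟩ := third i j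
  have hik := transvection_mem_of_ne_right hc h hkj.symm hki.symm (1 : F)
  by_cases hip : i = p
  · subst hip
    exact row hpq hik d
  · obtain ⟨l, hli, hlp⟩ := third i p
    exact row hpq (transvection_mem_of_ne_left one_ne_zero (row hli.symm hik 1) (Ne.symm hip)
      hlp.symm 1) d

theorem not_isSolvable_of_forall_transvection_mem (hι : 3 ≤ Fintype.card ι)
    {N : Subgroup (SpecialLinearGroup ι F)}
    (hN : ∀ {i j : ι} (hij : i ≠ j) (c : F), transvection hij c ∈ N) : ¬ Group.IsSolvable N := by
  intro hsol
  set S : Set (SpecialLinearGroup ι F) :=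
    {t | ∃ (i j : ι) (hij : i ≠ j) (c : F), t = transvection hij c}
  set H := Subgroup.closure S with hH
  have hHN : H ≤ N := by
    rw [hH, Subgroup.closure_le]
    rintro _ ⟨i, j, hij, c, rfl⟩
    exact hN hij c
  have hmem : ∀ {i j : ι} (hij : i ≠ j) (c : F), transvection hij c ∈ H :=
    fun hij c => Subgroup.subset_closure ⟨_, _, hij, c, rfl⟩
  have hperf : H ≤ ⁅H, H⁆ := by
    conv_lhs => rw [hH]
    rw [Subgroup.closure_le]
    rintro _ ⟨i, j, hij, c, rfl⟩
    obtain ⟨k, hk⟩ := Finset.exists_mem_notMem_of_card_lt_card (s := {i, j}) (t := Finset.univ)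
      (lt_of_le_of_lt Finset.card_le_two hι)
    have hk' : k ≠ i ∧ k ≠ j := by simpa using hk
    rw [← mul_one c, ← commutator_transvection hk'.1.symm hk'.2]
    exact Subgroup.commutator_mem_commutator (hmem _ _) (hmem _ _)
  have : Group.IsSolvable H :=
    Group.isSolvable_of_isSolvable_injective (Subgroup.inclusion_injective hHN)
  have : Nontrivial H := by
    obtain ⟨i, j, hij⟩ := Fintype.exists_pair_of_one_lt_card (by omega : 1 < Fintype.card ι)
    refine (Subgroup.nontrivial_iff_exists_ne_one H).2 ⟨_, hmem hij 1, fun h => ?_⟩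
    exact one_ne_zero ((transvection_mem_center_iff hij (1 : F)).1 (h ▸ one_mem _))
  refine (Group.IsSolvable.commutator_lt_top_of_nontrivial H).not_ge ?_
  rw [← Subgroup.map_subtype_le_map_subtype, Subgroup.map_subtype_commutator,
    ← MonoidHom.range_eq_map, Subgroup.range_subtype]
  exact hperf

end Field

end Matrix.SpecialLinearGroup


theorem transvection_counterexample
    (n : ℕ) (hn : 3 ≤ n) (i j : Fin n) (hij : i ≠ j)
    (c : ZMod 3) (hc : c ≠ 0)
    (x : Matrix.SpecialLinearGroup (Fin n) (ZMod 3))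
    (hx : (x : Matrix (Fin n) (Fin n) (ZMod 3)) = Matrix.transvection i j c) :
    (∀ g : Matrix.SpecialLinearGroup (Fin n) (ZMod 3),
        IsSolvable ↥(Subgroup.closure
          ({x, g⁻¹ * x * g} : Set (Matrix.SpecialLinearGroup (Fin n) (ZMod 3))))) ∧
      ¬ IsSolvable ↥(Subgroup.normalClosure
          ({x} : Set (Matrix.SpecialLinearGroup (Fin n) (ZMod 3)))) := by
  obtain rfl : x = Matrix.SpecialLinearGroup.transvection hij c := Subtype.ext hx
  refine ⟨Matrix.SpecialLinearGroup.isSolvable_closure_transvection_conj hij c, ?_⟩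
  have hι : 3 ≤ Fintype.card (Fin n) := by rwa [Fintype.card_fin]
  exact Matrix.SpecialLinearGroup.not_isSolvable_of_forall_transvection_mem hι
    (Matrix.SpecialLinearGroup.transvection_mem_of_transvection_mem hι hc
      (Subgroup.subset_normalClosure (Set.mem_singleton _)))
end

section
/- Let G be a finite group and x ∈ G. If the sum, over all maximal subgroups M of G that contain x, of the number of conjugates of x lying in M is strictly less than the total number of conjugates of x, then there exists g ∈ G such that the subgroup generated by x and g⁻¹xg equals G. -/
theorem generation_from_counting
    (G : Type*) [Group G] [Finite G] (x : G)
    (h : ∑ᶠ M ∈ {M : Subgroup G | IsCoatom M ∧ x ∈ M},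
        Nat.card ({y : G | ∃ g : G, y = g⁻¹ * x * g} ∩ (M : Set G) : Set G)
      < Nat.card {y : G | ∃ g : G, y = g⁻¹ * x * g}) :
    ∃ g : G, Subgroup.closure ({x, g⁻¹ * x * g} : Set G) = ⊤ := by
  classical
  by_contra! hgen
  set C : Set G := {y : G | ∃ g : G, y = g⁻¹ * x * g}
  have hfin : {M : Subgroup G | IsCoatom M ∧ x ∈ M}.Finite := Set.toFinite _
  rw [finsum_mem_eq_finite_toFinset_sum _ hfin] at h
  have hcover : C ⊆ ⋃ M ∈ hfin.toFinset, C ∩ (M : Set G) := by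
    rintro _ ⟨g, rfl⟩
    obtain ⟨M, hM, hle⟩ := (eq_top_or_exists_le_coatom _).resolve_left (hgen g)
    rw [Subgroup.closure_le, Set.insert_subset_iff, Set.singleton_subset_iff] at hle
    simp only [Set.mem_iUnion]
    exact ⟨M, by simpa using ⟨hM, hle.1⟩, ⟨g, rfl⟩, hle.2⟩
  simp only [Nat.card_coe_set_eq] at h
  exact h.not_ge <| (Set.ncard_le_ncard hcover (Set.toFinite _)).trans
    (Finset.set_ncard_biUnion_le _ _)
end

section
/- Let G be a finite almost simple group with socle S, i.e. S is a normal subgroup of G that is a nonabelian simple group with trivial centralizer in G. Let x ∈ G with x ≠ 1, and let M₁ and M₂ be subgroups of G. If every conjugate of x lies in M₁ ∪ M₂, then S ≤ M₁ or S ≤ M₂. -/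
namespace Subgroup

variable {G : Type*} [Group G]

/-- A nontrivial subgroup normalized by a normal simple subgroup with trivial centralizer
contains it. -/
theorem le_of_isSimpleGroup_of_le_normalizer {S H : Subgroup G} [S.Normal] [IsSimpleGroup S]
    (hS : centralizer (S : Set G) = ⊥) (hH : H ≠ ⊥) (hSH : S ≤ normalizer (H : Set G)) :
    S ≤ H := by
  have hnormal : (H.subgroupOf S).Normal := normal_subgroupOf_of_le_normalizer hSH
  refine hnormal.eq_bot_or_eq_top.elim (fun hbot ↦ absurd ?_ hH) subgroupOf_eq_top.mp
  rw [eq_bot_iff, ← hS]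
  refine fun a ha ↦ mem_centralizer_iff.mpr fun s hs ↦ ?_
  have hmemH : s * a * s⁻¹ * a⁻¹ ∈ H :=
    H.mul_mem ((mem_normalizer_iff.mp (hSH hs) a).mp ha) (H.inv_mem ha)
  have hmemS : s * a * s⁻¹ * a⁻¹ ∈ S := by
    simpa only [mul_assoc] using
      S.mul_mem hs (Normal.conj_mem inferInstance _ (S.inv_mem hs) a)
  have hone := disjoint_def.mp (subgroupOf_eq_bot.mp hbot) hmemH hmemS
  rwa [mul_inv_eq_one, mul_inv_eq_iff_eq_mul] at hone

/-- The normal closure of an element normalizes the subgroup generated by the part of its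
conjugacy class lying outside a given subgroup. -/
theorem normalClosure_le_normalizer_closure_sdiff (x : G) (M : Subgroup G) :
    normalClosure {x} ≤ normalizer (closure (conjugatesOf x \ M) : Set G) := by
  have hconj : ∀ c ∈ M, ∀ y ∈ conjugatesOf x \ (M : Set G),
      c * y * c⁻¹ ∈ conjugatesOf x \ (M : Set G) := fun c hc y hy ↦
    ⟨IsConj.trans hy.1 (isConj_iff.mpr ⟨c, rfl⟩), fun hmem ↦ hy.2 <| by
      simpa [mul_assoc] using M.mul_mem (M.mul_mem (M.inv_mem hc) hmem) hc⟩
  have hclosure : ∀ c ∈ M, ∀ y ∈ closure (conjugatesOf x \ (M : Set G)),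
      c * y * c⁻¹ ∈ closure (conjugatesOf x \ (M : Set G)) := fun c hc y hy ↦ by
    have hle : closure (conjugatesOf x \ (M : Set G)) ≤
        (closure (conjugatesOf x \ (M : Set G))).comap (MulAut.conj c).toMonoidHom :=
      (closure_le _).mpr fun z hz ↦ subset_closure (hconj c hc z hz)
    exact hle hy
  refine (closure_le _).mpr fun c hc ↦ ?_
  rw [Group.conjugatesOfSet, Set.biUnion_singleton] at hc
  by_cases hcM : c ∈ M
  · refine mem_normalizer_iff.mpr fun y ↦ ⟨hclosure c hcM y, fun hy ↦ ?_⟩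
    simpa [mul_assoc] using hclosure c⁻¹ (M.inv_mem hcM) _ hy
  · exact le_normalizer (subset_closure ⟨hc, hcM⟩)

end Subgroup

open Subgroup in
theorem conj_class_in_two_subgroups
    (G : Type*) [Group G] [Finite G] (S : Subgroup G)
    (hnorm : S.Normal) (hsimple : IsSimpleGroup S)
    (hnonab : ¬ ∀ a b : S, a * b = b * a)
    (hcent : Subgroup.centralizer (S : Set G) = ⊥)
    (x : G) (hx : x ≠ 1) (M₁ M₂ : Subgroup G)
    (h : {y : G | ∃ g : G, y = g⁻¹ * x * g} ⊆ (M₁ : Set G) ∪ (M₂ : Set G)) :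
    S ≤ M₁ ∨ S ≤ M₂ := by
  have hcover : conjugatesOf x ⊆ (M₁ : Set G) ∪ M₂ := fun y hy ↦ by
    obtain ⟨c, rfl⟩ := isConj_iff.mp hy
    exact h ⟨c⁻¹, by simp⟩
  have hS : S ≤ normalClosure {x} :=
    le_of_isSimpleGroup_of_le_normalizer hcent (by simpa using hx)
      (by simp [normalizer_eq_top])
  by_cases hM₂ : conjugatesOf x ⊆ (M₂ : Set G)
  · refine .inr (hS.trans ((closure_le _).mpr ?_))
    rwa [Group.conjugatesOfSet, Set.biUnion_singleton]
  · obtain ⟨a, ha, haM₂⟩ := Set.not_subset.mp hM₂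
    have hne : closure (conjugatesOf x \ (M₂ : Set G)) ≠ ⊥ := fun hbot ↦
      haM₂ <| by
        have ha1 : a = 1 := mem_bot.mp (hbot ▸ subset_closure ⟨ha, haM₂⟩)
        exact ha1 ▸ M₂.one_mem
    refine .inl ((le_of_isSimpleGroup_of_le_normalizer hcent hne
      (hS.trans (normalClosure_le_normalizer_closure_sdiff x M₂))).trans
        ((closure_le _).mpr fun y hy ↦ (hcover hy.1).resolve_right hy.2))
end

section
/- Let n ≥ 5 and let x be an element of the alternating group A_n (on Fin n) whose order is an odd prime. Then there exists g ∈ A_n such that the subgroup ⟨x, g⁻¹xg⟩ generated by x and its conjugate is not solvable. -/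
open Equiv

/-- In a solvable group, two elements are trivial as soon as they and their product are
annihilated by pairwise coprime exponents. -/
theorem eq_one_of_coprime_pow_eq_one {G : Type*} [Group G] [Group.IsSolvable G] {u v : G} {a b c : ℕ}
    (hab : a.Coprime b) (hac : a.Coprime c) (hbc : b.Coprime c)
    (hu : u ^ a = 1) (hv : v ^ b = 1) (huv : (u * v) ^ c = 1) : u = 1 := by
  set H := Subgroup.closure {u, v} with hH
  have hu' : u ∈ H := Subgroup.subset_closure (by simp)
  have hv' : v ∈ H := Subgroup.subset_closure (by simp)
  have key : ∀ w : H, Abelianization.of w = 1 → (w : G) ∈ ⁅H, H⁆ := by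
    intro w hw
    rw [← Subgroup.map_subtype_commutator]
    refine ⟨w, ?_, rfl⟩
    rw [← Abelianization.ker_of]
    exact hw
  set U : Abelianization H := Abelianization.of ⟨u, hu'⟩ with hU
  set V : Abelianization H := Abelianization.of ⟨v, hv'⟩ with hV
  have hUa : U ^ a = 1 := by
    rw [hU, ← map_pow, show (⟨u, hu'⟩ : H) ^ a = 1 from Subtype.ext hu, map_one]
  have hVb : V ^ b = 1 := by
    rw [hV, ← map_pow, show (⟨v, hv'⟩ : H) ^ b = 1 from Subtype.ext hv, map_one]
  have hUV : U ^ c * V ^ c = 1 := by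
    rw [← mul_pow, hU, hV, ← map_mul, ← map_pow,
      show ((⟨u, hu'⟩ : H) * ⟨v, hv'⟩) ^ c = 1 from Subtype.ext huv, map_one]
  have hUcb : U ^ (b * c) = 1 := by
    rw [mul_comm b c, pow_mul, eq_inv_of_mul_eq_one_left hUV, inv_pow, ← pow_mul, mul_comm c b,
      pow_mul, hVb, one_pow, inv_one]
  have hU1 : U = 1 := by
    have := Nat.Coprime.mul_right hab hac
    have h := pow_gcd_eq_one.2 ⟨hUa, hUcb⟩
    rwa [this.gcd_eq_one, pow_one] at h
  have hV1 : V = 1 := by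
    rw [hU1, one_pow, one_mul] at hUV
    have h := pow_gcd_eq_one.2 ⟨hVb, hUV⟩
    rwa [hbc.gcd_eq_one, pow_one] at h
  by_contra hne
  have hbot : H ≠ ⊥ := fun h => hne (by rw [h] at hu'; exact hu')
  refine (Group.IsSolvable.commutator_lt_of_ne_bot hbot).not_ge ?_
  rw [hH, Subgroup.closure_le]
  rintro w (rfl | rfl)
  · exact key ⟨w, hu'⟩ hU1
  · exact key ⟨w, hv'⟩ hV1

/-- If `x` acts on the image of the support of `h` as `x₀` does, then conjugation by `x` transports
to conjugation by `x₀`. -/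
theorem mul_viaEmbeddingHom_mul_inv {α β : Type*} (f : α ↪ β) (x : Perm β) (x₀ h : Perm α)
    (hx : ∀ i, h i ≠ i → x (f i) = f (x₀ i)) :
    x * Perm.viaEmbeddingHom f h * x⁻¹ = Perm.viaEmbeddingHom f (x₀ * h * x₀⁻¹) := by
  rw [mul_inv_eq_iff_eq_mul]
  ext b
  simp only [Perm.viaEmbeddingHom_apply, Perm.mul_apply]
  by_cases hb : ∃ i, f i = b ∧ h i ≠ i
  · obtain ⟨i, rfl, hi⟩ := hb
    rw [Perm.viaEmbedding_apply, hx i hi, Perm.viaEmbedding_apply,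
      hx (h i) (fun e => hi (h.injective e))]
    simp
  · have h1 : h.viaEmbedding f b = b := by
      by_cases hr : b ∈ Set.range f
      · obtain ⟨i, rfl⟩ := hr
        rw [Perm.viaEmbedding_apply]
        by_contra hi
        exact hb ⟨i, rfl, fun e => hi (by rw [e])⟩
      · exact Perm.viaEmbedding_apply_of_notMem _ _ _ hr
    rw [h1]
    by_cases hr : x b ∈ Set.range f
    · obtain ⟨j, hj⟩ := hr
      rw [← hj, Perm.viaEmbedding_apply]
      congr 1
      by_contra hne
      have hi : h (x₀⁻¹ j) ≠ x₀⁻¹ j := fun e => hne (by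
        rw [Perm.mul_apply, Perm.mul_apply, e, ← Perm.mul_apply, mul_inv_cancel, Perm.one_apply])
      refine hb ⟨x₀⁻¹ j, x.injective ?_, hi⟩
      rw [hx _ hi, ← hj]
      simp
    · exact (Perm.viaEmbedding_apply_of_notMem _ _ _ hr).symm

theorem viaEmbeddingHom_mem_alternatingGroup {α β : Type*} [Fintype α] [DecidableEq α]
    [Fintype β] [DecidableEq β] (f : α ↪ β) {g : Perm α} (hg : g ∈ alternatingGroup α) :
    Perm.viaEmbeddingHom f g ∈ alternatingGroup β := by
  classical
  rw [Perm.mem_alternatingGroup] at hg ⊢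
  rw [← hg]
  convert Perm.sign_extendDomain g (Equiv.ofInjective f.1 f.2)
  rw [Perm.viaEmbeddingHom_apply, Perm.viaEmbedding]
  congr!

/-- A criterion for `x` and a conjugate of `x` to generate a nonsolvable group, reducing the
question to a computation with permutations `x₀` and `g₀` of a smaller set. -/
theorem exists_not_isSolvable_closure_of_embedding {α β : Type*} [Fintype α] [DecidableEq α]
    [Fintype β] [DecidableEq β] (x : alternatingGroup β) (f : α ↪ β) (x₀ g₀ c u v : Perm α)
    (hg₀ : g₀ ∈ alternatingGroup α) (hc : c = g₀⁻¹ * (x₀ * g₀ * x₀⁻¹))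
    (hxg : ∀ i, g₀ i ≠ i → (x : Perm β) (f i) = f (x₀ i))
    (hxc : ∀ i, c i ≠ i → (x : Perm β) (f i) = f (x₀ i))
    (hu : u ∈ Subgroup.closure {c, x₀ * c * x₀⁻¹}) (hv : v ∈ Subgroup.closure {c, x₀ * c * x₀⁻¹})
    (hu1 : u ≠ 1) {k l m : ℕ} (hkl : k.Coprime l) (hkm : k.Coprime m) (hlm : l.Coprime m)
    (huk : u ^ k = 1) (hvl : v ^ l = 1) (huvm : (u * v) ^ m = 1) :
    ∃ g : alternatingGroup β,
      ¬ Group.IsSolvable (Subgroup.closure ({x, g⁻¹ * x * g} : Set (alternatingGroup β))) := by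
  let g : alternatingGroup β :=
    ⟨Perm.viaEmbeddingHom f g₀, viaEmbeddingHom_mem_alternatingGroup f hg₀⟩
  refine ⟨g, fun hsol => hu1 ?_⟩
  set H := Subgroup.closure ({x, g⁻¹ * x * g} : Set (alternatingGroup β)) with hH
  have hxH : x ∈ H := Subgroup.subset_closure (by simp)
  have hyH : g⁻¹ * x * g ∈ H := Subgroup.subset_closure (by simp)
  set φ := Perm.viaEmbeddingHom f with hφ
  let K := (H.map (alternatingGroup β).subtype).comap φ
  have hcK : c ∈ K := by
    refine ⟨g⁻¹ * x * g * x⁻¹, H.mul_mem hyH (H.inv_mem hxH), ?_⟩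
    have h := mul_viaEmbeddingHom_mul_inv f (x : Perm β) x₀ g₀ hxg
    rw [hc, map_mul φ, map_inv φ, hφ, ← h]
    simp [g, mul_assoc]
  have hcK' : x₀ * c * x₀⁻¹ ∈ K := by
    obtain ⟨z, hz, hzc⟩ := hcK
    refine ⟨x * z * x⁻¹, H.mul_mem (H.mul_mem hxH hz) (H.inv_mem hxH), ?_⟩
    rw [← mul_viaEmbeddingHom_mul_inv f (x : Perm β) x₀ c hxc, ← hφ, ← hzc]
    simp
  have hle : Subgroup.closure {c, x₀ * c * x₀⁻¹} ≤ K := by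
    rw [Subgroup.closure_le]
    rintro w (rfl | rfl)
    · exact hcK
    · exact hcK'
  obtain ⟨u', hu', huu⟩ := hle hu
  obtain ⟨v', hv', hvv⟩ := hle hv
  have hinj : Function.Injective (alternatingGroup β).subtype := Subtype.val_injective
  have h1 : (⟨u', hu'⟩ : H) = 1 := by
    refine eq_one_of_coprime_pow_eq_one (v := ⟨v', hv'⟩) hkl hkm hlm ?_ ?_ ?_ <;>
      refine Subtype.ext (hinj ?_) <;> change _ = (1 : Perm β)
    · change (alternatingGroup β).subtype (u' ^ k) = 1
      rw [map_pow, huu, ← map_pow, huk, map_one]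
    · change (alternatingGroup β).subtype (v' ^ l) = 1
      rw [map_pow, hvv, ← map_pow, hvl, map_one]
    · change (alternatingGroup β).subtype ((u' * v') ^ m) = 1
      rw [map_pow, map_mul, huu, hvv, ← map_mul, ← map_pow, huvm, map_one]
  have h2 : u' = 1 := congrArg Subtype.val h1
  rw [h2, map_one] at huu
  exact Perm.viaEmbeddingHom_injective f (huu.symm.trans (map_one _).symm)

set_option maxRecDepth 10000 in
/-- The case of a permutation having an orbit with five distinct consecutive points. -/
theorem exists_not_isSolvable_closure_of_five_points {β : Type*} [Fintype β] [DecidableEq β]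
    (x : alternatingGroup β) (f : Fin 5 ↪ β)
    (hf : ∀ i : Fin 5, i ≠ 4 → (x : Perm β) (f i) = f (i + 1)) :
    ∃ g : alternatingGroup β,
      ¬ Group.IsSolvable (Subgroup.closure ({x, g⁻¹ * x * g} : Set (alternatingGroup β))) := by
  let x₀ : Perm (Fin 5) := finRotate 5
  let g₀ : Perm (Fin 5) := swap 0 1 * swap 1 2
  let c := g₀⁻¹ * (x₀ * g₀ * x₀⁻¹)
  have hc : c ∈ Subgroup.closure {c, x₀ * c * x₀⁻¹} := Subgroup.subset_closure (by simp)
  have hc' : x₀ * c * x₀⁻¹ ∈ Subgroup.closure {c, x₀ * c * x₀⁻¹} :=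
    Subgroup.subset_closure (by simp)
  have hx₀ : ∀ i : Fin 5, i ≠ 4 → (x : Perm β) (f i) = f (x₀ i) := by
    intro i hi
    rw [hf i hi, show x₀ i = i + 1 from finRotate_apply i]
  refine exists_not_isSolvable_closure_of_embedding x f x₀ g₀ c
    c⁻¹ (x₀ * c * x₀⁻¹ * c * (x₀ * c * x₀⁻¹)) (by rw [Perm.mem_alternatingGroup]; decide) rfl
    (fun i hi => hx₀ i ?_) (fun i hi => hx₀ i ?_)
    (inv_mem hc) (mul_mem (mul_mem hc' hc) hc') (by decide) (k := 3) (l := 5) (m := 2)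
    (by decide) (by decide) (by decide) (Equiv.ext (by decide)) (Equiv.ext (by decide))
    (Equiv.ext (by decide))
  · revert i; decide
  · revert i; decide

set_option maxRecDepth 10000 in
/-- The case of a permutation acting on some five points as a 3-cycle. -/
theorem exists_not_isSolvable_closure_of_three_cycle {β : Type*} [Fintype β] [DecidableEq β]
    (x : alternatingGroup β) (f : Fin 5 ↪ β)
    (hf : ∀ i : Fin 5, (x : Perm β) (f i) = f ((swap 0 1 * swap 1 2 : Perm (Fin 5)) i)) :
    ∃ g : alternatingGroup β,
      ¬ Group.IsSolvable (Subgroup.closure ({x, g⁻¹ * x * g} : Set (alternatingGroup β))) := by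
  let x₀ : Perm (Fin 5) := swap 0 1 * swap 1 2
  let g₀ : Perm (Fin 5) := swap 1 3 * swap 2 4
  let c := g₀⁻¹ * (x₀ * g₀ * x₀⁻¹)
  have hc : c ∈ Subgroup.closure {c, x₀ * c * x₀⁻¹} := Subgroup.subset_closure (by simp)
  have hc' : x₀ * c * x₀⁻¹ ∈ Subgroup.closure {c, x₀ * c * x₀⁻¹} :=
    Subgroup.subset_closure (by simp)
  exact exists_not_isSolvable_closure_of_embedding x f x₀ g₀ c
    c⁻¹ (c⁻¹ * (x₀ * c * x₀⁻¹)) (by rw [Perm.mem_alternatingGroup]; decide) rfl (fun i _ => hf i) (fun i _ => hf i)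
    (inv_mem hc) (mul_mem (inv_mem hc) hc') (by decide) (k := 5) (l := 3) (m := 2)
    (by decide) (by decide) (by decide) (Equiv.ext (by decide)) (Equiv.ext (by decide))
    (Equiv.ext (by decide))

set_option maxRecDepth 10000 in
/-- The case of a permutation acting on some six points as a product of two 3-cycles. -/
theorem exists_not_isSolvable_closure_of_two_three_cycles {β : Type*} [Fintype β] [DecidableEq β]
    (x : alternatingGroup β) (f : Fin 6 ↪ β)
    (hf : ∀ i : Fin 6, (x : Perm β) (f i) =
      f ((swap 0 1 * swap 1 2 * (swap 3 4 * swap 4 5) : Perm (Fin 6)) i)) :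
    ∃ g : alternatingGroup β,
      ¬ Group.IsSolvable (Subgroup.closure ({x, g⁻¹ * x * g} : Set (alternatingGroup β))) := by
  let x₀ : Perm (Fin 6) := swap 0 1 * swap 1 2 * (swap 3 4 * swap 4 5)
  let g₀ : Perm (Fin 6) := swap 2 3 * swap 4 5
  let c := g₀⁻¹ * (x₀ * g₀ * x₀⁻¹)
  have hc : c ∈ Subgroup.closure {c, x₀ * c * x₀⁻¹} := Subgroup.subset_closure (by simp)
  have hc' : x₀ * c * x₀⁻¹ ∈ Subgroup.closure {c, x₀ * c * x₀⁻¹} :=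
    Subgroup.subset_closure (by simp)
  exact exists_not_isSolvable_closure_of_embedding x f x₀ g₀ c
    c⁻¹ (c⁻¹ * (x₀ * c * x₀⁻¹)) (by rw [Perm.mem_alternatingGroup]; decide) rfl (fun i _ => hf i) (fun i _ => hf i)
    (inv_mem hc) (mul_mem (inv_mem hc) hc') (by decide) (k := 5) (l := 3) (m := 2)
    (by decide) (by decide) (by decide) (Equiv.ext (by decide)) (Equiv.ext (by decide))
    (Equiv.ext (by decide))

/-- The first five iterates of a point moved by a permutation of prime order `p ≥ 5` are
distinct. -/
theorem injective_pow_apply_of_prime {β : Type*} {x : Perm β} {p : ℕ} (hp : p.Prime) (hp5 : 5 ≤ p)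
    (hx : x ^ p = 1) {a : β} (ha : x a ≠ a) :
    Function.Injective fun i : Fin 5 => (x ^ (i : ℕ)) a := by
  have hper : Function.minimalPeriod x a = p := by
    have hdvd : Function.minimalPeriod x a ∣ p := by
      refine Function.IsPeriodicPt.minimalPeriod_dvd ?_
      rw [Function.IsPeriodicPt, Function.IsFixedPt, ← Perm.coe_pow, hx, Perm.one_apply]
    refine (hp.eq_one_or_self_of_dvd _ hdvd).resolve_left fun h => ha ?_
    exact Function.minimalPeriod_eq_one_iff_isFixedPt.1 h
  intro i j hij
  simp only [Perm.coe_pow] at hij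
  exact Fin.ext (Function.iterate_injOn_Iio_minimalPeriod
    (by simp only [hper, Set.mem_Iio]; omega) (by simp only [hper, Set.mem_Iio]; omega) hij)

theorem exists_not_isSolvable_closure_of_pow_three {β : Type*} [Fintype β] [DecidableEq β]
    (hβ : 5 ≤ Fintype.card β) (x : alternatingGroup β) (hx : (x : Perm β) ^ 3 = 1)
    {a : β} (ha : (x : Perm β) a ≠ a) :
    ∃ g : alternatingGroup β,
      ¬ Group.IsSolvable (Subgroup.closure ({x, g⁻¹ * x * g} : Set (alternatingGroup β))) := by
  set y : Perm β := x.1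
  have hy3 : ∀ b, y (y (y b)) = b := fun b => by
    simpa [pow_succ] using congrArg (fun z : Perm β => z b) hx
  have hinj : ∀ b c, y b = y c → b = c := fun b c h => y.injective h
  have h02 : y (y a) ≠ a := fun h => ha (by simpa [h] using hy3 a)
  have h12 : y (y a) ≠ y a := fun h => ha (hinj _ _ h)
  by_cases hb : ∃ b, b ≠ a ∧ b ≠ y a ∧ b ≠ y (y a) ∧ y b ≠ b
  · obtain ⟨b, hb0, hb1, hb2, hb⟩ := hb
    have k02 : y (y b) ≠ b := fun h => hb (by simpa [h] using hy3 b)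
    have k12 : y (y b) ≠ y b := fun h => hb (hinj _ _ h)
    have l1 : y b ≠ a := fun h => hb2 (by rw [← h, hy3])
    have l2 : y b ≠ y a := fun h => hb0 (hinj _ _ h)
    have l3 : y b ≠ y (y a) := fun h => hb1 (hinj _ _ h)
    have m1 : y (y b) ≠ a := fun h => hb1 (by rw [← h, hy3])
    have m2 : y (y b) ≠ y a := fun h => l1 (hinj _ _ h)
    have m3 : y (y b) ≠ y (y a) := fun h => l2 (hinj _ _ h)
    have hf : Function.Injective ![a, y a, y (y a), b, y b, y (y b)] := by
      intro i j hij
      fin_cases i <;> fin_cases j <;> first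
        | rfl
        | exact absurd hij (by assumption)
        | exact absurd hij.symm (by assumption)
    refine exists_not_isSolvable_closure_of_two_three_cycles x ⟨_, hf⟩ fun i => ?_
    fin_cases i
    exacts [rfl, rfl, hy3 a, rfl, rfl, hy3 b]
  · push Not at hb
    have hcard : 1 < (({a, y a, y (y a)} : Finset β)ᶜ).card := by
      have := Finset.card_le_three (a := a) (b := y a) (c := y (y a))
      rw [Finset.card_compl]
      omega
    obtain ⟨d, hd, e, he, hde⟩ := Finset.one_lt_card.1 hcard
    simp only [Finset.mem_compl, Finset.mem_insert, Finset.mem_singleton, not_or] at hd he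
    obtain ⟨hd0, hd1, hd2⟩ := hd
    obtain ⟨he0, he1, he2⟩ := he
    have hyd := hb d hd0 hd1 hd2
    have hye := hb e he0 he1 he2
    have hf : Function.Injective ![a, y a, y (y a), d, e] := by
      intro i j hij
      fin_cases i <;> fin_cases j <;> first
        | rfl
        | exact absurd hij (by assumption)
        | exact absurd hij.symm (by assumption)
    refine exists_not_isSolvable_closure_of_three_cycle x ⟨_, hf⟩ fun i => ?_
    fin_cases i
    exacts [rfl, rfl, hy3 a, hyd, hye]

theorem alternating_nonsolvable_pair
    (n : ℕ) (hn : 5 ≤ n) (x : alternatingGroup (Fin n)) (p : ℕ)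
    (hp : p.Prime) (hodd : Odd p) (hx : orderOf x = p) :
    ∃ g : alternatingGroup (Fin n),
      ¬ IsSolvable ↥(Subgroup.closure
        ({x, g⁻¹ * x * g} : Set (alternatingGroup (Fin n)))) := by
  have hxp : (x : Perm (Fin n)) ^ p = 1 := by
    rw [← Subgroup.coe_pow, ← hx, pow_orderOf_eq_one, Subgroup.coe_one]
  obtain ⟨a, ha⟩ : ∃ a, (x : Perm (Fin n)) a ≠ a := by
    by_contra! h
    have : x = 1 := Subtype.ext (Equiv.ext h)
    rw [this, orderOf_one] at hx
    exact hp.ne_one hx.symm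
  by_cases hp5 : 5 ≤ p
  · refine exists_not_isSolvable_closure_of_five_points x
      ⟨_, injective_pow_apply_of_prime hp hp5 hxp ha⟩ fun i hi => ?_
    have : ((i + 1 : Fin 5) : ℕ) = i + 1 := by revert i; decide
    simp [this, pow_succ']
  · have hp3 : p = 3 := by
      have := hp.two_le
      interval_cases p <;> revert hodd <;> decide +revert
    exact exists_not_isSolvable_closure_of_pow_three (by simpa using hn) x (hp3 ▸ hxp) ha
end
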